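/- arXiv:1602.02609 — 2 statements merged into one kernel-verified Lean document; each statement's English description precedes it below -/
import Mathlib

section
/- Let n be a positive integer, let K be a compact metric space with dim_T K ≥ n, and let dim_* be one of dim_T, dim_H, dim_P. Then for a generic f ∈ C(K,ℝⁿ) the supremum is attained: there exists y ∈ ℝⁿ with dim_* f⁻¹(y) = d^n_*(K), and dim_* f⁻¹(y) ≤ d^n_*(K) for all y ∈ ℝⁿ; that is, max{dim_* f⁻¹(y) : y ∈ ℝⁿ} = d^n_*(K). -/
open Set Metric Filter Topology TopologicalSpace
open scoped ENNReal NNReal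

noncomputable section

universe u

/-- `indBelow n X` means that the small inductive (topological) dimension of `X`
is at most `n - 1`; in particular `indBelow 0 X` means `X = ∅`. -/
def indBelow : ℕ → ∀ (X : Type u) [TopologicalSpace X], Prop
  | 0, X, _ => IsEmpty X
  | n + 1, X, inst =>
      letI := inst
      ∀ (x : X) (U : Set X), IsOpen U → x ∈ U →
        ∃ V : Set X, IsOpen V ∧ x ∈ V ∧ V ⊆ U ∧ indBelow n ↥(frontier V)

/-- The small inductive (topological) dimension, with values in `EReal`:
`-1` for the empty space and `⊤` if there is no finite bound. -/
def indDim (X : Type u) [TopologicalSpace X] : EReal :=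
  sInf {d : EReal | ∃ n : ℕ, indBelow n X ∧ d = (n : EReal) - 1}

variable {X : Type u} [MetricSpace X]

/-- Topological dimension of a subset of a metric space. -/
def tdim (A : Set X) : EReal := indDim ↥A

open Classical in
/-- Hausdorff dimension of a subset of a metric space,
with the convention `dim ∅ = -1`. -/
def hdim (A : Set X) : EReal := if A = ∅ then -1 else ((dimH A : ℝ≥0∞) : EReal)

/-- A `δ`-packing of `A`: a countable family of pairwise disjoint closed balls
with centers in `A` and radii at most `δ`. -/
def IsPacking (A : Set X) (δ : ℝ≥0) (s : Set (X × ℝ≥0)) : Prop :=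
  s.Countable ∧ (∀ p ∈ s, p.1 ∈ A ∧ p.2 ≤ δ) ∧
    s.Pairwise fun p q => Disjoint (closedBall p.1 (p.2 : ℝ)) (closedBall q.1 (q.2 : ℝ))

/-- The packing pre-measure `P^h_δ(A)`. -/
def packPre (h : ℝ≥0 → ℝ≥0) (A : Set X) (δ : ℝ≥0) : ℝ≥0∞ :=
  ⨆ (s : Set (X × ℝ≥0)) (_ : IsPacking A δ s), ∑' p : s, ((h p.1.2 : ℝ≥0) : ℝ≥0∞)

/-- The packing pre-measure (packing number) `P^h₀(A) = lim_{δ → 0+} P^h_δ(A)`. -/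
def packPre0 (h : ℝ≥0 → ℝ≥0) (A : Set X) : ℝ≥0∞ :=
  ⨅ (δ : ℝ≥0) (_ : 0 < δ), packPre h A δ

/-- The `h`-packing measure `𝒫^h(A)`. -/
def packMeasure (h : ℝ≥0 → ℝ≥0) (A : Set X) : ℝ≥0∞ :=
  ⨅ (c : ℕ → Set X) (_ : A = ⋃ i, c i), ∑' i, packPre0 h (c i)

open Classical in
/-- The packing dimension, with the convention `dim ∅ = -1`. -/
def pdim (A : Set X) : EReal :=
  if A = ∅ then -1
  else max 0 (⨆ (s : ℝ≥0) (_ : packMeasure (fun r => r ^ (s : ℝ)) A = ∞), ((s : ℝ) : EReal))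

/-- The restriction of the packing measure `𝒫^h` to `A` is σ-finite. -/
def PackSigmaFiniteOn (h : ℝ≥0 → ℝ≥0) (A : Set X) : Prop :=
  ∃ c : ℕ → Set X, A ⊆ ⋃ i, c i ∧ ∀ i, packMeasure h (A ∩ c i) < ∞

/-- The generalized Hausdorff measure `ℋ^h(A)` associated to a gauge function `h`. -/
def hMeasure (h : ℝ≥0 → ℝ≥0) (A : Set X) : ℝ≥0∞ :=
  ⨆ (δ : ℝ≥0) (_ : 0 < δ),
    ⨅ (c : ℕ → Set X) (_ : A ⊆ ⋃ i, c i) (_ : ∀ i, EMetric.diam (c i) ≤ (δ : ℝ≥0∞)),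
      ∑' i, ((h (EMetric.diam (c i)).toNNReal : ℝ≥0) : ℝ≥0∞)

/-- `F` is an `F_σ` subset of the subspace `A`. -/
def IsFSigmaIn (F A : Set X) : Prop :=
  ∃ C : ℕ → Set X, (∀ i, IsClosed (C i)) ∧ F = ⋃ i, C i ∩ A

/-- `d^n_*(A) = inf {dim_*(A ∖ F) : F ⊆ A is F_σ in A and dim_T F ≤ n - 1}`. -/
def dStar (dim : Set X → EReal) (n : ℕ) (A : Set X) : EReal :=
  sInf {d : EReal |
    ∃ F : Set X, IsFSigmaIn F A ∧ tdim F ≤ (n : EReal) - 1 ∧ d = dim (A \ F)}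

end

namespace FiberDim

universe u

section ZeroDimensional

/-- Disjoint closed sets can be separated by a clopen set. -/
def HasClopenSep (X : Type u) [TopologicalSpace X] : Prop :=
  ∀ E F : Set X, IsClosed E → IsClosed F → Disjoint E F → ∃ C, IsClopen C ∧ E ⊆ C ∧ Disjoint C F

theorem hasClopenSep_of_local {X : Type u} [TopologicalSpace X] [SecondCountableTopology X]
    (h : ∀ (x : X) (U : Set X), IsOpen U → x ∈ U → ∃ V, IsClopen V ∧ x ∈ V ∧ V ⊆ U) :
    HasClopenSep X := by
  intro E F hE hF hEF
  rcases isEmpty_or_nonempty X with hX | hX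
  · exact ⟨univ, isClopen_univ, subset_univ _, by
      rw [Set.eq_empty_of_isEmpty F]; exact disjoint_bot_right⟩
  have h1 : ∀ x : X, ∃ V, IsClopen V ∧ x ∈ V ∧ (Disjoint V E ∨ Disjoint V F) := by
    intro x
    by_cases hx : x ∈ E
    · obtain ⟨V, hV, hxV, hVU⟩ := h x Fᶜ hF.isOpen_compl (disjoint_left.1 hEF hx)
      exact ⟨V, hV, hxV, Or.inr (subset_compl_iff_disjoint_right.1 hVU)⟩
    · obtain ⟨V, hV, hxV, hVU⟩ := h x Eᶜ hE.isOpen_compl hx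
      exact ⟨V, hV, hxV, Or.inl (subset_compl_iff_disjoint_right.1 hVU)⟩
  choose V hV hxV hVd using h1
  obtain ⟨s, hs, hsU⟩ := TopologicalSpace.countable_cover_nhds
    (f := V) fun x => (hV x).isOpen.mem_nhds (hxV x)
  have hsne : s.Nonempty := by
    rcases s.eq_empty_or_nonempty with rfl | h
    · simp at hsU
      exact (hX.elim fun x => (Set.eq_empty_iff_forall_notMem.1 hsU.symm x (mem_univ x)).elim)
    · exact h
  obtain ⟨x, rfl⟩ := hs.exists_eq_range hsne
  set W : ℕ → Set X := disjointed fun k => V (x k) with hW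
  have hWc : ∀ k, IsClopen (W k) := fun k =>
    disjointedRec (p := IsClopen) (fun t i ht => ht.diff (hV (x i))) (hV (x k))
  have hWsub : ∀ k, W k ⊆ V (x k) := fun k => disjointed_subset _ k
  have hWU : ⋃ k, W k = univ := by
    rw [hW, iUnion_disjointed, ← hsU]; simp
  have hWd : Pairwise fun i j => Disjoint (W i) (W j) := disjoint_disjointed _
  have hmem : ∀ z, ∃ k, z ∈ W k := fun z => mem_iUnion.1 (hWU ▸ mem_univ z)
  refine ⟨⋃ k ∈ {k | Disjoint (V (x k)) F}, W k, ⟨?_, ?_⟩, ?_, ?_⟩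
  · have : (⋃ k ∈ {k | Disjoint (V (x k)) F}, W k) = (⋃ k ∈ {k | ¬ Disjoint (V (x k)) F}, W k)ᶜ := by
      ext z
      obtain ⟨k, hk⟩ := hmem z
      have huniq : ∀ j, z ∈ W j → j = k := fun j hj => by
        by_contra hne
        exact disjoint_left.1 (hWd hne) hj hk
      simp only [mem_iUnion, mem_compl_iff, mem_ofPred_eq, exists_prop, not_exists, not_and]
      constructor
      · rintro ⟨j, hj, hz⟩ i hi hzi
        rw [huniq j hz] at hj; rw [huniq i hzi] at hi; exact hi hj
      · intro hh
        exact ⟨k, by_contra fun hc => hh k hc hk, hk⟩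
    rw [this]
    exact (isOpen_biUnion fun k _ => (hWc k).isOpen).isClosed_compl
  · exact isOpen_biUnion fun k _ => (hWc k).isOpen
  · intro z hz
    obtain ⟨k, hk⟩ := hmem z
    refine mem_biUnion (x := k) ?_ hk
    rcases hVd (x k) with h | h
    · exact (disjoint_left.1 h (hWsub k hk) hz).elim
    · exact h
  · rw [disjoint_left]
    rintro z hz hzF
    obtain ⟨k, hk, hzk⟩ := mem_iUnion₂.1 hz
    exact disjoint_left.1 hk (hWsub k hzk) hzF

theorem exists_open_disjoint_closure {X : Type u} [TopologicalSpace X] [NormalSpace X]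
    {A B : Set X} (hA : IsClosed A) (hB : IsClosed B) (hAB : Disjoint A B) :
    ∃ U W, IsOpen U ∧ IsOpen W ∧ A ⊆ U ∧ B ⊆ W ∧ Disjoint (closure U) (closure W) := by
  obtain ⟨U, hU, hAU, hUB⟩ := normal_exists_closure_subset hA hB.isOpen_compl
    (subset_compl_iff_disjoint_right.2 hAB)
  obtain ⟨W, hW, hBW, hWU⟩ := normal_exists_closure_subset hB isClosed_closure.isOpen_compl
    (subset_compl_comm.1 hUB)
  exact ⟨U, W, hU, hW, hAU, hBW, (subset_compl_iff_disjoint_right.1 hWU).symm⟩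

theorem hasClopenSep_of_closed_cover {X : Type u} [TopologicalSpace X] [NormalSpace X]
    (D : ℕ → Set X) (hDU : ⋃ j, D j = univ)
    (hD : ∀ j, ∀ E F : Set X, IsClosed E → IsClosed F → Disjoint E F →
      ∃ P ⊆ D j, IsClosed P ∧ IsClosed (D j \ P) ∧ E ∩ D j ⊆ P ∧ Disjoint P F) :
    HasClopenSep X := by
  intro E F hE hF hEF
  let T := {p : Set X × Set X // IsOpen p.1 ∧ IsOpen p.2 ∧ Disjoint (closure p.1) (closure p.2)}
  have step : ∀ (j : ℕ) (p : T), ∃ q : T, p.1.1 ⊆ q.1.1 ∧ p.1.2 ⊆ q.1.2 ∧ D j ⊆ q.1.1 ∪ q.1.2 := by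
    rintro j ⟨⟨U, W⟩, hU, hW, hUW⟩
    obtain ⟨P, hPD, hP, hPc, hUP, hPW⟩ := hD j (closure U) (closure W) isClosed_closure
      isClosed_closure hUW
    have hdis : Disjoint (closure U ∪ P) (closure W ∪ (D j \ P)) := by
      rw [disjoint_left]
      rintro z (hz | hz) (hz' | hz')
      · exact disjoint_left.1 hUW hz hz'
      · exact hz'.2 (hUP ⟨hz, hz'.1⟩)
      · exact disjoint_left.1 hPW hz hz'
      · exact hz'.2 hz
    obtain ⟨U', W', hU', hW', hUU', hWW', hd⟩ := exists_open_disjoint_closure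
      (isClosed_closure.union hP) (isClosed_closure.union hPc) hdis
    refine ⟨⟨⟨U', W'⟩, hU', hW', hd⟩, ?_, ?_, ?_⟩
    · exact subset_closure.trans (subset_union_left.trans hUU')
    · exact subset_closure.trans (subset_union_left.trans hWW')
    · intro z hz
      by_cases hzP : z ∈ P
      · exact Or.inl (hUU' (Or.inr hzP))
      · exact Or.inr (hWW' (Or.inr ⟨hz, hzP⟩))
  choose next hn1 hn2 hn3 using step
  obtain ⟨U0, W0, hU0, hW0, hEU, hFW, hd0⟩ := exists_open_disjoint_closure hE hF hEF
  let s : ℕ → T := fun k => Nat.rec ⟨⟨U0, W0⟩, hU0, hW0, hd0⟩ (fun j p => next j p) k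
  have hs : ∀ k, s (k + 1) = next k (s k) := fun k => rfl
  have m1 : Monotone fun k => (s k).1.1 := monotone_nat_of_le_succ fun k => by
    rw [hs]; exact hn1 k (s k)
  have m2 : Monotone fun k => (s k).1.2 := monotone_nat_of_le_succ fun k => by
    rw [hs]; exact hn2 k (s k)
  have hdis : Disjoint (⋃ k, (s k).1.1) (⋃ k, (s k).1.2) := by
    rw [disjoint_left]
    intro z hz hz'
    obtain ⟨i, hi⟩ := mem_iUnion.1 hz
    obtain ⟨j, hj⟩ := mem_iUnion.1 hz'
    exact disjoint_left.1 (s (max i j)).2.2.2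
      (subset_closure (m1 (le_max_left i j) hi)) (subset_closure (m2 (le_max_right i j) hj))
  have hcov : (⋃ k, (s k).1.1) = (⋃ k, (s k).1.2)ᶜ := by
    refine Subset.antisymm (subset_compl_iff_disjoint_right.2 hdis) ?_
    intro z hz
    obtain ⟨j, hj⟩ := mem_iUnion.1 (hDU.symm ▸ mem_univ z : z ∈ ⋃ j, D j)
    rcases hn3 j (s j) hj with h | h
    · exact mem_iUnion.2 ⟨j + 1, h⟩
    · exact (hz (mem_iUnion.2 ⟨j + 1, h⟩)).elim
  refine ⟨⋃ k, (s k).1.1, ⟨?_, isOpen_iUnion fun k => (s k).2.1⟩, ?_, ?_⟩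
  · rw [hcov]; exact (isOpen_iUnion fun k => (s k).2.2.1).isClosed_compl
  · exact hEU.trans (subset_iUnion (fun k => (s k).1.1) 0)
  · exact hdis.mono_right (hFW.trans (subset_iUnion (fun k => (s k).1.2) 0))

/-- A subset of a space is zero-dimensional in it if the space has a basis of open sets whose
frontiers miss the subset. -/
def ZD {K : Type u} [TopologicalSpace K] (Z : Set K) : Prop :=
  ∀ (x : K) (U : Set K), IsOpen U → x ∈ U →
    ∃ V, IsOpen V ∧ x ∈ V ∧ V ⊆ U ∧ Disjoint (frontier V) Z

theorem ZD.mono {K : Type u} [TopologicalSpace K] {Z Z' : Set K} (h : ZD Z) (hZ : Z' ⊆ Z) :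
    ZD Z' := fun x U hU hx =>
  let ⟨V, h1, h2, h3, h4⟩ := h x U hU hx
  ⟨V, h1, h2, h3, h4.mono_right hZ⟩

theorem zd_of_hasClopenSep {K : Type u} [TopologicalSpace K] [T5Space K] {Z : Set K}
    (h : HasClopenSep ↥Z) : ZD Z := by
  intro x U hU hxU
  obtain ⟨U1, U2, hU1, hU2, hxU1, hUU2, hd⟩ := exists_open_disjoint_closure
    (isClosed_singleton (x := x)) hU.isClosed_compl (by simpa using hxU)
  obtain ⟨C, hC, h1C, hC2⟩ := h (Subtype.val ⁻¹' closure U1) (Subtype.val ⁻¹' closure U2)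
    (isClosed_closure.preimage continuous_subtype_val)
    (isClosed_closure.preimage continuous_subtype_val) (hd.preimage _)
  set P : Set K := Subtype.val '' C with hP
  set Q : Set K := Subtype.val '' Cᶜ with hQ
  have hPQ : ∀ D : Set ↥Z, IsClosed D → ∀ z, z ∈ closure (Subtype.val '' D : Set K) → 
      z ∉ (Subtype.val '' Dᶜ : Set K) := by
    rintro D hD _ hz ⟨z, hzD, rfl⟩
    exact hzD (hD.closure_eq ▸ closure_subtype.2 hz)
  have hPU : Disjoint P U2 := by
    rw [disjoint_left]
    rintro _ ⟨z, hz, rfl⟩ hz2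
    exact disjoint_left.1 hC2 hz (subset_closure hz2)
  have hQU : Disjoint Q U1 := by
    rw [disjoint_left]
    rintro _ ⟨z, hz, rfl⟩ hz2
    exact hz (h1C (subset_closure hz2 : (z : K) ∈ closure U1))
  have hxU2 : Disjoint ({x} : Set K) Uᶜ := by simpa using hxU
  have s1 : Disjoint (closure ({x} ∪ P)) (Uᶜ ∪ Q) := by
    rw [closure_union, closure_singleton]
    rw [disjoint_left]
    rintro z (hz | hz) (hz' | hz')
    · exact disjoint_left.1 hxU2 hz hz'
    · exact disjoint_left.1 hQU hz' (hxU1 hz)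
    · exact disjoint_left.1 (hPU.closure_left hU2) hz (hUU2 hz')
    · exact hPQ C hC.isClosed z hz hz'
  have s2 : Disjoint ({x} ∪ P) (closure (Uᶜ ∪ Q)) := by
    rw [closure_union, hU.isClosed_compl.closure_eq, disjoint_left]
    rintro z (hz | hz) (hz' | hz')
    · exact disjoint_left.1 hxU2 hz hz'
    · exact disjoint_left.1 (hQU.closure_left hU1) hz' (hxU1 hz)
    · exact disjoint_left.1 hPU hz (hUU2 hz')
    · exact hPQ Cᶜ hC.compl.isClosed z hz' (by rwa [compl_compl])
  obtain ⟨V, W, hV, hW, hSV, hTW, hVW⟩ := separatedNhds_iff_disjoint.2 (completely_normal s1 s2)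
  refine ⟨V, hV, hSV (Or.inl rfl), ?_, ?_⟩
  · intro z hz
    by_contra hzU
    exact disjoint_left.1 hVW hz (hTW (Or.inl hzU))
  · rw [disjoint_left]
    intro z hz hzZ
    rw [hV.frontier_eq] at hz
    by_cases hzC : (⟨z, hzZ⟩ : ↥Z) ∈ C
    · exact hz.2 (hSV (Or.inr ⟨_, hzC, rfl⟩))
    · exact disjoint_left.1 (hVW.closure_left hW) hz.1 (hTW (Or.inr ⟨_, hzC, rfl⟩))

theorem ZD.hasClopenSep {K : Type u} [TopologicalSpace K] [SecondCountableTopology K] {Z : Set K}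
    (h : ZD Z) : HasClopenSep ↥Z := by
  refine hasClopenSep_of_local ?_
  rintro x _ ⟨U, hU, rfl⟩ hx
  obtain ⟨V, hV, hxV, hVU, hd⟩ := h x U hU hx
  refine ⟨Subtype.val ⁻¹' V, ⟨?_, hV.preimage continuous_subtype_val⟩, hxV, preimage_mono hVU⟩
  rw [← frontier_subset_iff_isClosed]
  intro z hz
  have := continuous_subtype_val.frontier_preimage_subset V hz
  exact (disjoint_left.1 hd this z.2).elim

theorem zd_of_closed_cover {K : Type u} [TopologicalSpace K] [T5Space K]
    [SecondCountableTopology K] (S : Set K) (D : ℕ → Set K) (hDc : ∀ j, IsClosed (D j))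
    (hS : S ⊆ ⋃ j, D j) (h : ∀ j, ZD (S ∩ D j)) : ZD S := by
  refine zd_of_hasClopenSep ?_
  refine hasClopenSep_of_closed_cover (fun j => Subtype.val ⁻¹' D j) ?_ ?_
  · rw [← preimage_iUnion, eq_univ_iff_forall]
    exact fun z => hS z.2
  · intro j E F hE hF hEF
    have hcs := (h j).hasClopenSep
    let ι : ↥(S ∩ D j) → ↥S := inclusion inter_subset_left
    have hι : IsClosedEmbedding ι := by
      refine ⟨IsEmbedding.inclusion _, ?_⟩
      rw [range_inclusion]
      have : {x : ↥S | (x : K) ∈ S ∩ D j} = Subtype.val ⁻¹' D j := by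
        ext z; simp
      rw [this]
      exact (hDc j).preimage continuous_subtype_val
    obtain ⟨C, hC, hEC, hCF⟩ := hcs (ι ⁻¹' E) (ι ⁻¹' F) (hE.preimage hι.continuous)
      (hF.preimage hι.continuous) (hEF.preimage ι)
    have hcompl : (Subtype.val ⁻¹' D j : Set ↥S) \ ι '' C = ι '' Cᶜ := by
      ext z
      constructor
      · rintro ⟨hz, hzC⟩
        exact ⟨⟨z, z.2, hz⟩, fun hc => hzC ⟨_, hc, rfl⟩, rfl⟩
      · rintro ⟨w, hw, rfl⟩
        refine ⟨w.2.2, ?_⟩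
        rintro ⟨w', hw', he⟩
        exact hw (hι.injective he ▸ hw')
    refine ⟨ι '' C, ?_, hι.isClosedMap _ hC.isClosed, ?_, ?_, ?_⟩
    · rintro _ ⟨w, -, rfl⟩; exact w.2.2
    · rw [hcompl]; exact hι.isClosedMap _ hC.compl.isClosed
    · rintro z ⟨hz, hzD⟩
      exact ⟨⟨z, z.2, hzD⟩, hEC hz, rfl⟩
    · rw [disjoint_left]
      rintro _ ⟨w, hw, rfl⟩ hF'
      exact disjoint_left.1 hCF hw hF'

end ZeroDimensional

section

section Inductive

theorem indBelow_of_isEmbedding : ∀ (n : ℕ) {X Y : Type u} [TopologicalSpace X]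
    [TopologicalSpace Y] {e : Y → X}, IsEmbedding e → indBelow n X → indBelow n Y
  | 0, X, Y, _, _, e, _, h => by
      have : IsEmpty X := h
      exact (Function.isEmpty e : IsEmpty Y)
  | n + 1, X, Y, _, _, e, he, h => by
      intro y U hU hy
      obtain ⟨U', hU', rfl⟩ := he.isOpen_iff.1 hU
      obtain ⟨V, hV, hyV, hVU, hfr⟩ := h (e y) U' hU' hy
      refine ⟨e ⁻¹' V, hV.preimage he.continuous, hyV, preimage_mono hVU, ?_⟩
      have hmaps : MapsTo e (frontier (e ⁻¹' V)) (frontier V) :=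
        fun z hz => he.continuous.frontier_preimage_subset V hz
      refine indBelow_of_isEmbedding n (e := hmaps.restrict) ?_ hfr
      exact he.restrict hmaps

theorem indBelow_succ : ∀ (n : ℕ) {X : Type u} [TopologicalSpace X], indBelow n X →
    indBelow (n + 1) X
  | 0, X, _, h => fun x => ((h : IsEmpty X).false x).elim
  | n + 1, X, _, h => by
      intro x U hU hx
      obtain ⟨V, hV, hxV, hVU, hfr⟩ := h x U hU hx
      exact ⟨V, hV, hxV, hVU, indBelow_succ n hfr⟩

theorem indBelow_mono {m n : ℕ} (hmn : m ≤ n) {X : Type u} [TopologicalSpace X]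
    (h : indBelow m X) : indBelow n X := by
  induction hmn with
  | refl => exact h
  | step _ ih => exact indBelow_succ _ ih

theorem indBelow_subset {K : Type u} [TopologicalSpace K] {A B : Set K} {n : ℕ} (hAB : A ⊆ B)
    (h : indBelow n ↥B) : indBelow n ↥A :=
  indBelow_of_isEmbedding n (IsEmbedding.inclusion hAB) h

/-- The set is covered by `n` zero-dimensional sets. -/
def Dec {K : Type u} [TopologicalSpace K] (n : ℕ) (A : Set K) : Prop :=
  ∃ Z : Fin n → Set K, (∀ i, ZD (Z i)) ∧ A ⊆ ⋃ i, Z i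

theorem Dec.mono {K : Type u} [TopologicalSpace K] {n : ℕ} {A B : Set K} (h : Dec n B)
    (hAB : A ⊆ B) : Dec n A :=
  let ⟨Z, hZ, hB⟩ := h
  ⟨Z, hZ, hAB.trans hB⟩

theorem Dec.indBelow : ∀ {n : ℕ} {K : Type u} [TopologicalSpace K] {A : Set K}, Dec n A →
    indBelow n ↥A
  | 0, K, _, A, ⟨Z, _, hA⟩ => by
      have : A = ∅ := by simpa using hA
      subst this
      exact (inferInstance : IsEmpty ↥(∅ : Set K))
  | n + 1, K, _, A, ⟨Z, hZ, hA⟩ => by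
      rintro x _ ⟨U, hU, rfl⟩ hx
      obtain ⟨V, hV, hxV, hVU, hd⟩ := hZ 0 x U hU hx
      refine ⟨Subtype.val ⁻¹' V, hV.preimage continuous_subtype_val, hxV, preimage_mono hVU, ?_⟩
      set B : Set ↥A := frontier (Subtype.val ⁻¹' V)
      have hB : Dec n (Subtype.val '' B : Set K) := by
        refine ⟨fun i => Z i.succ, fun i => hZ _, ?_⟩
        rintro _ ⟨z, hz, rfl⟩
        obtain ⟨i, hi⟩ := mem_iUnion.1 (hA z.2)
        induction i using Fin.cases with
        | zero =>
          exact (disjoint_left.1 hd (continuous_subtype_val.frontier_preimage_subset V hz) hi).elim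
        | succ i => exact mem_iUnion.2 ⟨i, hi⟩
      have hmaps : MapsTo (Subtype.val : ↥A → K) B (Subtype.val '' B) := mapsTo_image _ _
      exact indBelow_of_isEmbedding n (e := hmaps.restrict)
        (IsEmbedding.subtypeVal.restrict hmaps) hB.indBelow

section Metric

variable {K : Type u} [MetricSpace K] [SecondCountableTopology K]

theorem Dec.of_closed_cover {n : ℕ} {A : Set K} (D : ℕ → Set K) (hDc : ∀ j, IsClosed (D j))
    (hA : A ⊆ ⋃ j, D j) (h : ∀ j, Dec n (A ∩ D j)) : Dec n A := by
  choose Z hZ hAZ using h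
  have hR : ∀ j, ∃ F : ℕ → Set K, (∀ m, IsClosed (F m)) ∧ disjointed D j = ⋃ m, F m := by
    intro j
    have ho : IsOpen (⋃ i ∈ Finset.range j, D i)ᶜ := by
      refine IsClosed.isOpen_compl (self := ?_)
      exact isClosed_biUnion_finset fun i _ => hDc i
    obtain ⟨F, hF, -, hFU, -⟩ := ho.exists_iUnion_isClosed
    refine ⟨fun m => D j ∩ F m, fun m => (hDc j).inter (hF m), ?_⟩
    rw [← inter_iUnion, hFU, disjointed_apply, ← sdiff_eq]
    congr 1
    ext z; simp [Finset.sup_eq_iSup]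
  choose F hFc hFU using hR
  refine ⟨fun i => ⋃ j, Z j i ∩ disjointed D j, ?_, ?_⟩
  · intro i
    refine zd_of_closed_cover _ (fun k => F k.unpair.1 k.unpair.2) (fun k => hFc _ _) ?_ ?_
    · intro z hz
      obtain ⟨j, -, hj⟩ := mem_iUnion.1 hz
      rw [hFU] at hj
      obtain ⟨m, hm⟩ := mem_iUnion.1 hj
      exact mem_iUnion.2 ⟨Nat.pair j m, by simpa using hm⟩
    · intro k
      refine (hZ k.unpair.1 i).mono ?_
      rintro z ⟨hz, hzF⟩
      obtain ⟨j, hjZ, hj⟩ := mem_iUnion.1 hz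
      have h2 : z ∈ disjointed D k.unpair.1 := by
        rw [hFU]; exact mem_iUnion.2 ⟨_, hzF⟩
      have : j = k.unpair.1 := by
        by_contra hne
        exact disjoint_left.1 (disjoint_disjointed D hne) hj h2
      rwa [← this]
  · intro z hz
    have : z ∈ ⋃ j, disjointed D j := by rw [iUnion_disjointed]; exact hA hz
    obtain ⟨j, hj⟩ := mem_iUnion.1 this
    obtain ⟨i, hi⟩ := mem_iUnion.1 (hAZ j ⟨hz, disjointed_subset D j hj⟩)
    exact mem_iUnion.2 ⟨i, mem_iUnion.2 ⟨j, hi, hj⟩⟩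

theorem dec_of_indBelow : ∀ {n : ℕ} {A : Set K}, indBelow n ↥A → Dec n A
  | 0, A, h => by
      refine ⟨fun i => i.elim0, fun i => i.elim0, fun z hz => ((h : IsEmpty ↥A).false ⟨z, hz⟩).elim⟩
  | n + 1, A, h => by
      have hb : IsTopologicalBasis {V : Set ↥A | IsOpen V ∧ indBelow n ↥(frontier V)} :=
        isTopologicalBasis_of_isOpen_of_nhds (fun V hV => hV.1) fun x U hx hU =>
          let ⟨V, h1, h2, h3, h4⟩ := h x U hU hx
          ⟨V, ⟨h1, h4⟩, h2, h3⟩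
      obtain ⟨s, hs, hsc, hsb⟩ := hb.exists_countable
      have hc : ∀ V ∈ s, Dec n (Subtype.val '' frontier V : Set K) := by
        intro V hV
        refine dec_of_indBelow (indBelow_of_isEmbedding n
          (X := ↥(frontier V)) (e := fun z => ⟨⟨z, ?_⟩, ?_⟩) ?_ (hs hV).2)
        · obtain ⟨_, w, hw, rfl⟩ := z; exact w.2
        · obtain ⟨_, w, hw, rfl⟩ := z; exact hw
        · refine IsEmbedding.of_comp (g := fun z : ↥(frontier V) => ((z : ↥A) : K)) ?_ ?_ ?_
          · refine Continuous.subtype_mk (Continuous.subtype_mk continuous_subtype_val _) _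
          · exact continuous_subtype_val.comp continuous_subtype_val
          · exact IsEmbedding.subtypeVal
      set B : Set K := ⋃ V ∈ s, Subtype.val '' frontier V with hB
      have hBdec : Dec n B := by
        rcases s.eq_empty_or_nonempty with rfl | hne
        · refine ⟨fun _ => ∅, fun i x U hU hx => ⟨U, hU, hx, Subset.rfl, disjoint_bot_right⟩, ?_⟩
          simp [hB]
        obtain ⟨V, rfl⟩ := hsc.exists_eq_range hne
        refine Dec.of_closed_cover (fun j => closure (Subtype.val '' frontier (V j)))
          (fun j => isClosed_closure) ?_ ?_
        · intro z hz
          obtain ⟨_, ⟨j, rfl⟩, hz⟩ := mem_iUnion₂.1 hz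
          exact mem_iUnion.2 ⟨j, subset_closure hz⟩
        · intro j
          refine (hc (V j) ⟨j, rfl⟩).mono ?_
          rintro z ⟨hz, hzj⟩
          obtain ⟨_, -, w, -, rfl⟩ := mem_iUnion₂.1 hz
          refine ⟨w, ?_, rfl⟩
          rw [← (isClosed_frontier (s := V j)).closure_eq]
          exact closure_subtype.2 hzj
      have hZ : ZD (A \ B) := by
        refine zd_of_hasClopenSep (hasClopenSep_of_local ?_)
        intro x U hU hx
        let ι : ↥(A \ B) → ↥A := inclusion sdiff_subset
        have hι : IsEmbedding ι := IsEmbedding.inclusion _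
        obtain ⟨U', hU', rfl⟩ := hι.isOpen_iff.1 hU
        obtain ⟨V, hV, hxV, hVU⟩ := hsb.exists_subset_of_mem_open (a := ι x) hx hU'
        refine ⟨ι ⁻¹' V, ⟨?_, (hs hV).1.preimage hι.continuous⟩, hxV, preimage_mono hVU⟩
        rw [← frontier_subset_iff_isClosed]
        intro z hz
        have := hι.continuous.frontier_preimage_subset V hz
        exact (z.2.2 (mem_iUnion₂.2 ⟨V, hV, ι z, this, rfl⟩)).elim
      obtain ⟨Z, hZ', hBZ⟩ := hBdec
      refine ⟨Fin.cons (A \ B) Z, ?_, ?_⟩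
      · intro i
        induction i using Fin.cases with
        | zero => exact hZ
        | succ i => exact hZ' i
      · intro z hz
        by_cases hzB : z ∈ B
        · obtain ⟨i, hi⟩ := mem_iUnion.1 (hBZ hzB)
          exact mem_iUnion.2 ⟨i.succ, hi⟩
        · exact mem_iUnion.2 ⟨0, hz, hzB⟩

/-- A zero-dimensional set is contained in a zero-dimensional `G_δ` set, written here as the
complement of a countable union of closed sets. -/
theorem ZD.exists_gdelta {Z : Set K} (h : ZD Z) :
    ∃ C : ℕ → Set K, (∀ i, IsClosed (C i)) ∧ Z ⊆ (⋃ i, C i)ᶜ ∧ ZD (⋃ i, C i)ᶜ := by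
  have hb : IsTopologicalBasis {V : Set K | IsOpen V ∧ Disjoint (frontier V) Z} :=
    isTopologicalBasis_of_isOpen_of_nhds (fun V hV => hV.1) fun x U hx hU =>
      let ⟨V, h1, h2, h3, h4⟩ := h x U hU hx
      ⟨V, ⟨h1, h4⟩, h2, h3⟩
  obtain ⟨s, hs, hsc, hsb⟩ := hb.exists_countable
  obtain ⟨V, hV⟩ := (hsc.insert ∅).exists_eq_range (insert_nonempty _ _)
  refine ⟨fun i => frontier (V i), fun i => isClosed_frontier, ?_, ?_⟩
  · intro z hz hzU
    obtain ⟨i, hi⟩ := mem_iUnion.1 hzU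
    have : V i ∈ insert ∅ s := hV ▸ mem_range_self i
    rcases this with h0 | h1
    · rw [h0] at hi; simp at hi
    · exact disjoint_left.1 (hs h1).2 hi hz
  · intro x U hU hx
    obtain ⟨W, hW, hxW, hWU⟩ := hsb.exists_subset_of_mem_open hx hU
    refine ⟨W, (hs hW).1, hxW, hWU, ?_⟩
    obtain ⟨i, rfl⟩ : W ∈ range V := hV ▸ mem_insert_of_mem _ hW
    exact disjoint_left.2 fun z hz hz' => hz' (mem_iUnion.2 ⟨i, hz⟩)

theorem Dec.exists_gdelta {n : ℕ} {A : Set K} (h : Dec n A) :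
    ∃ C : ℕ → Set K, (∀ i, IsClosed (C i)) ∧ A ⊆ (⋃ i, C i)ᶜ ∧ Dec n (⋃ i, C i)ᶜ := by
  obtain ⟨Z, hZ, hA⟩ := h
  choose C hC hZC hCZ using fun i => (hZ i).exists_gdelta
  rcases Nat.eq_zero_or_pos n with rfl | hn
  · refine ⟨fun _ => univ, fun _ => isClosed_univ, ?_, Z, hZ, ?_⟩
    · exact hA.trans (by simp)
    · exact fun z hz => (hz (mem_iUnion.2 ⟨0, mem_univ z⟩)).elim
  have : Nonempty (Fin n) := ⟨⟨0, hn⟩⟩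
  have hclosed : ∃ D : ℕ → Set K, (∀ i, IsClosed (D i)) ∧ ⋃ i, D i = ⋂ i, ⋃ j, C i j := by
    obtain ⟨e, he⟩ := exists_surjective_nat (Fin n → ℕ)
    refine ⟨fun k => ⋂ i, C i (e k i), fun k => isClosed_iInter fun i => hC _ _, ?_⟩
    ext z
    simp only [mem_iUnion, mem_iInter]
    constructor
    · rintro ⟨k, hk⟩ i; exact ⟨_, hk i⟩
    · intro hz
      choose g hg using hz
      obtain ⟨k, rfl⟩ := he g
      exact ⟨k, hg⟩
  obtain ⟨D, hD, hDU⟩ := hclosed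
  have hcompl : (⋃ i, D i)ᶜ = ⋃ i, (⋃ j, C i j)ᶜ := by rw [hDU, compl_iInter]
  refine ⟨D, hD, ?_, fun i => (⋃ j, C i j)ᶜ, hCZ, hcompl.subset⟩
  rw [hcompl]
  exact hA.trans (iUnion_mono hZC)

end Metric

end Inductive

end

/-- Zero is an unstable value of every continuous map from `P` to `ℝⁿ`. -/
def Unst (n : ℕ) (P : Type u) [TopologicalSpace P] : Prop :=
  ∀ g : C(P, Fin n → ℝ), ∀ ε > 0, ∃ g' : C(P, Fin n → ℝ),
    (∀ p, dist (g' p) (g p) < ε) ∧ ∀ p, g' p ≠ 0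

theorem Unst.indBelow : ∀ {n : ℕ} {P : Type u} [MetricSpace P] [CompactSpace P], Unst n P →
    indBelow n P
  | 0, P, _, _, h => by
      obtain ⟨g', -, hg'⟩ := h 0 1 one_pos
      exact ⟨fun p => hg' p (Subsingleton.elim _ _)⟩
  | n + 1, P, _, _, h => by
      intro x U hU hx
      let O : C(P, Fin n → ℝ) → ℕ → Set C(P, ℝ) := fun g m =>
        {f | ∃ g' : C(P, Fin n → ℝ), (∀ p, dist (g' p) (g p) < 1 / (m + 1)) ∧
          ∀ p, f p ≠ 0 ∨ g' p ≠ 0}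
      have hne : Nonempty P := ⟨x⟩
      have hO : ∀ g m, IsOpen (O g m) := by
        intro g m
        rw [Metric.isOpen_iff]
        rintro f ⟨g', hg', hfg⟩
        obtain ⟨p, -, hp⟩ := isCompact_univ.exists_isMinOn (f := fun p => max ‖f p‖ ‖g' p‖)
          univ_nonempty (by fun_prop)
        refine ⟨max ‖f p‖ ‖g' p‖, ?_, ?_⟩
        · rcases hfg p with h0 | h0
          · exact lt_max_of_lt_left (norm_pos_iff.2 h0)
          · exact lt_max_of_lt_right (norm_pos_iff.2 h0)
        · intro f' hf'
          refine ⟨g', hg', fun q => ?_⟩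
          by_contra! hcon
          have h1 := hp (mem_univ q)
          simp only [mem_ofPred_eq] at h1
          have h2 : dist (f' q) (f q) < max ‖f p‖ ‖g' p‖ :=
            (ContinuousMap.dist_apply_le_dist q).trans_lt hf'
          rw [hcon.1, dist_zero_left] at h2
          rw [hcon.2, norm_zero, max_eq_left (norm_nonneg _)] at h1
          linarith
      have hOd : ∀ g m, Dense (O g m) := by
        intro g m
        rw [Metric.dense_iff]
        intro f r hr
        have hm : (0 : ℝ) < 1 / (m + 1) := by positivity
        let F : C(P, Fin (n + 1) → ℝ) := ⟨fun p => Fin.cons (f p) (g p), by fun_prop⟩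
        obtain ⟨G, hG, hG0⟩ := h F (min (r / 2) (1 / (m + 1))) (lt_min (half_pos hr) hm)
        refine ⟨⟨fun p => G p 0, by fun_prop⟩, ?_,
          ⟨fun p i => G p i.succ, by fun_prop⟩, ?_, ?_⟩
        · rw [mem_ball]
          refine lt_of_le_of_lt ((ContinuousMap.dist_le (half_pos hr).le).2 fun p => ?_)
            (half_lt_self hr)
          have := (dist_le_pi_dist (G p) (F p) 0).trans (hG p).le
          exact this.trans (min_le_left _ _)
        · intro p
          refine (dist_pi_lt_iff hm).2 fun i => ?_
          have := (dist_le_pi_dist (G p) (F p) i.succ).trans_lt (hG p)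
          exact this.trans_le (min_le_right _ _)
        · intro p
          by_contra! hcon
          refine hG0 p (funext fun i => ?_)
          induction i using Fin.cases with
          | zero => exact hcon.1
          | succ i => exact congrFun hcon.2 i
      have hbaire : Dense (⋂ k : ℕ × ℕ, O (denseSeq C(P, Fin n → ℝ) k.1) k.2) :=
        dense_iInter_of_isOpen (fun k => hO _ _) fun k => hOd _ _
      obtain ⟨f0, hf0⟩ : ∃ f0 : C(P, ℝ), f0 x = -1 ∧ ∀ p ∈ Uᶜ, f0 p = 1 := by
        obtain ⟨f, hf1, hf2, -⟩ := exists_continuous_zero_one_of_isClosed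
          (isClosed_singleton (x := x)) hU.isClosed_compl (by simpa using hx)
        refine ⟨⟨fun p => 2 * f p - 1, by fun_prop⟩, ?_, ?_⟩
        · have : f x = 0 := hf1 rfl
          simp [this]
        · intro p hp
          have : f p = 1 := hf2 hp
          simp [this]; norm_num
      obtain ⟨f, hff0, hf⟩ := Metric.dense_iff.1 hbaire f0 1 one_pos
      rw [mem_iInter] at hf
      have hff : ∀ p, |f p - f0 p| < 1 := fun p =>
        (ContinuousMap.dist_apply_le_dist (f := f) (g := f0) p).trans_lt hff0
      refine ⟨{p | f p < 0}, isOpen_lt (by fun_prop) (by fun_prop), ?_, ?_, ?_⟩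
      · have := abs_lt.1 (hff x)
        rw [mem_ofPred_eq]; linarith [hf0.1]
      · intro p hp
        rw [mem_ofPred_eq] at hp
        by_contra hpU
        have := abs_lt.1 (hff p)
        rw [hf0.2 p hpU] at this; linarith
      · have hfr : ∀ p ∈ frontier {p | f p < 0}, f p = 0 := fun p hp =>
          frontier_lt_subset_eq f.continuous continuous_const hp
        have : CompactSpace ↥(frontier {p | f p < 0}) :=
          isCompact_iff_compactSpace.1 isClosed_frontier.isCompact
        refine Unst.indBelow ?_
        intro g ε hε
        obtain ⟨G, hG⟩ := ContinuousMap.exists_restrict_eq isClosed_frontier g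
        obtain ⟨k, hk⟩ := (denseRange_denseSeq C(P, Fin n → ℝ)).exists_dist_lt G (half_pos hε)
        obtain ⟨m, hm⟩ := exists_nat_one_div_lt (half_pos hε)
        obtain ⟨g', hg', hfg⟩ := hf (k, m)
        refine ⟨g'.restrict _, fun p => ?_, fun p => ?_⟩
        · have h1 : g p = G p := by rw [← hG]; rfl
          rw [h1, ContinuousMap.restrict_apply]
          have h2 := (ContinuousMap.dist_apply_le_dist (f := G) (p : P)).trans_lt hk
          have h3 := hg' p
          rw [dist_comm] at h2
          linarith [dist_triangle (g' p) (denseSeq C(P, Fin n → ℝ) k p) (G p)]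
        · rcases hfg p with h0 | h0
          · exact (h0 (hfr p p.2)).elim
          · exact h0

/-- If `D` is not of dimension at most `n - 1` then there is a continuous map into `ℝⁿ`, defined on
the whole space, for which zero is a stable value on `D`. -/
theorem exists_stable {K : Type u} [MetricSpace K] [CompactSpace K] {n : ℕ} {D : Set K}
    (hD : IsClosed D) (h : ¬ indBelow n ↥D) :
    ∃ g : C(K, Fin n → ℝ), ∃ ε > 0, ∀ g' : C(K, Fin n → ℝ),
      (∀ p ∈ D, dist (g' p) (g p) < ε) → ∃ p ∈ D, g' p = 0 := by
  have : CompactSpace ↥D := isCompact_iff_compactSpace.1 hD.isCompact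
  have h' : ¬ Unst n ↥D := fun hu => h hu.indBelow
  unfold Unst at h'
  push Not at h'
  obtain ⟨g, ε, hε, hg⟩ := h'
  obtain ⟨G, hG⟩ := ContinuousMap.exists_restrict_eq hD g
  refine ⟨G, ε, hε, fun g' hg' => ?_⟩
  obtain ⟨p, hp⟩ := hg (g'.restrict D) fun p => by
    rw [← hG]; exact hg' p p.2
  exact ⟨p, p.2, hp⟩

section

variable {K : Type u} [MetricSpace K] [CompactSpace K]

theorem ZD.exists_disjoint_cover {Z : Set K} (h : ZD Z) {ρ : ℝ} (hρ : 0 < ρ) :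
    ∃ W : ℕ → Set K, (∀ j, IsOpen (W j)) ∧ Pairwise (fun i j => Disjoint (W i) (W j)) ∧
      Z ⊆ ⋃ j, W j ∧ ∀ j, ∀ a ∈ W j, ∀ b ∈ W j, dist a b < ρ := by
  rcases isEmpty_or_nonempty K with hK | hK
  · exact ⟨fun _ => ∅, fun _ => isOpen_empty, fun _ _ _ => disjoint_bot_left,
      fun z _ => (hK.false z).elim, fun _ a => (hK.false a).elim⟩
  choose V hV hxV hVb hVd using fun x => h x (ball x (ρ / 2)) isOpen_ball
    (mem_ball_self (half_pos hρ))
  obtain ⟨s, hs, hsU⟩ := TopologicalSpace.countable_cover_nhds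
    (f := V) fun x => (hV x).mem_nhds (hxV x)
  have hsne : s.Nonempty := by
    rcases s.eq_empty_or_nonempty with rfl | h
    · simp at hsU
      exact (hK.elim fun x => (Set.eq_empty_iff_forall_notMem.1 hsU.symm x (mem_univ x)).elim)
    · exact h
  obtain ⟨x, rfl⟩ := hs.exists_eq_range hsne
  refine ⟨fun k => V (x k) \ ⋃ i ∈ Finset.range k, closure (V (x i)), fun k => ?_, ?_, ?_, ?_⟩
  · exact (hV _).sdiff (isClosed_biUnion_finset fun i _ => isClosed_closure)
  · have key : ∀ i j, i < j → Disjoint (V (x i) \ ⋃ l ∈ Finset.range i, closure (V (x l)))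
        (V (x j) \ ⋃ l ∈ Finset.range j, closure (V (x l))) := by
      intro i j hij
      rw [disjoint_left]
      rintro z ⟨hz, -⟩ ⟨-, hz'⟩
      exact hz' (mem_iUnion₂.2 ⟨i, Finset.mem_range.2 hij, subset_closure hz⟩)
    intro i j hij
    rcases lt_or_gt_of_ne hij with h | h
    · exact key i j h
    · exact (key j i h).symm
  · intro z hz
    have hex : ∃ k, z ∈ V (x k) := by
      have : z ∈ ⋃ y ∈ range x, V y := hsU ▸ mem_univ z
      simpa using this
    classical
    refine mem_iUnion.2 ⟨Nat.find hex, Nat.find_spec hex, fun hc => ?_⟩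
    obtain ⟨i, hi, hzi⟩ := mem_iUnion₂.1 hc
    refine disjoint_left.1 (hVd (x i)) ?_ hz
    rw [(hV _).frontier_eq]
    exact ⟨hzi, Nat.find_min hex (Finset.mem_range.1 hi)⟩
  · rintro k a ⟨ha, -⟩ b ⟨hb, -⟩
    have h1 := mem_ball.1 (hVb _ ha)
    have h2 := mem_ball.1 (hVb _ hb)
    linarith [dist_triangle_right a b (x k)]

theorem exists_injOn_near {ι : Type*} (s : Finset ι) (a : ι → ℝ) {ε : ℝ} (hε : 0 < ε) :
    ∃ c : ι → ℝ, InjOn c s ∧ ∀ j ∈ s, |c j - a j| < ε := by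
  classical
  induction s using Finset.induction_on with
  | empty => exact ⟨a, by simp, by simp⟩
  | insert k s hk ih =>
    obtain ⟨c, hc, hca⟩ := ih
    obtain ⟨x, hx, hxs⟩ := (Ioo_infinite (a := a k) (b := a k + ε) (by linarith)
      ).exists_notMem_finset (s.image c)
    have hne : ∀ j ∈ s, j ≠ k := fun j hj h => hk (h ▸ hj)
    refine ⟨Function.update c k x, ?_, ?_⟩
    · rw [Finset.coe_insert, injOn_insert (by exact_mod_cast hk)]
      refine ⟨fun i hi j hj hij => ?_, ?_⟩
      · rw [Function.update_of_ne (hne i hi), Function.update_of_ne (hne j hj)] at hij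
        exact hc hi hj hij
      · rintro ⟨j, hj, hjk⟩
        rw [Function.update_self, Function.update_of_ne (hne j hj)] at hjk
        exact hxs (Finset.mem_image.2 ⟨j, hj, hjk⟩)
    · intro j hj
      rcases Finset.mem_insert.1 hj with rfl | hj
      · rw [Function.update_self, abs_lt]
        constructor <;> linarith [hx.1, hx.2]
      · rw [Function.update_of_ne (hne j hj)]; exact hca j hj

/-- Any `n + 1` points of `C` with the same image contain two points at distance less than `ρ`. -/
def CloseFibers (n : ℕ) (C : Set K) (ρ : ℝ) (g : C(K, Fin n → ℝ)) : Prop :=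
  ∀ z : Fin (n + 1) → K, (∀ a, z a ∈ C) → (∀ a b, g (z a) = g (z b)) →
    ∃ a b, a ≠ b ∧ dist (z a) (z b) < ρ

theorem exists_ball_closeFibers {n : ℕ} {C : Set K} (hC : IsClosed C) (h : Dec n C)
    {ρ : ℝ} (hρ : 0 < ρ) (f : C(K, Fin n → ℝ)) {ε : ℝ} (hε : 0 < ε) :
    ∃ g ∈ ball f ε, ∃ η > 0, ∀ g' ∈ ball g η, CloseFibers n C ρ g' := by
  obtain ⟨Z, hZ, hCZ⟩ := h
  have hε4 : 0 < ε / 4 := by positivity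
  obtain ⟨δ, hδ, hfδ⟩ := Metric.uniformContinuous_iff.1
    (CompactSpace.uniformContinuous_of_continuous f.continuous) (ε / 4) hε4
  choose W hWo hWd hWU hWρ using fun i => (hZ i).exists_disjoint_cover (lt_min hρ hδ)
  obtain ⟨t, ht⟩ := hC.isCompact.elim_finite_subcover (fun q : Fin n × ℕ => W q.1 q.2)
    (fun q => hWo _ _) (by
      intro z hz
      obtain ⟨i, hi⟩ := mem_iUnion.1 (hCZ hz)
      obtain ⟨j, hj⟩ := mem_iUnion.1 (hWU i hi)
      exact mem_iUnion.2 ⟨(i, j), hj⟩)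
  obtain ⟨D, hCD, hDc, hDW⟩ := exists_subset_iUnion_closed_subset hC
    (u := fun q : ↥t => W q.1.1 q.1.2) (fun q => hWo _ _) (fun x _ => Set.toFinite _) (by
      intro z hz
      obtain ⟨q, hq, hzq⟩ := mem_iUnion₂.1 (ht hz)
      exact mem_iUnion.2 ⟨⟨q, hq⟩, hzq⟩)
  have ha : ∀ q : ↥t, ∃ a : ℝ, ∀ p ∈ W q.1.1 q.1.2, |a - f p q.1.1| < ε / 4 := by
    intro q
    rcases (W q.1.1 q.1.2).eq_empty_or_nonempty with h0 | ⟨w, hw⟩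
    · rw [h0]; exact ⟨0, by simp⟩
    · refine ⟨f w q.1.1, fun p hp => ?_⟩
      have := hfδ ((hWρ _ _ w hw p hp).trans_le (min_le_right _ _))
      exact (dist_le_pi_dist (f w) (f p) q.1.1).trans_lt this
  choose a ha using ha
  obtain ⟨c, hc, hca⟩ := exists_injOn_near (Finset.univ : Finset ↥t) a hε4
  have hχ : ∀ q : ↥t, ∃ χ : C(K, ℝ), EqOn χ 0 (W q.1.1 q.1.2)ᶜ ∧ EqOn χ 1 (D q) ∧
      ∀ x, χ x ∈ Icc (0 : ℝ) 1 := fun q =>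
    exists_continuous_zero_one_of_isClosed (hWo _ _).isClosed_compl (hDc q)
      (disjoint_compl_left_iff_subset.2 (hDW q))
  choose χ hχ0 hχ1 hχI using hχ
  let φ : Fin n → K → ℝ := fun i p =>
    ∑ q : ↥t, if q.1.1 = i then χ q p * (c q - f p i) else 0
  have hφ1 : ∀ (q : ↥t) (p : K), p ∈ W q.1.1 q.1.2 → φ q.1.1 p = χ q p * (c q - f p q.1.1) := by
    intro q p hp
    refine (Finset.sum_eq_single q ?_ (by simp)).trans (if_pos rfl)
    intro q' _ hq'
    split_ifs with h1
    · have : p ∉ W q'.1.1 q'.1.2 := fun hp' => by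
        have h2 : q'.1.2 ≠ q.1.2 := fun h2 => hq' (Subtype.ext (Prod.ext h1 h2))
        exact disjoint_left.1 (hWd q.1.1 h2) (h1 ▸ hp') hp
      rw [hχ0 q' this]; simp
    · rfl
  have hφ0 : ∀ i p, (∀ q : ↥t, q.1.1 = i → p ∉ W q.1.1 q.1.2) → φ i p = 0 := by
    intro i p hp
    refine Finset.sum_eq_zero fun q _ => ?_
    split_ifs with h1
    · rw [hχ0 q (hp q h1)]; simp
    · rfl
  have hφb : ∀ i p, |φ i p| ≤ ε / 2 := by
    intro i p
    by_cases hex : ∃ q : ↥t, q.1.1 = i ∧ p ∈ W q.1.1 q.1.2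
    · obtain ⟨q, rfl, hq⟩ := hex
      rw [hφ1 q p hq, abs_mul]
      have h1 : |χ q p| ≤ 1 := abs_le.2 ⟨by linarith [(hχI q p).1], (hχI q p).2⟩
      have h2 := hca q (Finset.mem_univ _)
      have h3 := ha q p hq
      have h4 : |c q - f p q.1.1| ≤ ε / 2 := by
        have := abs_sub_le (c q) (a q) (f p q.1.1)
        linarith
      calc |χ q p| * |c q - f p q.1.1| ≤ 1 * (ε / 2) := by gcongr
        _ = ε / 2 := one_mul _
    · push Not at hex
      rw [hφ0 i p hex, abs_zero]; positivity
  have hφc : Continuous fun p => fun i => f p i + φ i p := by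
    refine continuous_pi fun i => ?_
    refine Continuous.add (by fun_prop) (continuous_finsetSum _ fun q _ => ?_)
    split_ifs
    · fun_prop
    · exact continuous_const
  obtain ⟨η, hη, hηc⟩ : ∃ η > 0, ∀ q q' : ↥t, q ≠ q' → 2 * η ≤ |c q - c q'| := by
    have : ∀ᶠ η in 𝓝[>] (0 : ℝ), ∀ q q' : ↥t, q ≠ q' → 2 * η ≤ |c q - c q'| := by
      refine eventually_all.2 fun q => eventually_all.2 fun q' => ?_
      by_cases hq : q = q'
      · exact Eventually.of_forall fun _ h => (h hq).elim
      · have hpos : 0 < |c q - c q'| := abs_pos.2 (sub_ne_zero.2 fun h =>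
          hq (hc (by simp) (by simp) h))
        filter_upwards [Ioo_mem_nhdsGT (half_pos hpos)] with η hη _
        linarith [hη.2]
    obtain ⟨η, h1, h2⟩ := (this.and self_mem_nhdsWithin).exists
    exact ⟨η, h2, h1⟩
  refine ⟨⟨_, hφc⟩, ?_, η, hη, ?_⟩
  · rw [mem_ball]
    refine lt_of_le_of_lt ((ContinuousMap.dist_le (half_pos hε).le).2 fun p => ?_)
      (half_lt_self hε)
    refine (dist_pi_le_iff (half_pos hε).le).2 fun i => ?_
    rw [Real.dist_eq, ContinuousMap.coe_mk, add_sub_cancel_left]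
    exact hφb i p
  · intro g hg z hzC hz
    choose q hq using fun k => mem_iUnion.1 (hCD (hzC k))
    obtain ⟨k, l, hkl, hi⟩ := Fintype.exists_ne_map_eq_of_card_lt (fun k => (q k).1.1) (by simp)
    have hval : ∀ k, |g (z k) (q k).1.1 - c (q k)| < η := by
      intro k
      have h1 := (ContinuousMap.dist_apply_le_dist (z k)).trans_lt hg
      have h2 : dist (g (z k) (q k).1.1) (f (z k) (q k).1.1 + φ (q k).1.1 (z k)) < η :=
        (dist_le_pi_dist _ _ (q k).1.1).trans_lt h1
      rw [hφ1 _ _ (hDW _ (hq k)), hχ1 _ (hq k), Real.dist_eq] at h2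
      simpa using h2
    have hqq : q k = q l := by
      by_contra hne
      have h1 := hηc _ _ hne
      have h2 := hval k
      have h3 := hval l
      rw [← hi, ← hz k l] at h3
      have := abs_sub_le (c (q k)) (g (z k) (q k).1.1) (c (q l))
      rw [abs_sub_comm] at h2
      linarith
    refine ⟨k, l, hkl, (hWρ _ _ _ (hDW _ (hq k)) _ ?_).trans_le (min_le_left _ _)⟩
    rw [hqq]; exact hDW _ (hq l)

theorem residual_closeFibers {n : ℕ} {C : Set K} (hC : IsClosed C) (h : Dec n C)
    {ρ : ℝ} (hρ : 0 < ρ) : ∀ᶠ f in residual C(K, Fin n → ℝ), CloseFibers n C ρ f := by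
  have : Dense (interior {f : C(K, Fin n → ℝ) | CloseFibers n C ρ f}) := by
    rw [Metric.dense_iff]
    intro f r hr
    obtain ⟨g, hg, η, hη, hgη⟩ := exists_ball_closeFibers hC h hρ f hr
    exact ⟨g, hg, mem_interior.2 ⟨ball g η, hgη, isOpen_ball, mem_ball_self hη⟩⟩
  exact mem_of_superset (residual_of_dense_open isOpen_interior this) interior_subset

/-- The fibers of a generic map into `ℝⁿ` meet a given `F_σ` set of dimension at most `n - 1` in
finite sets. -/
theorem residual_finite_fibers {n : ℕ} (C : ℕ → Set K) (hC : ∀ i, IsClosed (C i))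
    (h : indBelow n ↥(⋃ i, C i)) :
    ∀ᶠ (f : C(K, Fin n → ℝ)) in residual C(K, Fin n → ℝ), ∀ y, (⇑f ⁻¹' {y} ∩ ⋃ i, C i).Finite := by
  have hD : ∀ i, IsClosed (partialSups C i) := fun i => by
    rw [partialSups_eq_biUnion_range]
    exact isClosed_biUnion_finset fun i _ => hC i
  have hDec : ∀ i, Dec n (partialSups C i) := fun i => (dec_of_indBelow h).mono (by
    rw [partialSups_eq_biUnion_range]
    exact iUnion₂_subset fun i _ => subset_iUnion C i)
  have hgen : ∀ᶠ f in residual C(K, Fin n → ℝ), ∀ i m : ℕ,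
      CloseFibers n (partialSups C i) (1 / (m + 1)) f := by
    refine eventually_countable_forall.2 fun i => eventually_countable_forall.2 fun m => ?_
    exact residual_closeFibers (hD i) (hDec i) (by positivity)
  filter_upwards [hgen] with f hf y
  by_contra hinf
  let e := Set.Infinite.natEmbedding _ hinf
  let z : Fin (n + 1) → K := fun a => e a
  have hzinj : Function.Injective z := fun a b hab =>
    Fin.val_injective (e.injective (Subtype.ext hab))
  choose j hj using fun a : Fin (n + 1) => mem_iUnion.1 (e a).2.2
  obtain ⟨N, hN⟩ := (Set.finite_range j).bddAbove
  have hzC : ∀ a, z a ∈ partialSups C N := fun a =>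
    le_partialSups_of_le C (hN (mem_range_self a)) (hj a)
  have hzy : ∀ a, f (z a) = y := fun a => (e a).2.1
  obtain ⟨δ, hδ, hzδ⟩ : ∃ δ > 0, ∀ a b, a ≠ b → δ ≤ dist (z a) (z b) := by
    have : ∀ᶠ δ in 𝓝[>] (0 : ℝ), ∀ a b, a ≠ b → δ ≤ dist (z a) (z b) := by
      refine eventually_all.2 fun a => eventually_all.2 fun b => ?_
      by_cases hab : a = b
      · exact Eventually.of_forall fun _ h => (h hab).elim
      · filter_upwards [Ioo_mem_nhdsGT (dist_pos.2 (hzinj.ne hab))] with η hη _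
        exact hη.2.le
    obtain ⟨η, h1, h2⟩ := (this.and self_mem_nhdsWithin).exists
    exact ⟨η, h2, h1⟩
  obtain ⟨m, hm⟩ := exists_nat_one_div_lt hδ
  obtain ⟨a, b, hab, hd⟩ := hf N m z hzC fun a b => (hzy a).trans (hzy b).symm
  linarith [hzδ a b hab]

end

section

section Metric

variable {K : Type u} [MetricSpace K]

theorem neg_one_le_zero : (-1 : EReal) ≤ 0 := by
  have : (-1 : EReal) = ((-1 : ℝ) : EReal) := by simp
  rw [this]
  exact_mod_cast (by norm_num : (-1 : ℝ) ≤ 0)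

/-- Countable unions of closed sets. -/
def IsFσ (A : Set K) : Prop := IsGδ Aᶜ

theorem _root_.IsClosed.isFσ {A : Set K} (h : IsClosed A) : IsFσ A := h.isOpen_compl.isGδ

theorem _root_.IsOpen.isFσ {A : Set K} (h : IsOpen A) : IsFσ A := h.isClosed_compl.isGδ

theorem IsFσ.iUnion {ι : Type*} [Countable ι] {A : ι → Set K} (h : ∀ i, IsFσ (A i)) :
    IsFσ (⋃ i, A i) := by
  rw [IsFσ, compl_iUnion]
  exact IsGδ.iInter h

theorem IsFσ.inter {A B : Set K} (hA : IsFσ A) (hB : IsFσ B) : IsFσ (A ∩ B) := by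
  rw [IsFσ, compl_inter]
  exact IsGδ.union hA hB

theorem isFσ_iff {A : Set K} :
    IsFσ A ↔ ∃ C : ℕ → Set K, (∀ i, IsClosed (C i)) ∧ A = ⋃ i, C i := by
  constructor
  · intro h
    obtain ⟨f, hf, hA⟩ := isGδ_iff_eq_iInter_nat.1 h
    refine ⟨fun i => (f i)ᶜ, fun i => (hf i).isClosed_compl, ?_⟩
    rw [← compl_iInter, ← hA, compl_compl]
  · rintro ⟨C, hC, rfl⟩
    exact IsFσ.iUnion fun i => (hC i).isFσ

/-- The properties common to the topological, Hausdorff and packing dimensions. -/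
structure GoodDim (dim : Set K → EReal) : Prop where
  empty : dim ∅ = -1
  nonneg : ∀ {A : Set K}, A.Nonempty → 0 ≤ dim A
  mono : ∀ {A B : Set K}, A ⊆ B → dim A ≤ dim B
  singleton : ∀ x, dim {x} ≤ 0
  of_closed_cover : ∀ {A : Set K} {c : EReal} (C : ℕ → Set K), (∀ i, IsClosed (C i)) →
    A ⊆ ⋃ i, C i → (∀ i, dim (A ∩ C i) ≤ c) → dim A ≤ c

namespace GoodDim

variable {dim : Set K → EReal}

theorem of_isFσ_cover (hd : GoodDim dim) {ι : Type*} [Countable ι] [Nonempty ι] {A : Set K}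
    {c : EReal} (S : ι → Set K) (hS : ∀ i, IsFσ (S i)) (hA : A ⊆ ⋃ i, S i)
    (h : ∀ i, dim (A ∩ S i) ≤ c) : dim A ≤ c := by
  choose C hC hCS using fun i => isFσ_iff.1 (hS i)
  obtain ⟨e, he⟩ := exists_surjective_nat (ι × ℕ)
  refine hd.of_closed_cover (fun k => C (e k).1 (e k).2) (fun k => hC _ _) ?_ fun k =>
    (hd.mono (inter_subset_inter_right A ?_)).trans (h (e k).1)
  · intro x hx
    obtain ⟨i, hi⟩ := mem_iUnion.1 (hA hx)
    rw [hCS i] at hi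
    obtain ⟨j, hj⟩ := mem_iUnion.1 hi
    obtain ⟨k, hk⟩ := he (i, j)
    exact mem_iUnion.2 ⟨k, by rwa [hk]⟩
  · rw [hCS]; exact subset_iUnion _ _

theorem finite (hd : GoodDim dim) {T : Set K} (hT : T.Finite) : dim T ≤ 0 := by
  rcases T.eq_empty_or_nonempty with rfl | ⟨x, hx⟩
  · rw [hd.empty]; exact neg_one_le_zero
  · have := hT.countable.to_subtype
    have : Nonempty ↥T := ⟨⟨x, hx⟩⟩
    refine hd.of_isFσ_cover (fun t : ↥T => ({t.1} : Set K)) (fun t => isClosed_singleton.isFσ)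
      (fun y hy => mem_iUnion.2 ⟨⟨y, hy⟩, rfl⟩) fun t => (hd.mono inter_subset_right).trans
      (hd.singleton _)

theorem of_finite_inter (hd : GoodDim dim) {Y F : Set K} {c : EReal} (hF : (Y ∩ F).Finite)
    (hc : 0 ≤ c) (h : dim Fᶜ ≤ c) : dim Y ≤ c := by
  refine hd.of_isFσ_cover (fun b : Bool => if b then Y ∩ F else (Y ∩ F)ᶜ) (fun b => ?_)
    (fun y _ => ?_) fun b => ?_
  · cases b
    · exact hF.isClosed.isOpen_compl.isFσ
    · exact hF.isClosed.isFσ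
  · by_cases hy : y ∈ Y ∩ F
    · exact mem_iUnion.2 ⟨true, hy⟩
    · exact mem_iUnion.2 ⟨false, hy⟩
  · cases b
    · exact (hd.mono fun y hy => fun hyF => hy.2 ⟨hy.1, hyF⟩).trans h
    · exact (hd.mono inter_subset_right).trans ((hd.finite hF).trans hc)

end GoodDim

end Metric

section Top

theorem natCast_sub_one_le_iff {m n : ℕ} :
    (m : EReal) - 1 ≤ (n : EReal) - 1 ↔ m ≤ n := by
  have h : ∀ k : ℕ, (k : EReal) - 1 = (((k : ℝ) - 1 : ℝ) : EReal) := fun k => by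
    rw [EReal.coe_sub]; rfl
  rw [h, h, EReal.coe_le_coe_iff]
  simp

variable {K : Type u} [MetricSpace K]

theorem exists_indBelow_of_tdim_le {A : Set K} {c : EReal} (hc : c < ⊤) (h : tdim A ≤ c) :
    ∃ m : ℕ, indBelow m ↥A ∧ (m : EReal) - 1 ≤ c := by
  classical
  have hex : ∃ m : ℕ, indBelow m ↥A := by
    by_contra hno
    push Not at hno
    refine (h.trans_lt hc).ne (sInf_eq_top.2 ?_)
    rintro d ⟨n, hn, -⟩
    exact (hno n hn).elim
  refine ⟨Nat.find hex, Nat.find_spec hex, le_trans (le_sInf ?_) h⟩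
  rintro d ⟨n, hn, rfl⟩
  exact natCast_sub_one_le_iff.2 (Nat.find_min' hex hn)

theorem tdim_le_of_indBelow {A : Set K} {m : ℕ} (h : indBelow m ↥A) :
    tdim A ≤ (m : EReal) - 1 :=
  sInf_le ⟨m, h, rfl⟩

theorem natCast_sub_one_lt_top (m : ℕ) : (m : EReal) - 1 < ⊤ := by
  have : (m : EReal) - 1 = (((m : ℝ) - 1 : ℝ) : EReal) := by rw [EReal.coe_sub]; rfl
  rw [this]
  exact EReal.coe_lt_top _

theorem tdim_le_iff {A : Set K} {m : ℕ} : tdim A ≤ (m : EReal) - 1 ↔ indBelow m ↥A := by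
  refine ⟨fun h => ?_, tdim_le_of_indBelow⟩
  obtain ⟨k, hk, hkm⟩ := exists_indBelow_of_tdim_le (natCast_sub_one_lt_top m) h
  exact indBelow_mono (natCast_sub_one_le_iff.1 hkm) hk

theorem goodDim_tdim [SecondCountableTopology K] : GoodDim (tdim : Set K → EReal) where
  empty := by
    refine le_antisymm ?_ (le_sInf ?_)
    · refine (tdim_le_of_indBelow (m := 0) ?_).trans (by simp)
      exact (inferInstance : IsEmpty ↥(∅ : Set K))
    · rintro d ⟨n, -, rfl⟩
      refine le_trans ?_ (natCast_sub_one_le_iff.2 n.zero_le)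
      simp
  nonneg := by
    rintro A ⟨x, hx⟩
    refine le_sInf ?_
    rintro d ⟨n, hn, rfl⟩
    cases n with
    | zero => exact ((hn : IsEmpty ↥A).false ⟨x, hx⟩).elim
    | succ n =>
      refine le_trans ?_ (natCast_sub_one_le_iff.2 (Nat.succ_le_succ n.zero_le))
      norm_num
      exact (EReal.sub_self (by decide) (by decide)).ge
  mono := by
    intro A B hAB
    refine sInf_le_sInf ?_
    rintro d ⟨n, hn, rfl⟩
    exact ⟨n, indBelow_subset hAB hn, rfl⟩
  singleton x := by
    refine (tdim_le_of_indBelow (m := 1) fun y U hU hy => ⟨univ, isOpen_univ, mem_univ _,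
      fun z _ => (Subsingleton.elim y z) ▸ hy, ?_⟩).trans ?_
    · rw [frontier_univ]
      exact (inferInstance : IsEmpty ↥(∅ : Set ↥({x} : Set K)))
    · norm_num
      exact (EReal.sub_self (by decide) (by decide)).le
  of_closed_cover := by
    intro A c C hC hA h
    rcases eq_top_or_lt_top c with rfl | hc
    · exact le_top
    choose m hm hmc using fun i => exists_indBelow_of_tdim_le hc (h i)
    have hb : BddAbove (range m) := by
      obtain ⟨r, hcr, -⟩ := EReal.lt_iff_exists_real_btwn.1 hc
      obtain ⟨N, hN⟩ := exists_nat_ge (r + 1)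
      refine ⟨N, ?_⟩
      rintro _ ⟨i, rfl⟩
      have h1 : (m i : EReal) - 1 = (((m i : ℝ) - 1 : ℝ) : EReal) := by
        rw [EReal.coe_sub]; rfl
      have h2 := (hmc i).trans hcr.le
      rw [h1, EReal.coe_le_coe_iff] at h2
      have h3 : (m i : ℝ) ≤ N := by linarith
      exact_mod_cast h3
    obtain ⟨i, hi⟩ := Nat.sSup_mem (range_nonempty m) hb
    have hle : ∀ j, m j ≤ m i := fun j => hi ▸ le_csSup hb (mem_range_self j)
    refine (tdim_le_of_indBelow (m := m i) ?_).trans (hmc i)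
    exact (Dec.of_closed_cover C hC hA fun j =>
      dec_of_indBelow (indBelow_mono (hle j) (hm j))).indBelow

end Top

section Measure

variable {K : Type u} [MetricSpace K]

open Classical in
theorem GoodDim.of_stable {φ : Set K → EReal} (h0 : ∀ A, 0 ≤ φ A) (he : φ ∅ ≤ 0)
    (hm : ∀ {A B : Set K}, A ⊆ B → φ A ≤ φ B) (hs : ∀ x, φ {x} ≤ 0)
    (hc : ∀ {A : Set K} {c : EReal} (C : ℕ → Set K), A ⊆ ⋃ i, C i → (∀ i, φ (A ∩ C i) ≤ c) →
      φ A ≤ c) : GoodDim fun A => if A = ∅ then -1 else φ A where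
  empty := if_pos rfl
  nonneg hA := by rw [if_neg hA.ne_empty]; exact h0 _
  mono {A B} hAB := by
    split_ifs with hA hB hB
    · exact le_rfl
    · exact neg_one_le_zero.trans (h0 B)
    · exact (hA (subset_eq_empty hAB hB)).elim
    · exact hm hAB
  singleton x := by rw [if_neg (singleton_ne_empty x)]; exact hs x
  of_closed_cover {A c} C _ hA h := by
    split_ifs with hA0
    · simpa [hA0] using h 0
    · refine hc C hA fun i => ?_
      obtain ⟨x, hx⟩ := nonempty_iff_ne_empty.2 hA0
      obtain ⟨j, hj⟩ := mem_iUnion.1 (hA hx)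
      have h1 := h j
      have hne : (A ∩ C j).Nonempty := ⟨x, hx, hj⟩
      rw [if_neg hne.ne_empty] at h1
      by_cases hi : A ∩ C i = ∅
      · rw [hi]; exact he.trans ((h0 _).trans h1)
      · simpa [hi] using h i

theorem goodDim_hdim : GoodDim (hdim : Set K → EReal) := by
  refine GoodDim.of_stable (φ := fun A => ((dimH A : ℝ≥0∞) : EReal))
    (fun A => EReal.coe_ennreal_nonneg _) (by simp) (fun h => ?_) (by simp) ?_
  · exact EReal.coe_ennreal_le_coe_ennreal_iff.2 (dimH_mono h)
  · intro A c C hA h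
    have hc : 0 ≤ c := (EReal.coe_ennreal_nonneg _).trans (h 0)
    rw [← EReal.coe_toENNReal hc] at h ⊢
    simp only [EReal.coe_ennreal_le_coe_ennreal_iff] at h ⊢
    calc dimH A ≤ dimH (⋃ i, A ∩ C i) := dimH_mono (by rw [← inter_iUnion]; exact subset_inter le_rfl hA)
      _ = ⨆ i, dimH (A ∩ C i) := dimH_iUnion _
      _ ≤ _ := iSup_le h

theorem packPre_mono {h : ℝ≥0 → ℝ≥0} {A B : Set K} {δ ε : ℝ≥0} (hAB : A ⊆ B) (hδ : δ ≤ ε) :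
    packPre h A δ ≤ packPre h B ε :=
  iSup₂_mono' fun s hs => ⟨s, ⟨hs.1, fun p hp => ⟨hAB (hs.2.1 p hp).1, (hs.2.1 p hp).2.trans hδ⟩,
    hs.2.2⟩, le_rfl⟩

theorem packPre0_mono {h : ℝ≥0 → ℝ≥0} {A B : Set K} (hAB : A ⊆ B) :
    packPre0 h A ≤ packPre0 h B :=
  iInf₂_mono fun _ _ => packPre_mono hAB le_rfl

theorem packMeasure_mono {h : ℝ≥0 → ℝ≥0} {A B : Set K} (hAB : A ⊆ B) :
    packMeasure h A ≤ packMeasure h B := by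
  refine le_iInf₂ fun c hc => ?_
  refine (iInf₂_le (fun i => A ∩ c i) ?_).trans
    (ENNReal.tsum_le_tsum fun i => packPre0_mono inter_subset_right)
  rw [← inter_iUnion, ← hc, inter_eq_left.2 hAB]

theorem packPre_le_mul {s t : ℝ} (ht : 0 ≤ t) (hts : t ≤ s) (A : Set K) (δ : ℝ≥0) :
    packPre (fun r => r ^ s) A δ ≤ ((δ ^ (s - t) : ℝ≥0) : ℝ≥0∞) * packPre (fun r => r ^ t) A δ := by
  refine iSup₂_le fun p hp => ?_
  refine le_trans ?_ (mul_le_mul_right (le_iSup₂_of_le p hp le_rfl) _)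
  rw [← ENNReal.tsum_mul_left]
  refine ENNReal.tsum_le_tsum fun q => ?_
  rw [← ENNReal.coe_mul, ENNReal.coe_le_coe]
  calc q.1.2 ^ s = q.1.2 ^ (s - t) * q.1.2 ^ t := by
        rw [← NNReal.rpow_add_of_nonneg _ (sub_nonneg.2 hts) ht, sub_add_cancel]
    _ ≤ _ := by
        gcongr
        exact (hp.2.1 _ q.2).2

theorem packPre0_eq_zero {s t : ℝ} (ht : 0 ≤ t) (hts : t < s) {A : Set K}
    (h : packPre0 (fun r => r ^ t) A ≠ ∞) : packPre0 (fun r => r ^ s) A = 0 := by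
  obtain ⟨δ₀, hδ₀, hM⟩ : ∃ δ₀ : ℝ≥0, 0 < δ₀ ∧ packPre (fun r => r ^ t) A δ₀ ≠ ∞ := by
    by_contra hno
    push Not at hno
    exact h (by simp only [packPre0]; exact iInf₂_eq_top.2 hno)
  have hlim : Tendsto (fun δ : ℝ≥0 => ((δ ^ (s - t) : ℝ≥0) : ℝ≥0∞) *
      packPre (fun r => r ^ t) A δ₀) (𝓝[>] 0) (𝓝 0) := by
    have h1 : Tendsto (fun δ : ℝ≥0 => ((δ ^ (s - t) : ℝ≥0) : ℝ≥0∞)) (𝓝[>] 0) (𝓝 0) := by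
      have : Tendsto (fun δ : ℝ≥0 => δ ^ (s - t)) (𝓝 0) (𝓝 (0 ^ (s - t))) :=
        (NNReal.continuousAt_rpow_const (Or.inr (sub_pos.2 hts).le)).tendsto
      rw [NNReal.zero_rpow (sub_pos.2 hts).ne'] at this
      exact ENNReal.tendsto_coe.2 (this.mono_left nhdsWithin_le_nhds)
    simpa using ENNReal.Tendsto.mul_const h1 (Or.inr hM)
  refine le_antisymm (ge_of_tendsto hlim ?_) zero_le
  filter_upwards [Ioo_mem_nhdsGT hδ₀] with δ hδ
  refine (iInf₂_le δ hδ.1).trans ((packPre_le_mul ht hts.le A δ).trans ?_)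
  gcongr
  exact packPre_mono le_rfl hδ.2.le

theorem packPre0_empty (h : ℝ≥0 → ℝ≥0) : packPre0 h (∅ : Set K) = 0 := by
  refine le_antisymm ((iInf₂_le 1 one_pos).trans (iSup₂_le fun s hs => ?_)) zero_le
  have : IsEmpty ↥s := ⟨fun p => (hs.2.1 _ p.2).1⟩
  simp

theorem packMeasure_le_packPre0 (h : ℝ≥0 → ℝ≥0) (A : Set K) :
    packMeasure h A ≤ packPre0 h A := by
  classical
  refine (iInf₂_le (fun i : ℕ => if i = 0 then A else ∅) ?_).trans ?_
  · ext x
    simp only [mem_iUnion]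
    exact ⟨fun hx => ⟨0, by simpa using hx⟩, fun ⟨i, hi⟩ => by
      by_cases h0 : i = 0
      · simpa [h0] using hi
      · simp [h0] at hi⟩
  · rw [tsum_eq_single 0 fun i hi => by simp [hi, packPre0_empty]]
    simp

theorem packMeasure_eq_zero {s t : ℝ} (ht : 0 ≤ t) (hts : t < s) {A : Set K} (C : ℕ → Set K)
    (hA : A ⊆ ⋃ i, C i) (h : ∀ i, packMeasure (fun r => r ^ t) (A ∩ C i) ≠ ∞) :
    packMeasure (fun r => r ^ s) A = 0 := by
  have hex : ∀ i, ∃ c : ℕ → Set K, A ∩ C i = ⋃ j, c j ∧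
      ∀ j, packPre0 (fun r => r ^ s) (c j) = 0 := by
    intro i
    by_contra hno
    push Not at hno
    refine h i ?_
    simp only [packMeasure]
    refine iInf₂_eq_top.2 fun c hc => ?_
    obtain ⟨j, hj⟩ := hno c hc
    by_contra hne
    refine hj (packPre0_eq_zero ht hts fun htop => hne ?_)
    exact top_le_iff.1 (htop ▸ ENNReal.le_tsum j)
  choose c hc hc0 using hex
  refine le_antisymm ((iInf₂_le (fun k => c (Nat.unpair k).1 (Nat.unpair k).2) ?_).trans ?_) zero_le
  · rw [iUnion_unpair (fun i j => c i j)]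
    simp only [← hc]
    rw [← inter_iUnion, inter_eq_left.2 hA]
  · simp [hc0]

theorem packMeasure_singleton (s : ℝ≥0) (x : K) :
    packMeasure (fun r => r ^ (s : ℝ)) ({x} : Set K) ≠ ∞ := by
  refine ((packMeasure_le_packPre0 _ _).trans_lt ((iInf₂_le 1 one_pos).trans_lt
    (lt_of_le_of_lt (iSup₂_le fun p hp => ?_) ENNReal.one_lt_top))).ne
  have hsub : p.Subsingleton := by
    intro a ha b hb
    by_contra hab
    refine disjoint_left.1 (hp.2.2 ha hb hab) (mem_closedBall_self a.2.2) ?_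
    rw [show a.1 = x from (hp.2.1 a ha).1, show b.1 = x from (hp.2.1 b hb).1]
    exact mem_closedBall_self b.2.2
  rcases p.eq_empty_or_nonempty with rfl | ⟨q, hq⟩
  · simp
  · have : p = {q} := hsub.eq_singleton_of_mem hq
    subst this
    rw [tsum_singleton q fun q : K × ℝ≥0 => ((q.2 ^ (s : ℝ) : ℝ≥0) : ℝ≥0∞)]
    exact_mod_cast NNReal.rpow_le_one (hp.2.1 q rfl).2 s.2

theorem goodDim_pdim : GoodDim (pdim : Set K → EReal) := by
  refine GoodDim.of_stable (φ := fun A => max 0 (⨆ (s : ℝ≥0)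
    (_ : packMeasure (fun r => r ^ (s : ℝ)) A = ∞), ((s : ℝ) : EReal)))
    (fun A => le_max_left _ _) ?_ (fun h => ?_) ?_ ?_
  · refine max_le le_rfl (iSup₂_le fun s hs => ?_)
    refine absurd hs (ne_of_lt ?_)
    exact (packMeasure_le_packPre0 _ _).trans_lt (by rw [packPre0_empty]; simp)
  · exact max_le_max le_rfl (iSup₂_mono' fun s hs =>
      ⟨s, top_le_iff.1 (hs ▸ packMeasure_mono h), le_rfl⟩)
  · exact fun x => max_le le_rfl (iSup₂_le fun s hs => absurd hs (packMeasure_singleton s x))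
  · intro A c C hA h
    have hc : 0 ≤ c := (le_max_left _ _).trans (h 0)
    refine max_le hc (iSup₂_le fun s hs => ?_)
    by_contra hcs
    obtain ⟨t, hct, hts⟩ := EReal.lt_iff_exists_real_btwn.1 (not_le.1 hcs)
    have ht : 0 < t := by exact_mod_cast hc.trans_lt hct
    have := packMeasure_eq_zero ht.le (by exact_mod_cast hts) C hA fun i htop => by
      have h1 : ((t : ℝ) : EReal) ≤ c := ((le_iSup₂ (f := fun (s : ℝ≥0)
        (_ : packMeasure (fun r => r ^ (s : ℝ)) (A ∩ C i) = ∞) => ((s : ℝ) : EReal))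
        ⟨t, ht.le⟩ htop).trans (le_max_right _ _)).trans (h i)
      exact hct.not_ge h1
    rw [this] at hs
    exact ENNReal.zero_ne_top hs

end Measure

end

section

variable {K : Type u} [MetricSpace K] {dim : Set K → EReal}

/-- After removing an `F_σ` set of topological dimension less than `n`, the set has dimension at
most `c`. -/
def Small (dim : Set K → EReal) (n : ℕ) (c : EReal) (A : Set K) : Prop :=
  ∃ F : Set K, IsFσ F ∧ indBelow n ↥F ∧ dim (A \ F) ≤ c

theorem GoodDim.small_mono (hd : GoodDim dim) {n : ℕ} {c c' : EReal} {A B : Set K}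
    (h : Small dim n c B) (hAB : A ⊆ B) (hc : c ≤ c') : Small dim n c' A := by
  obtain ⟨F, hF, hFn, hdF⟩ := h
  exact ⟨F, hF, hFn, (hd.mono (sdiff_subset_sdiff_left hAB)).trans (hdF.trans hc)⟩

theorem not_small_univ {n : ℕ} {c : EReal} (hc : c < dStar dim n univ) :
    ¬ Small dim n c univ := by
  rintro ⟨F, hF, hFn, hdF⟩
  obtain ⟨C, hC, rfl⟩ := isFσ_iff.1 hF
  refine (hdF.trans_lt hc).not_ge (sInf_le ⟨_, ⟨C, hC, by simp⟩, tdim_le_iff.2 hFn, rfl⟩)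

theorem dStar_nonneg (hd : GoodDim dim) {n : ℕ} (hK : ¬ indBelow n ↥(univ : Set K)) :
    0 ≤ dStar dim n univ := by
  refine le_sInf ?_
  rintro d ⟨F, -, hF, rfl⟩
  refine hd.nonneg (nonempty_iff_ne_empty.2 fun h => hK ?_)
  exact indBelow_subset (sdiff_eq_empty.1 h) (tdim_le_iff.1 hF)

variable [CompactSpace K]

theorem indBelow_iUnion_isFσ {ι : Type*} [Countable ι] [Nonempty ι] {n : ℕ} {F : ι → Set K}
    (hF : ∀ i, IsFσ (F i)) (h : ∀ i, indBelow n ↥(F i)) : indBelow n ↥(⋃ i, F i) := by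
  choose C hC hCF using fun i => isFσ_iff.1 (hF i)
  obtain ⟨e, he⟩ := exists_surjective_nat (ι × ℕ)
  refine (Dec.of_closed_cover (fun k => C (e k).1 (e k).2) (fun k => hC _ _) ?_ fun k =>
    (dec_of_indBelow (h (e k).1)).mono (inter_subset_right.trans ?_)).indBelow
  · intro x hx
    obtain ⟨i, hi⟩ := mem_iUnion.1 hx
    rw [hCF i] at hi
    obtain ⟨j, hj⟩ := mem_iUnion.1 hi
    obtain ⟨k, hk⟩ := he (i, j)
    exact mem_iUnion.2 ⟨k, by rwa [hk]⟩
  · rw [hCF]; exact subset_iUnion _ _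

theorem GoodDim.small_of_cover (hd : GoodDim dim) {ι : Type*} [Countable ι] [Nonempty ι] {n : ℕ}
    {c : EReal} {A : Set K} (S : ι → Set K) (hS : ∀ i, IsFσ (S i)) (hA : A ⊆ ⋃ i, S i)
    (h : ∀ i, Small dim n c (S i)) : Small dim n c A := by
  choose F hF hFn hdF using h
  refine ⟨⋃ i, F i, IsFσ.iUnion hF, indBelow_iUnion_isFσ hF hFn,
    hd.of_isFσ_cover S hS (sdiff_subset.trans hA) fun i => (hd.mono ?_).trans (hdF i)⟩
  rintro z ⟨⟨-, hz⟩, hzi⟩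
  exact ⟨hzi, fun hzF => hz (mem_iUnion.2 ⟨i, hzF⟩)⟩

/-- The fibers of a generic map have dimension at most `dStar dim n univ`. -/
theorem residual_fiber_le (hd : GoodDim dim) {n : ℕ} (hK : ¬ indBelow n ↥(univ : Set K)) :
    ∀ᶠ (f : C(K, Fin n → ℝ)) in residual C(K, Fin n → ℝ),
      ∀ y, dim (⇑f ⁻¹' {y}) ≤ dStar dim n univ := by
  have hq : ∀ q : ℚ, dStar dim n univ < ((q : ℝ) : EReal) →
      ∀ᶠ (f : C(K, Fin n → ℝ)) in residual C(K, Fin n → ℝ),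
        ∀ y, dim (⇑f ⁻¹' {y}) ≤ ((q : ℝ) : EReal) := by
    intro q hq
    obtain ⟨_, ⟨F, ⟨C, hC, hF⟩, hFn, rfl⟩, hlt⟩ := sInf_lt_iff.1 hq
    have hF' : F = ⋃ i, C i := by simpa using hF
    subst hF'
    filter_upwards [residual_finite_fibers C hC (tdim_le_iff.1 hFn)] with f hf y
    rw [← compl_eq_univ_sdiff] at hlt
    exact hd.of_finite_inter (hf y) ((dStar_nonneg hd hK).trans hq.le) hlt.le
  have hall := eventually_countable_forall.2 fun q : ℚ =>
    eventually_imp_distrib_left.2 (hq q)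
  filter_upwards [hall] with f hf y
  refine le_of_forall_gt_imp_ge_of_dense fun c hc => ?_
  obtain ⟨q, hq1, hq2⟩ := EReal.lt_iff_exists_rat_btwn.1 hc
  exact (hf q hq1 y).trans hq2.le

theorem exists_point_not_small (hd : GoodDim dim) {n : ℕ} (hK : ¬ indBelow n ↥(univ : Set K)) :
    ∃ x : K, ∀ N : Set K, IsOpen N → x ∈ N → ∀ c < dStar dim n univ, ¬ Small dim n c N := by
  have hne : Nonempty K := by
    by_contra hE
    rw [not_nonempty_iff] at hE
    exact hK (indBelow_mono n.zero_le (inferInstance : IsEmpty ↥(univ : Set K)))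
  by_contra hno
  push Not at hno
  choose N hNo hxN c hc hN using hno
  obtain ⟨t, ht⟩ := isCompact_univ.elim_finite_subcover N hNo fun x _ => mem_iUnion.2 ⟨x, hxN x⟩
  have hsup : t.sup c < dStar dim n univ :=
    (Finset.sup_lt_iff (EReal.bot_lt_zero.trans_le (dStar_nonneg hd hK))).2 fun x _ => hc x
  obtain ⟨x, hx, -⟩ := mem_iUnion₂.1 (ht (mem_univ hne.some))
  have : Nonempty ↥t := ⟨⟨x, hx⟩⟩
  refine not_small_univ hsup (hd.small_of_cover (fun x : ↥t => N x) (fun x => (hNo x).isFσ) ?_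
    fun x => hd.small_mono (hN x) le_rfl (Finset.le_sup x.2))
  intro z hz
  obtain ⟨y, hy, hzy⟩ := mem_iUnion₂.1 (ht hz)
  exact mem_iUnion.2 ⟨⟨y, hy⟩, hzy⟩

/-- Modify `f₀` inside an open set `V`, on which it is almost constant, to a prescribed small map
on a closed subset. -/
theorem exists_bump {n : ℕ} {D V : Set K} (hD : IsClosed D) (hV : IsOpen V) (hDV : D ⊆ V)
    (f₀ g : C(K, Fin n → ℝ)) (v : Fin n → ℝ) {ε : ℝ} (hε : 0 < ε)
    (hfv : ∀ z ∈ V, dist (f₀ z) v < ε) :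
    ∃ f : C(K, Fin n → ℝ), ∃ t : ℝ, 0 < t ∧ (∀ z ∉ V, f z = f₀ z) ∧
      (∀ z ∈ D, f z = v + t • g z) ∧ ∀ z, dist (f z) (f₀ z) ≤ 2 * ε := by
  obtain ⟨χ, hχ0, hχ1, hχI⟩ := exists_continuous_zero_one_of_isClosed hV.isClosed_compl hD
    (disjoint_compl_left_iff_subset.2 hDV)
  have ht : 0 < ε / (‖g‖ + 1) := by positivity
  refine ⟨⟨fun z => f₀ z + χ z • (v - f₀ z + (ε / (‖g‖ + 1)) • g z), by fun_prop⟩,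
    ε / (‖g‖ + 1), ht, fun z hz => ?_, fun z hz => ?_, fun z => ?_⟩
  · simp [hχ0 hz]
  · have := hχ1 hz
    simp only [ContinuousMap.coe_mk, this, Pi.one_apply, one_smul]
    abel
  · rw [dist_eq_norm]
    simp only [ContinuousMap.coe_mk, add_sub_cancel_left]
    by_cases hz : z ∈ V
    · rw [norm_smul, Real.norm_eq_abs, abs_of_nonneg (hχI z).1]
      have h1 : ‖v - f₀ z‖ ≤ ε := by
        rw [← dist_eq_norm, dist_comm]; exact (hfv z hz).le
      have h2 : ‖(ε / (‖g‖ + 1)) • g z‖ ≤ ε := by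
        rw [norm_smul, Real.norm_eq_abs, abs_of_pos ht, div_mul_eq_mul_div,
          div_le_iff₀ (by positivity)]
        have := g.norm_coe_le_norm z
        nlinarith
      calc χ z * ‖v - f₀ z + (ε / (‖g‖ + 1)) • g z‖ ≤ 1 * (ε + ε) := by
            gcongr
            · exact (hχI z).2
            · exact (norm_add_le _ _).trans (add_le_add h1 h2)
        _ = 2 * ε := by ring
    · rw [hχ0 hz]
      simp [hε.le]

end

section

/-- Every set is contained in a `G_δ` set of the same dimension. -/
def HasHull {K : Type u} [MetricSpace K] (dim : Set K → EReal) : Prop :=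
  ∀ (A : Set K) (c : EReal), dim A ≤ c → ∃ G : Set K, IsGδ G ∧ A ⊆ G ∧ dim G ≤ c

section Hulls

variable {K : Type u} [MetricSpace K]

theorem hasHull_tdim [SecondCountableTopology K] : HasHull (tdim : Set K → EReal) := by
  intro A c h
  rcases eq_top_or_lt_top c with rfl | hc
  · exact ⟨univ, IsGδ.univ, subset_univ A, le_top⟩
  obtain ⟨m, hm, hmc⟩ := exists_indBelow_of_tdim_le hc h
  obtain ⟨C, hC, hAC, hCm⟩ := (dec_of_indBelow hm).exists_gdelta
  refine ⟨(⋃ i, C i)ᶜ, IsFσ.iUnion fun i => (hC i).isFσ, hAC,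
    (tdim_le_of_indBelow hCm.indBelow).trans hmc⟩

open MeasureTheory in
theorem exists_open_cover_of_hausdorffMeasure_eq_zero [MeasurableSpace K] [BorelSpace K] {s : ℝ}
    (hs : 0 < s) {A : Set K} (h : μH[s] A = 0) {ε : ℝ≥0∞} (hε : ε ≠ 0) (hε' : ε ≠ ∞) :
    ∃ t : ℕ → Set K, (∀ i, IsOpen (t i)) ∧ A ⊆ ⋃ i, t i ∧ (∀ i, ediam (t i) ≤ ε) ∧
      ∑' i, ediam (t i) ^ s ≤ ε := by
  have hε2 : 0 < ε / 2 := ENNReal.half_pos hε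
  rw [Measure.hausdorffMeasure_apply] at h
  have h1 := (le_iSup₂ (f := fun (r : ℝ≥0∞) (_ : 0 < r) =>
    ⨅ (t : ℕ → Set K) (_ : A ⊆ ⋃ n, t n) (_ : ∀ n, ediam (t n) ≤ r),
      ∑' n, ⨆ _ : (t n).Nonempty, ediam (t n) ^ s) (ε / 2) hε2).trans h.le
  have h2 := h1.trans_lt hε2
  simp only [iInf_lt_iff] at h2
  obtain ⟨t, hAt, htd, hts⟩ := h2
  obtain ⟨ε', hε'0, hε'1⟩ := ENNReal.exists_pos_sum_of_countable hε2.ne' ℕ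
  have hU : ∀ i, ∃ U : Set K, IsOpen U ∧ t i ⊆ U ∧ ediam U ≤ ε ∧
      ediam U ^ s ≤ (⨆ _ : (t i).Nonempty, ediam (t i) ^ s) + ε' i := by
    intro i
    rcases (t i).eq_empty_or_nonempty with h0 | hne
    · exact ⟨∅, isOpen_empty, h0.le, by simp, by simp [ENNReal.zero_rpow_of_pos hs]⟩
    have hlt : ediam (t i) < ε := (htd i).trans_lt (ENNReal.half_lt_self hε hε')
    have hlim : Tendsto (fun δ : ℝ≥0 => ediam (t i) + 2 * (δ : ℝ≥0∞)) (𝓝[>] 0)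
        (𝓝 (ediam (t i))) := by
      have hc : Continuous fun δ : ℝ≥0 => ediam (t i) + 2 * (δ : ℝ≥0∞) :=
        continuous_const.add (ENNReal.continuous_const_mul (by simp) |>.comp
          ENNReal.continuous_coe)
      have := hc.tendsto 0
      simp only [ENNReal.coe_zero, mul_zero, add_zero] at this
      exact this.mono_left nhdsWithin_le_nhds
    have hlims := ((ENNReal.continuous_rpow_const (y := s)).tendsto (ediam (t i))).comp hlim
    have hlts : ediam (t i) ^ s < ediam (t i) ^ s + ε' i :=
      ENNReal.lt_add_right (ENNReal.rpow_lt_top_of_nonneg hs.le (hlt.trans_le le_top).ne).ne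
        (ENNReal.coe_pos.2 (hε'0 i)).ne'
    obtain ⟨δ, ⟨hδ1, hδ2⟩, hδ⟩ := (((hlim.eventually_lt_const hlt).and
      (hlims.eventually_lt_const hlts)).and self_mem_nhdsWithin).exists
    refine ⟨thickening δ (t i), isOpen_thickening,
      self_subset_thickening (NNReal.coe_pos.2 hδ) _, (ediam_thickening_le δ).trans hδ1.le, ?_⟩
    rw [ciSup_pos hne]
    exact (ENNReal.rpow_le_rpow (ediam_thickening_le δ) hs.le).trans hδ2.le
  choose U hUo htU hUd hUs using hU
  refine ⟨U, hUo, hAt.trans (iUnion_mono htU), hUd, ?_⟩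
  calc ∑' i, ediam (U i) ^ s ≤ ∑' i, ((⨆ _ : (t i).Nonempty, ediam (t i) ^ s) + ε' i) :=
        ENNReal.tsum_le_tsum hUs
    _ = _ := ENNReal.tsum_add
    _ ≤ ε / 2 + ε / 2 := add_le_add hts.le hε'1.le
    _ = ε := ENNReal.add_halves ε

open MeasureTheory in
theorem exists_isGδ_hausdorffMeasure_eq_zero [MeasurableSpace K] [BorelSpace K] {s : ℝ}
    (hs : 0 < s) {A : Set K} (h : μH[s] A = 0) : ∃ G, IsGδ G ∧ A ⊆ G ∧ μH[s] G = 0 := by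
  have hk : ∀ k : ℕ, ((k : ℝ≥0∞) + 1)⁻¹ ≠ 0 := fun k => by simp
  have hk' : ∀ k : ℕ, ((k : ℝ≥0∞) + 1)⁻¹ ≠ ∞ := fun k => by simp
  choose t hto hAt htd hts using fun k : ℕ =>
    exists_open_cover_of_hausdorffMeasure_eq_zero hs h (hk k) (hk' k)
  refine ⟨⋂ k, ⋃ i, t k i, IsGδ.iInter_of_isOpen fun k => isOpen_iUnion (hto k),
    subset_iInter hAt, le_antisymm ?_ zero_le⟩
  have hlim : Tendsto (fun k : ℕ => ((k : ℝ≥0∞) + 1)⁻¹) atTop (𝓝 0) := by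
    have := (tendsto_add_atTop_iff_nat 1).2 ENNReal.tendsto_inv_nat_nhds_zero
    exact_mod_cast this
  refine (Measure.hausdorffMeasure_le_liminf_tsum s _ _ hlim t (Eventually.of_forall htd)
    (Eventually.of_forall fun k => iInter_subset _ k)).trans ?_
  exact (liminf_le_liminf (Eventually.of_forall hts)).trans hlim.liminf_eq.le

theorem hasHull_hdim : HasHull (hdim : Set K → EReal) := by
  intro A c h
  rcases A.eq_empty_or_nonempty with rfl | hA
  · exact ⟨∅, IsGδ.empty, le_rfl, h⟩
  rcases eq_top_or_lt_top c with rfl | hc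
  · exact ⟨univ, IsGδ.univ, subset_univ A, le_top⟩
  have hdA : ∀ B : Set K, B.Nonempty → hdim B = ((dimH B : ℝ≥0∞) : EReal) :=
    fun B hB => if_neg hB.ne_empty
  have h0 : 0 ≤ c := (goodDim_hdim.nonneg hA).trans h
  rw [hdA A hA, ← EReal.coe_toENNReal h0, EReal.coe_ennreal_le_coe_ennreal_iff] at h
  borelize K
  have hG : ∀ q : {q : ℚ // c < ((q : ℝ) : EReal)}, ∃ G, IsGδ G ∧ A ⊆ G ∧
      MeasureTheory.Measure.hausdorffMeasure (q.1 : ℝ) G = 0 := by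
    rintro ⟨q, hq⟩
    have hq0 : (0 : ℝ) < q := by exact_mod_cast h0.trans_lt hq
    refine exists_isGδ_hausdorffMeasure_eq_zero hq0 ?_
    refine hausdorffMeasure_of_dimH_lt (d := ⟨(q : ℝ), hq0.le⟩) (h.trans_lt ?_)
    rw [← EReal.coe_ennreal_lt_coe_ennreal_iff, EReal.coe_toENNReal h0]
    exact hq
  choose G hGδ hAG hG0 using hG
  refine ⟨⋂ q, G q, IsGδ.iInter hGδ, subset_iInter hAG, ?_⟩
  rw [hdA _ (hA.mono (subset_iInter hAG))]
  refine le_of_forall_gt_imp_ge_of_dense fun b hb => ?_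
  obtain ⟨q, hq1, hq2⟩ := EReal.lt_iff_exists_rat_btwn.1 hb
  have hq0 : (0 : ℝ) < q := by exact_mod_cast h0.trans_lt hq1
  refine le_trans ?_ hq2.le
  obtain ⟨d, hdq⟩ : ∃ d : ℝ≥0, (d : ℝ) = q := ⟨⟨q, hq0.le⟩, rfl⟩
  have h1 : dimH (⋂ q, G q) ≤ (d : ℝ≥0∞) := by
    refine dimH_le_of_hausdorffMeasure_ne_top ?_
    refine ne_top_of_le_ne_top ENNReal.zero_ne_top (b := 0) ?_
    rw [hdq]
    exact (MeasureTheory.measure_mono (iInter_subset G ⟨q, hq1⟩)).trans (hG0 ⟨q, hq1⟩).le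
  rw [← hdq]
  exact EReal.coe_ennreal_le_coe_ennreal_iff.2 h1

end Hulls

variable {K : Type u} [MetricSpace K] [CompactSpace K] {dim : Set K → EReal}

theorem dist_inv_smul_sub_lt {E : Type*} [NormedAddCommGroup E] [NormedSpace ℝ E] {a b v w : E}
    {t η : ℝ} (ht : 0 < t) (ha : dist a (v + t • w) < t * η / 2) (hb : dist b v < t * η / 2) :
    dist (t⁻¹ • (a - b)) w < η := by
  have h : t⁻¹ • (a - b) - w = t⁻¹ • ((a - (v + t • w)) - (b - v)) := by
    have : t⁻¹ • t • w = w := inv_smul_smul₀ ht.ne' _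
    nth_rewrite 1 [← this]
    rw [← smul_sub]
    congr 1
    abel
  rw [dist_eq_norm] at ha hb ⊢
  rw [h, norm_smul, norm_inv, Real.norm_eq_abs, abs_of_pos ht, inv_mul_lt_iff₀ ht]
  refine (norm_sub_le _ _).trans_lt ?_
  linarith

theorem unst_of_dense {n : ℕ} {x : K} {Q N : Set K} {f₀ : C(K, Fin n → ℝ)} {ε : ℝ} (hε : 0 < ε)
    {𝒟 : Set C(K, Fin n → ℝ)} (h𝒟 : ball f₀ ε ⊆ closure 𝒟) (hQ : IsClosed Q) (hN : IsOpen N)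
    (hQN : Q ⊆ N) (hx : x ∉ Q) (hfN : ∀ z ∈ N, dist (f₀ z) (f₀ x) < ε / 8)
    (hne : ∀ f ∈ 𝒟, ∀ z ∈ Q, f z ≠ f x) : Unst n ↥Q := by
  intro g δ hδ
  obtain ⟨g', hg'⟩ := ContinuousMap.exists_restrict_eq hQ g
  obtain ⟨f₁, t, ht, hf₁, hfQ, hfd⟩ := exists_bump hQ (hN.sdiff isClosed_singleton)
    (subset_sdiff_singleton hQN hx) f₀ g' (f₀ x) (show 0 < ε / 8 by positivity)
    fun z hz => hfN z hz.1
  have hf₁ε : f₁ ∈ ball f₀ ε := by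
    refine lt_of_le_of_lt ((ContinuousMap.dist_le (by positivity)).2 hfd) ?_
    linarith
  obtain ⟨f, hf, hff⟩ := Metric.mem_closure_iff.1 (h𝒟 hf₁ε) (t * δ / 2) (by positivity)
  have hpt : ∀ z, dist (f z) (f₁ z) < t * δ / 2 := fun z => by
    rw [dist_comm]
    exact (ContinuousMap.dist_apply_le_dist z).trans_lt hff
  refine ⟨⟨fun p : ↥Q => t⁻¹ • (f p - f x), by fun_prop⟩, fun p => ?_, fun p => ?_⟩
  · have hgp : g p = g' p := by rw [← hg']; rfl
    rw [hgp]
    exact dist_inv_smul_sub_lt ht (hfQ p p.2 ▸ hpt p) (hf₁ x (by simp) ▸ hpt x)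
  · exact smul_ne_zero (inv_ne_zero ht.ne') (sub_ne_zero.2 (hne f hf p p.2))

/-- For dimensions with `G_δ` hulls, the fiber of a generic map through a point all of whose
neighborhoods are large has large dimension. -/
theorem residual_lt_fiber (hd : GoodDim dim) (hh : HasHull dim) {n : ℕ} {c : EReal} {x : K}
    (hx : ∀ N : Set K, IsOpen N → x ∈ N → ¬ Small dim n c N) :
    ∀ᶠ (f : C(K, Fin n → ℝ)) in residual C(K, Fin n → ℝ), c < dim (⇑f ⁻¹' {f x}) := by
  suffices h : IsNowhereDense {f : C(K, Fin n → ℝ) | dim (⇑f ⁻¹' {f x}) ≤ c} by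
    filter_upwards [h.isMeagre] with f hf
    exact not_le.1 hf
  by_contra hnd
  obtain ⟨f₀, hf₀⟩ := nonempty_iff_ne_empty.2 hnd
  obtain ⟨ε, hε, hball⟩ := Metric.mem_nhds_iff.1 (mem_interior_iff_mem_nhds.1 hf₀)
  obtain ⟨𝒟, h𝒟S, h𝒟c, h𝒟d⟩ := (IsSeparable.of_separableSpace
    {f : C(K, Fin n → ℝ) | dim (⇑f ⁻¹' {f x}) ≤ c}).exists_countable_dense_subset
  have h𝒟b : ball f₀ ε ⊆ closure 𝒟 := hball.trans (closure_minimal h𝒟d isClosed_closure)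
  obtain ⟨f₁, hf₁⟩ : 𝒟.Nonempty := closure_nonempty_iff.1 ⟨f₀, h𝒟b (mem_ball_self hε)⟩
  have := h𝒟c.to_subtype
  have : Nonempty ↥𝒟 := ⟨⟨f₁, hf₁⟩⟩
  obtain ⟨G, hG, hHG, hGc⟩ := hh (⋃ f : ↥𝒟, ⇑f.1 ⁻¹' {f.1 x}) c
    (hd.of_isFσ_cover _ (fun f => (isClosed_singleton.preimage f.1.continuous).isFσ) le_rfl
      fun f => (hd.mono inter_subset_right).trans (h𝒟S f.2))
  let N : Set K := f₀ ⁻¹' ball (f₀ x) (ε / 8)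
  have hN : IsOpen N := isOpen_ball.preimage f₀.continuous
  have hxN : x ∈ N := mem_ball_self (by positivity)
  have hF : IsFσ (Gᶜ ∩ N) := IsFσ.inter (by rwa [IsFσ, compl_compl]) hN.isFσ
  refine hx N hN hxN ⟨Gᶜ ∩ N, hF, ?_, (hd.mono ?_).trans hGc⟩
  · obtain ⟨Q, hQ, hQF⟩ := isFσ_iff.1 hF
    rw [hQF]
    refine indBelow_iUnion_isFσ (fun i => (hQ i).isFσ) fun i => ?_
    have hQG : Q i ⊆ Gᶜ ∩ N := hQF ▸ subset_iUnion Q i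
    have : CompactSpace ↥(Q i) := isCompact_iff_compactSpace.1 (hQ i).isCompact
    refine (unst_of_dense hε h𝒟b (hQ i) hN (hQG.trans inter_subset_right) (fun hxQ => ?_)
      (fun z hz => hz) fun f hf z hz hfz => ?_).indBelow
    · exact (hQG hxQ).1 (hHG (mem_iUnion.2 ⟨⟨f₁, hf₁⟩, rfl⟩))
    · exact (hQG hz).1 (hHG (mem_iUnion.2 ⟨⟨f, hf⟩, hfz⟩))
  · rintro z ⟨hzN, hz⟩
    by_contra hzG
    exact hz ⟨hzG, hzN⟩

end

section

variable {K : Type u} [MetricSpace K] {n : ℕ}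

/-- Every map uniformly close to `f` on `V` and at `x` has a point of `V ∩ L` in its fiber
through `x`. -/
def Stable (L : Set K) (x : K) (V : Set K) (f : C(K, Fin n → ℝ)) : Prop :=
  ∃ η > 0, ∀ g : C(K, Fin n → ℝ), (∀ z ∈ V, dist (g z) (f z) < η) → dist (g x) (f x) < η →
    ∃ z ∈ V ∩ L, g z = g x

namespace Stable

variable {L V W : Set K} {x : K} {f f' : C(K, Fin n → ℝ)}

theorem mono (h : Stable L x V f) (hVW : V ⊆ W) : Stable L x W f := by
  obtain ⟨η, hη, h⟩ := h
  refine ⟨η, hη, fun g hg hx => ?_⟩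
  obtain ⟨z, hz, hgz⟩ := h g (fun z hz => hg z (hVW hz)) hx
  exact ⟨z, ⟨hVW hz.1, hz.2⟩, hgz⟩

theorem congr (h : Stable L x V f) (hV : ∀ z ∈ V, f' z = f z) (hx : f' x = f x) :
    Stable L x V f' := by
  obtain ⟨η, hη, h⟩ := h
  refine ⟨η, hη, fun g hg hgx => h g (fun z hz => ?_) (hx ▸ hgx)⟩
  rw [← hV z hz]; exact hg z hz

theorem exists_mem (h : Stable L x V f) : ∃ z ∈ V ∩ L, f z = f x := by
  obtain ⟨η, hη, h⟩ := h
  exact h f (fun z _ => by simpa using hη) (by simpa using hη)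

theorem of_mem (hxL : x ∈ L) (hxV : x ∈ V) : Stable L x V f :=
  ⟨1, one_pos, fun _ _ _ => ⟨x, ⟨hxV, hxL⟩, rfl⟩⟩

variable [CompactSpace K]

theorem isOpen : IsOpen {f : C(K, Fin n → ℝ) | Stable L x V f} := by
  rw [Metric.isOpen_iff]
  rintro f ⟨η, hη, h⟩
  refine ⟨η / 2, half_pos hη, fun f' hf' => ⟨η / 2, half_pos hη, fun g hg hgx => ?_⟩⟩
  have hff : ∀ z, dist (f' z) (f z) < η / 2 := fun z =>
    (ContinuousMap.dist_apply_le_dist z).trans_lt hf'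
  refine h g (fun z hz => ?_) ?_
  · linarith [dist_triangle (g z) (f' z) (f z), hg z hz, hff z]
  · linarith [dist_triangle (g x) (f' x) (f x), hff x]

theorem exists_near (hxL : x ∈ L) (hV : IsOpen V)
    (hVL : ∃ D, IsClosed D ∧ D ⊆ V ∩ L ∧ ¬ indBelow n ↥D) (f₀ : C(K, Fin n → ℝ)) {ε : ℝ}
    (hε : 0 < ε) (hf₀ : ∀ z ∈ V, dist (f₀ z) (f₀ x) < ε) :
    ∃ f : C(K, Fin n → ℝ), (∀ z ∉ V, f z = f₀ z) ∧ (∀ z, dist (f z) (f₀ z) ≤ 2 * ε) ∧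
      f x = f₀ x ∧ Stable L x V f := by
  by_cases hxV : x ∈ V
  · exact ⟨f₀, fun _ _ => rfl, fun z => by simpa using hε.le, rfl, of_mem hxL hxV⟩
  obtain ⟨D, hD, hDV, hDn⟩ := hVL
  obtain ⟨g, δ, hδ, hg⟩ := exists_stable hD hDn
  obtain ⟨f, t, ht, hfV, hfD, hff⟩ :=
    exists_bump hD hV (hDV.trans inter_subset_left) f₀ g (f₀ x) hε hf₀
  refine ⟨f, hfV, hff, hfV x hxV, t * δ / 2, by positivity, fun g₁ hg₁ hg₁x => ?_⟩
  obtain ⟨p, hp, hp0⟩ := hg ⟨fun z => t⁻¹ • (g₁ z - g₁ x), by fun_prop⟩ fun p hp =>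
    dist_inv_smul_sub_lt ht (hfD p hp ▸ hg₁ p (hDV hp).1) (hfV x hxV ▸ hg₁x)
  refine ⟨p, hDV hp, ?_⟩
  exact sub_eq_zero.1 ((smul_eq_zero.1 hp0).resolve_left (inv_ne_zero ht.ne'))

theorem exists_near_finset {ι : Type*} (T : Finset ι) (B : ι → Set K) (hxL : x ∈ L)
    (hB : ∀ p ∈ T, IsOpen (B p))
    (hBL : ∀ p ∈ T, ∃ D, IsClosed D ∧ D ⊆ B p ∩ L ∧ ¬ indBelow n ↥D)
    (hd : (T : Set ι).Pairwise fun p q => Disjoint (B p) (B q)) (f₀ : C(K, Fin n → ℝ)) {ε : ℝ}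
    (hε : 0 < ε) (hf₀ : ∀ p ∈ T, ∀ z ∈ B p, dist (f₀ z) (f₀ x) < ε) :
    ∃ f : C(K, Fin n → ℝ), (∀ z, (∀ p ∈ T, z ∉ B p) → f z = f₀ z) ∧
      (∀ z, dist (f z) (f₀ z) ≤ 2 * ε) ∧ f x = f₀ x ∧ ∀ p ∈ T, Stable L x (B p) f := by
  classical
  induction T using Finset.induction_on with
  | empty => exact ⟨f₀, fun _ _ => rfl, fun z => by simpa using hε.le, rfl, by simp⟩
  | insert p T hpT ih =>
    have hdp : ∀ q ∈ T, Disjoint (B q) (B p) := fun q hq =>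
      hd (by simp [hq]) (by simp) fun h => hpT (h ▸ hq)
    obtain ⟨f', hf'B, hf'd, hf'x, hf'S⟩ := ih (fun q hq => hB q (Finset.mem_insert_of_mem hq))
      (fun q hq => hBL q (Finset.mem_insert_of_mem hq))
      (hd.mono (by simp)) (fun q hq => hf₀ q (Finset.mem_insert_of_mem hq))
    have hf'p : ∀ z ∈ B p, f' z = f₀ z := fun z hz =>
      hf'B z fun q hq hzq => disjoint_left.1 (hdp q hq) hzq hz
    obtain ⟨f, hfB, hfd, hfx, hfS⟩ := exists_near hxL (hB p (Finset.mem_insert_self p T))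
      (hBL p (Finset.mem_insert_self p T)) f' hε fun z hz => by
        rw [hf'p z hz, hf'x]; exact hf₀ p (Finset.mem_insert_self p T) z hz
    refine ⟨f, fun z hz => ?_, fun z => ?_, hfx.trans hf'x, fun q hq => ?_⟩
    · rw [hfB z (hz p (Finset.mem_insert_self p T)),
        hf'B z fun q hq => hz q (Finset.mem_insert_of_mem hq)]
    · by_cases hz : z ∈ B p
      · rw [← hf'p z hz]; exact hfd z
      · rw [hfB z hz]; exact hf'd z
    · rcases Finset.mem_insert.1 hq with rfl | hq
      · exact hfS
      · exact (hf'S q hq).congr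
          (fun z hz => hfB z fun hzp => disjoint_left.1 (hdp q hq) hz hzp) hfx

end Stable

variable [CompactSpace K]

/-- There are finite packings of `A` by arbitrarily small balls with arbitrarily large `s`-sums. -/
def ManyPackings (s : ℝ) (A : Set K) : Prop :=
  ∀ m : ℕ, ∃ T : Finset (K × ℝ≥0),
    (∀ p ∈ T, p.1 ∈ A ∧ 0 < p.2 ∧ p.2 ≤ ((m : ℝ≥0) + 1)⁻¹) ∧
    ((T : Set (K × ℝ≥0)).Pairwise fun p q =>
      Disjoint (closedBall p.1 (p.2 : ℝ)) (closedBall q.1 (q.2 : ℝ))) ∧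
    (m : ℝ≥0) < ∑ p ∈ T, (p.2 / 4) ^ s

/-- A finite packing with large `s`-sum such that `f` is stable on basic open sets close to the
centers of its balls. -/
def StablePacking (s : ℝ) (L : Set K) (x : K) (V : Set K) (m : ℕ) (f : C(K, Fin n → ℝ)) : Prop :=
  ∃ (T : Finset (K × ℝ≥0)) (B : K × ℝ≥0 → Set K),
    (∀ p ∈ T, 0 < p.2 ∧ p.2 ≤ ((m : ℝ≥0) + 1)⁻¹ ∧ B p ∈ countableBasis K ∧
      closure (B p) ⊆ V ∩ closedBall p.1 (p.2 / 2)) ∧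
    ((T : Set (K × ℝ≥0)).Pairwise fun p q =>
      Disjoint (closedBall p.1 (p.2 : ℝ)) (closedBall q.1 (q.2 : ℝ))) ∧
    (m : ℝ≥0) < ∑ p ∈ T, (p.2 / 4) ^ s ∧
    ∀ p ∈ T, Stable L x (B p) f

theorem StablePacking.isOpen {s : ℝ} {L : Set K} {x : K} {V : Set K} {m : ℕ} :
    IsOpen {f : C(K, Fin n → ℝ) | StablePacking s L x V m f} := by
  rw [isOpen_iff_mem_nhds]
  rintro f ⟨T, B, h1, h2, h3, h4⟩
  filter_upwards [(Filter.eventually_all_finset T).2 fun p hp =>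
    Stable.isOpen.mem_nhds (h4 p hp)] with f' hf'
  exact ⟨T, B, h1, h2, h3, hf'⟩

theorem Stable.mem_closure_stablePacking {s : ℝ} {L : Set K} {x : K} {V : Set K} (hxL : x ∈ L)
    (hp : ∀ V : Set K, IsOpen V → (V ∩ L).Nonempty → ManyPackings s (V ∩ L))
    (hD : ∀ V : Set K, IsOpen V → (V ∩ L).Nonempty →
      ∃ D, IsClosed D ∧ D ⊆ V ∩ L ∧ ¬ indBelow n ↥D)
    (hV : IsOpen V) (m : ℕ) {f₀ : C(K, Fin n → ℝ)} (h : Stable L x V f₀) :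
    f₀ ∈ closure {f : C(K, Fin n → ℝ) | StablePacking s L x V m f} := by
  rw [Metric.mem_closure_iff]
  intro ε hε
  obtain ⟨z₀, hz₀, hfz₀⟩ := h.exists_mem
  let V' : Set K := V ∩ f₀ ⁻¹' ball (f₀ x) (ε / 3)
  have hV' : IsOpen V' := hV.inter (isOpen_ball.preimage f₀.continuous)
  have hz₀V' : z₀ ∈ V' := ⟨hz₀.1, by
    rw [mem_preimage, hfz₀]; exact mem_ball_self (by positivity)⟩
  obtain ⟨T, hT, hTd, hTs⟩ := hp V' hV' ⟨z₀, hz₀V', hz₀.2⟩ m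
  have hB : ∀ p : K × ℝ≥0, ∃ B : Set K, p ∈ T → B ∈ countableBasis K ∧ p.1 ∈ B ∧
      closure B ⊆ V' ∩ closedBall p.1 (p.2 / 2) := by
    intro p
    by_cases hpT : p ∈ T
    · obtain ⟨B, h1, h2, h3⟩ := (isBasis_countableBasis K).exists_closure_subset
        (inter_mem (hV'.mem_nhds (hT p hpT).1.1)
          (closedBall_mem_nhds p.1 (ε := (p.2 : ℝ) / 2) (half_pos (hT p hpT).2.1)))
      exact ⟨B, fun _ => ⟨h1, h2, h3⟩⟩
    · exact ⟨∅, fun h => (hpT h).elim⟩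
  choose B hB using hB
  have hBo : ∀ p ∈ T, IsOpen (B p) := fun p hpT => isOpen_of_mem_countableBasis (hB p hpT).1
  have hBc : ∀ p ∈ T, B p ⊆ closedBall p.1 p.2 := fun p hpT => subset_closure.trans
    ((hB p hpT).2.2.trans (inter_subset_right.trans (closedBall_subset_closedBall
      (half_le_self p.2.2))))
  obtain ⟨f, -, hfd, -, hfS⟩ := Stable.exists_near_finset T B hxL hBo
    (fun p hpT => hD (B p) (hBo p hpT) ⟨p.1, (hB p hpT).2.1, (hT p hpT).1.2⟩)
    (fun p hpT q hqT hpq => (hTd hpT hqT hpq).mono (hBc p hpT) (hBc q hqT)) f₀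
    (show 0 < ε / 3 by positivity)
    fun p hpT z hz => ((hB p hpT).2.2 (subset_closure hz)).1.2
  refine ⟨f, ⟨T, B, fun p hpT => ⟨(hT p hpT).2.1, (hT p hpT).2.2, (hB p hpT).1,
    (hB p hpT).2.2.trans (inter_subset_inter_left _ inter_subset_left)⟩, hTd, hTs, hfS⟩, ?_⟩
  rw [dist_comm]
  refine lt_of_le_of_lt ((ContinuousMap.dist_le (by positivity)).2 hfd) ?_
  linarith

theorem residual_stable_imp_stablePacking {s : ℝ} {L : Set K} {x : K} (hxL : x ∈ L)
    (hp : ∀ V : Set K, IsOpen V → (V ∩ L).Nonempty → ManyPackings s (V ∩ L))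
    (hD : ∀ V : Set K, IsOpen V → (V ∩ L).Nonempty →
      ∃ D, IsClosed D ∧ D ⊆ V ∩ L ∧ ¬ indBelow n ↥D) :
    ∀ᶠ (f : C(K, Fin n → ℝ)) in residual C(K, Fin n → ℝ),
      ∀ V ∈ countableBasis K, ∀ m : ℕ, Stable L x V f → StablePacking s L x V m f := by
  refine (eventually_countable_ball (countable_countableBasis K)).2 fun V hV =>
    eventually_countable_forall.2 fun m => ?_
  have hsub : {f : C(K, Fin n → ℝ) | Stable L x V f} ⊆
      closure {f : C(K, Fin n → ℝ) | StablePacking s L x V m f} := fun f hf =>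
    hf.mem_closure_stablePacking hxL hp hD (isOpen_of_mem_countableBasis hV) m
  refine mem_of_superset (residual_of_dense_open (s := {f | StablePacking s L x V m f} ∪
    (closure {f : C(K, Fin n → ℝ) | Stable L x V f})ᶜ)
    (StablePacking.isOpen.union isClosed_closure.isOpen_compl) fun f => ?_) ?_
  · by_cases hf : f ∈ closure {f : C(K, Fin n → ℝ) | Stable L x V f}
    · exact closure_mono subset_union_left (closure_minimal hsub isClosed_closure hf)
    · exact subset_closure (Or.inr hf)
  · rintro f (hf | hf) hS
    · exact hf
    · exact (hf (subset_closure hS)).elim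

end

section

variable {K : Type u} [MetricSpace K]

theorem sum_le_packPre {h : ℝ≥0 → ℝ≥0} {A : Set K} {δ : ℝ≥0} {ι : Type*} (T : Finset ι)
    (e : ι → K) (r : ι → ℝ≥0) (he : ∀ p ∈ T, e p ∈ A) (hr : ∀ p ∈ T, r p ≤ δ)
    (hd : (T : Set ι).Pairwise fun p q =>
      Disjoint (closedBall (e p) (r p : ℝ)) (closedBall (e q) (r q : ℝ))) :
    ((∑ p ∈ T, h (r p) : ℝ≥0) : ℝ≥0∞) ≤ packPre h A δ := by
  classical
  have hinj : Set.InjOn (fun p => (e p, r p)) (T : Set ι) := by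
    intro p hp q hq hpq
    by_contra hne
    have h1 : e p = e q := congrArg Prod.fst hpq
    exact disjoint_left.1 (hd hp hq hne) (mem_closedBall_self (r p).2)
      (h1 ▸ mem_closedBall_self (r q).2)
  have hP : IsPacking A δ ((T.image fun p => (e p, r p) : Finset (K × ℝ≥0)) : Set (K × ℝ≥0)) := by
    refine ⟨Finset.countable_toSet _, ?_, ?_⟩
    · simp only [Finset.coe_image, Set.mem_image, Finset.mem_coe]
      rintro _ ⟨p, hp, rfl⟩
      exact ⟨he p hp, hr p hp⟩
    · simp only [Finset.coe_image]
      rintro _ ⟨p, hp, rfl⟩ _ ⟨q, hq, rfl⟩ hpq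
      exact hd hp hq fun h => hpq (h ▸ rfl)
  refine le_trans (le_of_eq ?_) (le_iSup₂ (f := fun (s : Set (K × ℝ≥0)) (_ : IsPacking A δ s) =>
    ∑' p : s, ((h p.1.2 : ℝ≥0) : ℝ≥0∞)) _ hP)
  rw [Finset.tsum_subtype' _ fun p : K × ℝ≥0 => ((h p.2 : ℝ≥0) : ℝ≥0∞), Finset.sum_image hinj]
  push_cast
  rfl

theorem manyPackings_of_packMeasure_eq_top {s t : ℝ} (hs : 0 ≤ s) (hst : s < t) {A : Set K}
    (h : packMeasure (fun r => r ^ t) A = ∞) : ManyPackings s A := by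
  intro m
  have h0 : packPre0 (fun r => r ^ t) A = ∞ := top_le_iff.1 (h ▸ packMeasure_le_packPre0 _ A)
  have hm : (0 : ℝ≥0) < ((m : ℝ≥0) + 1)⁻¹ := by positivity
  have h1 : packPre (fun r => r ^ t) A ((m : ℝ≥0) + 1)⁻¹ = ∞ := by
    simp only [packPre0, iInf_eq_top] at h0
    exact h0 _ hm
  have h2 : ((4 ^ s * m : ℝ≥0) : ℝ≥0∞) < packPre (fun r => r ^ t) A ((m : ℝ≥0) + 1)⁻¹ := by
    rw [h1]; exact ENNReal.coe_lt_top
  simp only [packPre, lt_iSup_iff] at h2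
  obtain ⟨P, hP, hlt⟩ := h2
  rw [ENNReal.tsum_eq_iSup_sum] at hlt
  obtain ⟨F, hF⟩ := lt_iSup_iff.1 hlt
  norm_cast at hF
  classical
  refine ⟨(F.map (Function.Embedding.subtype _)).filter fun p => 0 < p.2, ?_, ?_, ?_⟩
  · intro p hp
    simp only [Finset.mem_filter, Finset.mem_map, Function.Embedding.subtype_apply] at hp
    obtain ⟨⟨q, hq, rfl⟩, hp0⟩ := hp
    exact ⟨(hP.2.1 q q.2).1, hp0, (hP.2.1 q q.2).2⟩
  · refine hP.2.2.mono fun p hp => ?_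
    simp only [Finset.coe_filter, Finset.mem_map, Function.Embedding.subtype_apply] at hp
    obtain ⟨⟨q, hq, rfl⟩, hp0⟩ := hp
    exact q.2
  · have hF' : 4 ^ s * m < ∑ p ∈ (F.map (Function.Embedding.subtype _)).filter fun p => 0 < p.2,
        p.2 ^ t := by
      rw [Finset.sum_filter_of_ne, Finset.sum_map]
      · exact hF
      · intro p _ hp
        refine pos_iff_ne_zero.2 fun h0 => hp ?_
        rw [h0, NNReal.zero_rpow (hs.trans_lt hst).ne']
    simp only [NNReal.div_rpow]
    rw [← Finset.sum_div, lt_div_iff₀ (by positivity), mul_comm]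
    refine hF'.trans_le (Finset.sum_le_sum fun p hp => ?_)
    simp only [Finset.mem_filter, Finset.mem_map, Function.Embedding.subtype_apply] at hp
    obtain ⟨⟨q, -, rfl⟩, hp0⟩ := hp
    exact NNReal.rpow_le_rpow_of_exponent_ge hp0
      ((hP.2.1 q q.2).2.trans (inv_le_one_of_one_le₀ (by simp))) hst.le

variable {n : ℕ}

theorem manyPackings_of_not_small {s : ℝ≥0} {A : Set K} (h : ¬ Small pdim n (s : ℝ) A) :
    ManyPackings s A := by
  have hA : (s : ℝ) < pdim A := by
    by_contra hle
    exact h ⟨∅, isClosed_empty.isFσ, indBelow_mono n.zero_le (inferInstance : IsEmpty ↥(∅ : Set K)),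
      by simpa using hle⟩
  have hne : A ≠ ∅ := by
    rintro rfl
    rw [goodDim_pdim.empty] at hA
    exact (neg_one_le_zero.trans (EReal.coe_nonneg.2 s.2)).not_gt hA
  rw [pdim, if_neg hne, lt_max_iff] at hA
  rcases hA with hA | hA
  · exact ((EReal.coe_nonneg.2 s.2).not_gt hA).elim
  · simp only [lt_iSup_iff] at hA
    obtain ⟨t, ht, hst⟩ := hA
    exact manyPackings_of_packMeasure_eq_top s.2 (EReal.coe_lt_coe_iff.1 hst) ht

/-- The points all of whose neighborhoods are large. -/
def largeSet (dim : Set K → EReal) (n : ℕ) (c : EReal) : Set K :=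
  {z | ∀ N : Set K, IsOpen N → z ∈ N → ¬ Small dim n c N}

theorem isClosed_largeSet {dim : Set K → EReal} {c : EReal} : IsClosed (largeSet dim n c) := by
  rw [← isOpen_compl_iff, isOpen_iff_forall_mem_open]
  intro z hz
  simp only [largeSet, mem_compl_iff, mem_ofPred_eq, not_forall, not_not] at hz
  obtain ⟨N, hN, hzN, hNS⟩ := hz
  exact ⟨N, fun w hw hwL => hwL N hN hw hNS, hN, hzN⟩

variable [CompactSpace K]

/-- The points all of whose basic neighborhoods are stable. -/
def stableSet (L : Set K) (x : K) (f : C(K, Fin n → ℝ)) : Set K :=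
  {z | ∀ V ∈ countableBasis K, z ∈ V → Stable L x V f}

section StableSet

variable {s : ℝ} {L : Set K} {x : K} {f : C(K, Fin n → ℝ)}

theorem isClosed_stableSet : IsClosed (stableSet L x f) := by
  rw [← isOpen_compl_iff, isOpen_iff_forall_mem_open]
  intro z hz
  simp only [stableSet, mem_compl_iff, mem_ofPred_eq, not_forall] at hz
  obtain ⟨V, hV, hzV, hVS⟩ := hz
  exact ⟨V, fun w hw hwE => hVS (hwE V hV hw), isOpen_of_mem_countableBasis hV, hzV⟩

theorem stableSet_subset : stableSet L x f ⊆ ⇑f ⁻¹' {f x} := by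
  intro z hz
  by_contra hzf
  obtain ⟨V, hV, hzV, hVf⟩ := (isBasis_countableBasis K).exists_subset_of_mem_open
    (show z ∈ (⇑f ⁻¹' {f x})ᶜ from hzf) (isClosed_singleton.preimage f.continuous).isOpen_compl
  obtain ⟨w, hw, hwf⟩ := (hz V hV hzV).exists_mem
  exact hVf hw.1 hwf

theorem Stable.nonempty_stableSet_inter
    (hf : ∀ V ∈ countableBasis K, ∀ m : ℕ, Stable L x V f → StablePacking s L x V m f)
    {V : Set K} (hV : V ∈ countableBasis K) (hS : Stable L x V f) :
    (stableSet L x f ∩ V).Nonempty := by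
  have step : ∀ (W : {W : Set K // W ∈ countableBasis K ∧ Stable L x W f}) (k : ℕ),
      ∃ W' : {W : Set K // W ∈ countableBasis K ∧ Stable L x W f}, closure W'.1 ⊆ W.1 ∧
        ∃ p, closure W'.1 ⊆ closedBall p ((k : ℝ) + 1)⁻¹ := by
    rintro ⟨W, hW, hWS⟩ k
    obtain ⟨T, B, hT, -, hTs, hTS⟩ := hf W hW k hWS
    obtain ⟨p, hp⟩ : T.Nonempty := by
      rw [Finset.nonempty_iff_ne_empty]
      rintro rfl
      simp at hTs
    obtain ⟨h0, h1, h2, h3⟩ := hT p hp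
    refine ⟨⟨B p, h2, hTS p hp⟩, h3.trans inter_subset_left, p.1,
      h3.trans (inter_subset_right.trans (closedBall_subset_closedBall ?_))⟩
    have : (p.2 : ℝ) ≤ ((k : ℝ) + 1)⁻¹ := by exact_mod_cast h1
    exact (half_le_self p.2.2).trans this
  choose next hnext c hc using step
  let W : ℕ → {W : Set K // W ∈ countableBasis K ∧ Stable L x W f} :=
    fun k => Nat.rec ⟨V, hV, hS⟩ (fun k W => next W k) k
  have hW : ∀ k, closure (W (k + 1)).1 ⊆ (W k).1 := fun k => hnext (W k) k
  obtain ⟨z, hz⟩ := IsCompact.nonempty_iInter_of_sequence_nonempty_isCompact_isClosed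
    (fun k => closure (W k).1) (fun k => (hW k).trans subset_closure)
    (fun k => (W k).2.2.exists_mem.imp fun w hw => subset_closure hw.1.1)
    isClosed_closure.isCompact fun k => isClosed_closure
  have hzW : ∀ k, z ∈ closure (W k).1 := mem_iInter.1 hz
  refine ⟨z, fun V' hV' hzV' => ?_, hW 0 (hzW 1)⟩
  obtain ⟨ε, hε, hεV⟩ := Metric.isOpen_iff.1 (isOpen_of_mem_countableBasis hV') z hzV'
  obtain ⟨k, hk⟩ := exists_nat_one_div_lt (half_pos hε)
  rw [one_div] at hk
  refine (W (k + 1)).2.2.mono fun w hw => hεV ?_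
  have h1 := hc (W k) k (subset_closure hw)
  have h2 := hc (W k) k (hzW (k + 1))
  rw [mem_closedBall] at h1 h2
  rw [mem_ball]
  linarith [dist_triangle_right w z (c (W k) k)]

theorem StablePacking.le_packPre {V A : Set K} {m : ℕ} {δ : ℝ≥0}
    (h : StablePacking s L x V m f)
    (hne : ∀ W ∈ countableBasis K, Stable L x W f → (stableSet L x f ∩ W).Nonempty)
    (hA : V ∩ stableSet L x f ⊆ closure A) (hδ : ((m : ℝ≥0) + 1)⁻¹ ≤ δ) :
    (m : ℝ≥0∞) ≤ packPre (fun r => r ^ s) A δ := by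
  obtain ⟨T, B, hT, hTd, hTs, hTS⟩ := h
  have he : ∀ p : K × ℝ≥0, ∃ e, p ∈ T → e ∈ A ∧
      closedBall e (p.2 / 4 : ℝ≥0) ⊆ closedBall p.1 p.2 := by
    intro p
    by_cases hp : p ∈ T
    · obtain ⟨h0, -, h2, h3⟩ := hT p hp
      obtain ⟨w, hwE, hwB⟩ := hne (B p) h2 (hTS p hp)
      have hw := h3 (subset_closure hwB)
      have h0' : (0 : ℝ) < p.2 / 4 := div_pos (NNReal.coe_pos.2 h0) four_pos
      obtain ⟨e, heA, hwe⟩ := Metric.mem_closure_iff.1 (hA ⟨hw.1, hwE⟩) _ h0'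
      refine ⟨e, fun _ => ⟨heA, closedBall_subset_closedBall' ?_⟩⟩
      have h4 : dist w p.1 ≤ p.2 / 2 := hw.2
      push_cast
      linarith [dist_triangle_left e p.1 w]
    · exact ⟨p.1, fun h => (hp h).elim⟩
  choose e he using he
  refine le_trans ?_ (sum_le_packPre (h := fun r => r ^ s) T e (fun p => p.2 / 4)
    (fun p hp => (he p hp).1) (fun p hp => ?_) fun p hp q hq hpq =>
      (hTd hp hq hpq).mono (he p hp).2 (he q hq).2)
  · exact_mod_cast hTs.le
  · refine le_trans ?_ ((hT p hp).2.1.trans hδ)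
    exact div_le_self zero_le (by norm_num)

theorem packMeasure_fiber_eq_top (hxL : x ∈ L)
    (hf : ∀ V ∈ countableBasis K, ∀ m : ℕ, Stable L x V f → StablePacking s L x V m f) :
    packMeasure (fun r => r ^ s) (⇑f ⁻¹' {f x}) = ∞ := by
  refine top_le_iff.1 (le_trans (top_le_iff.2 ?_) (packMeasure_mono (stableSet_subset (L := L))))
  simp only [packMeasure, iInf_eq_top]
  intro c hc
  have : CompactSpace ↥(stableSet L x f) :=
    isCompact_iff_compactSpace.1 isClosed_stableSet.isCompact
  have : Nonempty ↥(stableSet L x f) := ⟨⟨x, fun V _ hxV => Stable.of_mem hxL hxV⟩⟩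
  obtain ⟨i, ⟨z, hzE⟩, hz⟩ := nonempty_interior_of_iUnion_of_closed
    (f := fun i => (Subtype.val ⁻¹' closure (c i) : Set ↥(stableSet L x f)))
    (fun i => isClosed_closure.preimage continuous_subtype_val) (by
      refine eq_univ_of_forall fun z => ?_
      obtain ⟨i, hi⟩ := mem_iUnion.1 (hc.subset z.2)
      exact mem_iUnion.2 ⟨i, subset_closure hi⟩)
  obtain ⟨U', hU'sub, hU', hzU'⟩ := mem_interior.1 hz
  obtain ⟨U, hU, rfl⟩ := isOpen_induced_iff.1 hU'
  obtain ⟨V, hV, hzV, hVU⟩ := (isBasis_countableBasis K).exists_subset_of_mem_open hzU' hU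
  refine ENNReal.tsum_eq_top_of_eq_top ⟨i, ?_⟩
  simp only [packPre0, iInf_eq_top]
  intro δ hδ
  obtain ⟨k, hk⟩ := exists_nat_one_div_lt hδ
  rw [one_div] at hk
  refine ENNReal.eq_top_of_forall_nnreal_le fun r => ?_
  obtain ⟨j, hj⟩ := exists_nat_ge r
  have hm := (hf V hV (max k j) (hzE V hV hzV)).le_packPre
    (fun W hW hWS => hWS.nonempty_stableSet_inter hf hW)
    (fun w hw => hU'sub (show (⟨w, hw.2⟩ : ↥(stableSet L x f)) ∈ _ from hVU hw.1)) (δ := δ) (by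
      refine le_trans ?_ hk.le
      gcongr
      exact le_max_left k j)
  refine le_trans ?_ hm
  exact_mod_cast hj.trans (Nat.cast_le.2 (le_max_right k j))

end StableSet

theorem GoodDim.not_small_inter_largeSet {dim : Set K → EReal} (hd : GoodDim dim) {c : EReal}
    {V : Set K} (hV : IsOpen V) (hne : (V ∩ largeSet dim n c).Nonempty) :
    ¬ Small dim n c (V ∩ largeSet dim n c) := by
  intro hS
  obtain ⟨z, hzV, hzL⟩ := hne
  refine hzL V hV hzV ?_
  have := (countable_countableBasis K).to_subtype
  refine hd.small_of_cover (ι := Option {B : ↥(countableBasis K) // Small dim n c B.1})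
    (fun o => o.elim (V ∩ largeSet dim n c) fun B => B.1.1) ?_ ?_ ?_
  · rintro (_ | B)
    · exact hV.isFσ.inter isClosed_largeSet.isFσ
    · exact (isOpen_of_mem_countableBasis B.1.2).isFσ
  · intro w hw
    by_cases hwL : w ∈ largeSet dim n c
    · exact mem_iUnion.2 ⟨none, hw, hwL⟩
    · simp only [largeSet, mem_ofPred_eq, not_forall, not_not] at hwL
      obtain ⟨N, hN, hwN, hNS⟩ := hwL
      obtain ⟨B, hB, hwB, hBN⟩ :=
        (isBasis_countableBasis K).exists_subset_of_mem_open hwN hN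
      exact mem_iUnion.2 ⟨some ⟨⟨B, hB⟩, hd.small_mono hNS hBN le_rfl⟩, hwB⟩
  · rintro (_ | B)
    · exact hS
    · exact B.2

theorem exists_isClosed_not_indBelow {s : ℝ≥0} {A : Set K} (hA : IsFσ A)
    (h : ¬ Small pdim n (s : ℝ) A) : ∃ D, IsClosed D ∧ D ⊆ A ∧ ¬ indBelow n ↥D := by
  by_contra hno
  push Not at hno
  obtain ⟨C, hC, hAC⟩ := isFσ_iff.1 hA
  refine h ⟨A, hA, ?_, ?_⟩
  · rw [hAC]
    exact indBelow_iUnion_isFσ (fun i => (hC i).isFσ) fun i =>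
      hno (C i) (hC i) (hAC ▸ subset_iUnion C i)
  · rw [sdiff_eq_empty.2 le_rfl, goodDim_pdim.empty]
    exact neg_one_le_zero.trans (EReal.coe_nonneg.2 s.2)

theorem residual_le_pdim_fiber {s : ℝ≥0} {x : K}
    (hx : ∀ N : Set K, IsOpen N → x ∈ N → ¬ Small pdim n (s : ℝ) N) :
    ∀ᶠ (f : C(K, Fin n → ℝ)) in residual C(K, Fin n → ℝ),
      ((s : ℝ) : EReal) ≤ pdim (⇑f ⁻¹' {f x}) := by
  have hV : ∀ V : Set K, IsOpen V → (V ∩ largeSet pdim n (s : ℝ)).Nonempty →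
      ¬ Small pdim n (s : ℝ) (V ∩ largeSet pdim n (s : ℝ)) := fun V hVo =>
    goodDim_pdim.not_small_inter_largeSet hVo
  filter_upwards [residual_stable_imp_stablePacking (s := s) (L := largeSet pdim n (s : ℝ)) hx
    (fun V hVo hne => manyPackings_of_not_small (hV V hVo hne))
    fun V hVo hne => exists_isClosed_not_indBelow (hVo.isFσ.inter isClosed_largeSet.isFσ)
      (hV V hVo hne)] with f hf
  have hne : (⇑f ⁻¹' {f x}) ≠ ∅ := nonempty_iff_ne_empty.1 ⟨x, rfl⟩
  rw [pdim, if_neg hne]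
  exact le_max_of_le_right (le_iSup₂ (f := fun (s : ℝ≥0)
    (_ : packMeasure (fun r => r ^ (s : ℝ)) (⇑f ⁻¹' {f x}) = ∞) => ((s : ℝ) : EReal)) s
    (packMeasure_fiber_eq_top (L := largeSet pdim n (s : ℝ)) hx hf))

/-- If almost optimal lower bounds hold for generic fibers through points with large
neighborhoods, then the maximal fiber dimension is `dStar dim n univ`. -/
theorem residual_max_fiber {dim : Set K → EReal} (hd : GoodDim dim)
    (hK : ¬ indBelow n ↥(univ : Set K))
    (h : ∀ (s : ℝ≥0) (x : K), (∀ N : Set K, IsOpen N → x ∈ N → ¬ Small dim n (s : ℝ) N) →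
      ∀ᶠ (f : C(K, Fin n → ℝ)) in residual C(K, Fin n → ℝ),
        ((s : ℝ) : EReal) ≤ dim (⇑f ⁻¹' {f x})) :
    ∀ᶠ (f : C(K, Fin n → ℝ)) in residual C(K, Fin n → ℝ),
      (∃ y, dim (⇑f ⁻¹' {y}) = dStar dim n univ) ∧
        ∀ y, dim (⇑f ⁻¹' {y}) ≤ dStar dim n univ := by
  obtain ⟨x, hx⟩ := exists_point_not_small hd hK
  have hq : ∀ q : ℚ, ((q : ℝ) : EReal) < dStar dim n univ →
      ∀ᶠ (f : C(K, Fin n → ℝ)) in residual C(K, Fin n → ℝ),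
        ((q : ℝ) : EReal) ≤ dim (⇑f ⁻¹' {f x}) := by
    intro q hq
    rcases le_total (q : ℝ) 0 with hq0 | hq0
    · exact Eventually.of_forall fun f =>
        le_trans (by exact_mod_cast hq0) (hd.nonneg ⟨x, rfl⟩)
    · obtain ⟨s, hs⟩ : ∃ s : ℝ≥0, (s : ℝ) = q := ⟨⟨q, hq0⟩, rfl⟩
      rw [← hs] at hq ⊢
      exact h s x fun N hN hxN => hx N hN hxN _ hq
  have hall := eventually_countable_forall.2 fun q : ℚ =>
    eventually_imp_distrib_left.2 (hq q)
  filter_upwards [hall, residual_fiber_le hd hK] with f hf hle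
  refine ⟨⟨f x, (hle _).antisymm (le_of_forall_lt_imp_le_of_dense fun c hc => ?_)⟩, hle⟩
  obtain ⟨q, hq1, hq2⟩ := EReal.lt_iff_exists_rat_btwn.1 hc
  exact hq1.le.trans (hf q hq2)

end

end FiberDim

/-- For a generic `f ∈ C(K,ℝⁿ)` the supremum of fiber dimensions is attained:
`max {dim_* f⁻¹(y) : y ∈ ℝⁿ} = d^n_*(K)`. -/
theorem stmt13 (n : ℕ) (hn : 0 < n) (K : Type*) [MetricSpace K] [CompactSpace K]
    (dimStar : Set K → EReal)
    (hdimStar : dimStar = tdim ∨ dimStar = hdim ∨ dimStar = pdim)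
    (hK : (n : EReal) ≤ tdim (Set.univ : Set K)) :
    ∀ᶠ (f : C(K, Fin n → ℝ)) in residual C(K, Fin n → ℝ),
      (∃ y : Fin n → ℝ, dimStar (⇑f ⁻¹' {y}) = dStar dimStar n Set.univ) ∧
      ∀ y : Fin n → ℝ, dimStar (⇑f ⁻¹' {y}) ≤ dStar dimStar n Set.univ := by
  have hK' : ¬ indBelow n ↥(Set.univ : Set K) := fun h => by
    have h1 : ((n : ℝ) : EReal) ≤ ((n - 1 : ℝ) : EReal) := by
      rw [EReal.coe_sub]
      exact hK.trans (FiberDim.tdim_le_iff.2 h)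
    linarith [EReal.coe_le_coe_iff.1 h1]
  rcases hdimStar with rfl | rfl | rfl
  · exact FiberDim.residual_max_fiber FiberDim.goodDim_tdim hK' fun s x hx =>
      (FiberDim.residual_lt_fiber FiberDim.goodDim_tdim FiberDim.hasHull_tdim hx).mono
        fun f hf => hf.le
  · exact FiberDim.residual_max_fiber FiberDim.goodDim_hdim hK' fun s x hx =>
      (FiberDim.residual_lt_fiber FiberDim.goodDim_hdim FiberDim.hasHull_hdim hx).mono
        fun f hf => hf.le
  · exact FiberDim.residual_max_fiber FiberDim.goodDim_pdim hK' fun s x hx =>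
      FiberDim.residual_le_pdim_fiber hx
end

section
/- Let n be a positive integer and let K be a compact metric space satisfying n ≤ dim_T K < ∞. Then for a generic f ∈ C(K,ℝⁿ) there exists a non-empty open set U_f ⊆ ℝⁿ such that dim_T f⁻¹(y) = d^n_T(K) for all y ∈ U_f. -/
open Set Metric Filter Topology TopologicalSpace
open scoped ENNReal NNReal

section IndBelow

variable {X Y : Type u} [TopologicalSpace X] [TopologicalSpace Y]

theorem indBelow.of_isInducing {k : ℕ} (hX : indBelow k X) {e : Y → X} (he : IsInducing e) :
    indBelow k Y := by
  induction k generalizing X Y with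
  | zero => exact ⟨fun y => hX.false (e y)⟩
  | succ k ih =>
    intro y U hU hy
    obtain ⟨U', hU', rfl⟩ := he.isOpen_iff.1 hU
    obtain ⟨V, hV, hyV, hVU, hk⟩ := hX (e y) U' hU' hy
    refine ⟨e ⁻¹' V, hV.preimage he.continuous, hyV, preimage_mono hVU, ?_⟩
    have hsub : MapsTo e (frontier (e ⁻¹' V)) (frontier V) := fun z hz =>
      he.continuous.frontier_preimage_subset V hz
    refine ih hk (e := hsub.restrict) ?_
    exact (he.comp IsInducing.subtypeVal).codRestrict fun z => hsub z.2

theorem indBelow.succ {k : ℕ} (hX : indBelow k X) : indBelow (k + 1) X := by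
  induction k generalizing X with
  | zero => exact fun x => (hX.false x).elim
  | succ k ih =>
    intro x U hU hx
    obtain ⟨V, hV, hxV, hVU, hk⟩ := hX x U hU hx
    exact ⟨V, hV, hxV, hVU, ih hk⟩

theorem indBelow.mono {k l : ℕ} (hkl : k ≤ l) (hX : indBelow k X) : indBelow l X := by
  induction hkl with
  | refl => exact hX
  | step _ ih => exact ih.succ

theorem indBelow.subset {k : ℕ} {A B : Set X} (hB : indBelow k B) (h : A ⊆ B) : indBelow k A :=
  hB.of_isInducing (IsEmbedding.inclusion h).isInducing

theorem indBelow_one_of_subsingleton [Subsingleton X] : indBelow 1 X := by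
  intro x U _ hx
  refine ⟨univ, isOpen_univ, mem_univ x, fun y _ => Subsingleton.elim x y ▸ hx, ?_⟩
  rw [frontier_univ]
  exact ⟨fun z => z.2⟩

theorem natCast_succ_sub_one (k : ℕ) : ((k + 1 : ℕ) : EReal) - 1 = k := by
  rw [← EReal.coe_coe_eq_natCast, ← EReal.coe_coe_eq_natCast, ← EReal.coe_one, ← EReal.coe_sub]
  simp

theorem indDim_le {k : ℕ} (hX : indBelow (k + 1) X) : indDim X ≤ k := by
  exact sInf_le ⟨k + 1, hX, (natCast_succ_sub_one k).symm⟩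

theorem le_indDim {k : ℕ} (hX : ¬ indBelow k X) : (k : EReal) ≤ indDim X := by
  refine le_sInf ?_
  rintro _ ⟨l, hl, rfl⟩
  have hkl : k < l := lt_of_not_ge fun h => hX (hl.mono h)
  obtain ⟨l, rfl⟩ := Nat.exists_eq_add_of_lt hkl
  rw [natCast_succ_sub_one]
  exact_mod_cast Nat.le_add_right k l

end IndBelow

theorem isOpen_setOf_forall_mem_compact {F P : Type*} [TopologicalSpace F] [TopologicalSpace P]
    {S : Set P} (hS : IsCompact S) {W : Set (F × P)} (hW : IsOpen W) :
    IsOpen {f | ∀ p ∈ S, (f, p) ∈ W} :=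
  isOpen_iff_mem_nhds.2 fun _ hf =>
    hS.eventually_forall_of_forall_eventually (P := fun f p => (f, p) ∈ W)
      fun p hp => hW.mem_nhds (hf p hp)

section Separating

variable {K : Type u} [MetricSpace K]

/-- A sequence of functions such that the sets where all but finitely many of them are positive
form a base of the topology, in a strong sense. -/
def IsSeparatingSeq (h : ℕ → C(K, ℝ)) : Prop :=
  ∀ (x : K) (U : Set K), IsOpen U → x ∈ U →
    ∀ N : ℕ, ∃ j, N ≤ j ∧ 0 < h j x ∧ ∀ y ∉ U, h j y < 0

theorem IsSeparatingSeq.indBelow {h : ℕ → C(K, ℝ)} (hh : IsSeparatingSeq h) (J₀ : Finset ℕ)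
    (k : ℕ) (X : Set K)
    (hX : ∀ J : Finset ℕ, Disjoint J J₀ → J.card = k → ∀ x ∈ X, ∃ j ∈ J, h j x ≠ 0) :
    indBelow k X := by
  induction k generalizing J₀ X with
  | zero => exact ⟨fun x => by simpa using hX ∅ (by simp) rfl x x.2⟩
  | succ k ih =>
    rintro x U hU hx
    obtain ⟨U, hU', rfl⟩ := isOpen_induced_iff.1 hU
    obtain ⟨N, hN⟩ := J₀.exists_nat_subset_range
    obtain ⟨j, hNj, hjx, hjU⟩ := hh x U hU' hx N
    have hj₀ : j ∉ J₀ := fun hj => by have := Finset.mem_range.1 (hN hj); omega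
    refine ⟨{y | 0 < h j y}, isOpen_lt continuous_const (by fun_prop), hjx, fun y hy => ?_, ?_⟩
    · by_contra hyU
      exact lt_asymm hy (hjU y hyU)
    · have hfr : ∀ y ∈ frontier {y : X | 0 < h j y}, h j y = 0 := fun y hy =>
        (frontier_lt_subset_eq continuous_const (by fun_prop) hy).symm
      refine (ih (insert j J₀) (Subtype.val '' frontier {y : X | 0 < h j y}) ?_).of_isInducing
        (e := fun y => ⟨y.1.1, mem_image_of_mem _ y.2⟩)
        ((IsInducing.subtypeVal.comp IsInducing.subtypeVal).codRestrict _)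
      rintro J hJ hJk _ ⟨y, hy, rfl⟩
      rw [Finset.disjoint_insert_right] at hJ
      obtain ⟨i, hi, hiy⟩ := hX (insert j J)
        (by rw [Finset.disjoint_insert_left]; exact ⟨hj₀, hJ.2⟩)
        (by rw [Finset.card_insert_of_notMem hJ.1, hJk]) y y.2
      rcases Finset.mem_insert.1 hi with rfl | hi
      · exact (hiy (hfr y hy)).elim
      · exact ⟨i, hi, hiy⟩

end Separating

section Avoidable

variable {K : Type u} [MetricSpace K] [CompactSpace K]

/-- Every `ι`-tuple of continuous functions can be approximated by tuples without a common
zero on `X`. For closed `X` this characterizes dimension less than the cardinality of `ι`. -/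
def Avoidable (ι : Type*) (X : Set K) : Prop :=
  ∀ (f : ι → C(K, ℝ)) (ε : ℝ), 0 < ε →
    ∃ g : ι → C(K, ℝ), (∀ i, dist (g i) (f i) < ε) ∧ ∀ x ∈ X, ∃ i, g i x ≠ 0

theorem Avoidable.reindex {ι κ : Type*} {X : Set K} (h : Avoidable ι X) (e : κ ≃ ι) :
    Avoidable κ X := by
  intro f ε hε
  obtain ⟨g, hg, hgX⟩ := h (f ∘ e.symm) ε hε
  refine ⟨g ∘ e, fun k => by simpa using hg (e k), fun x hx => ?_⟩
  obtain ⟨i, hi⟩ := hgX x hx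
  exact ⟨e.symm i, by simpa using hi⟩

theorem isOpen_avoiding {ι : Type*} (J : Set ι) {X : Set K} (hX : IsClosed X) (c : ι → ℝ) :
    IsOpen {f : ι → C(K, ℝ) | ∀ x ∈ X, ∃ i ∈ J, f i x ≠ c i} := by
  refine isOpen_setOf_forall_mem_compact (W := {p : (ι → C(K, ℝ)) × K | ∃ i ∈ J, p.1 i p.2 ≠ c i})
    hX.isCompact ?_
  have : {p : (ι → C(K, ℝ)) × K | ∃ i ∈ J, p.1 i p.2 ≠ c i} =
      ⋃ i ∈ J, {p : (ι → C(K, ℝ)) × K | p.1 i p.2 ≠ c i} := by ext; simp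
  rw [this]
  exact isOpen_biUnion fun i _ => isOpen_ne_fun (by fun_prop) continuous_const

theorem exists_near_forall_ne {ι Q : Type*} [Finite ι] [Countable Q] {X : Q → Set K}
    (hX : ∀ q, IsClosed (X q)) (h : ∀ q, Avoidable ι (X q)) (c : Q → ι → ℝ)
    (f : ι → C(K, ℝ)) {ε : ℝ} (hε : 0 < ε) :
    ∃ g : ι → C(K, ℝ), (∀ i, dist (g i) (f i) < ε) ∧ ∀ q, ∀ x ∈ X q, ∃ i, g i x ≠ c q i := by
  have := Fintype.ofFinite ι
  have hd : Dense (⋂ q, {f : ι → C(K, ℝ) | ∀ x ∈ X q, ∃ i ∈ univ, f i x ≠ c q i}) := by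
    refine dense_iInter_of_isOpen (fun q => isOpen_avoiding univ (hX q) (c q)) fun q => ?_
    refine Metric.dense_iff.2 fun f r hr => ?_
    obtain ⟨g, hg, hgX⟩ := h q (fun i => f i - .const K (c q i)) r hr
    refine ⟨fun i => g i + .const K (c q i), ?_, fun x hx => ?_⟩
    · rw [mem_ball, dist_pi_lt_iff hr]
      intro i
      rw [← dist_sub_right _ _ (.const K (c q i)), add_sub_cancel_right]
      exact hg i
    · obtain ⟨i, hi⟩ := hgX x hx
      exact ⟨i, mem_univ i, by simpa using hi⟩
  obtain ⟨g, hg, hgX⟩ := Metric.dense_iff.1 hd f ε hε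
  exact ⟨g, (dist_pi_lt_iff hε).1 hg, fun q x hx => by simpa using mem_iInter.1 hgX q x hx⟩

theorem avoidable_iUnion {ι Q : Type*} [Finite ι] [Countable Q] {X : Q → Set K}
    (hX : ∀ q, IsClosed (X q)) (h : ∀ q, Avoidable ι (X q)) : Avoidable ι (⋃ q, X q) := by
  intro f ε hε
  obtain ⟨g, hg, hgX⟩ := exists_near_forall_ne hX h (fun _ _ => 0) f hε
  exact ⟨g, hg, fun x hx => (mem_iUnion.1 hx).elim fun q hq => hgX q x hq⟩

theorem exists_isSeparatingSeq {Q : Type*} [Countable Q] {k : ℕ} {X : Q → Set K}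
    (hX : ∀ q, IsClosed (X q)) (h : ∀ q, Avoidable (Fin k) (X q)) :
    ∃ h : ℕ → C(K, ℝ), IsSeparatingSeq h ∧
      ∀ J : Finset ℕ, J.card = k → ∀ q, ∀ x ∈ X q, ∃ j ∈ J, h j x ≠ 0 := by
  let A (p : ℕ × ℕ) : Set (ℕ → C(K, ℝ)) :=
    {h | ∃ j, p.2 ≤ j ∧ dist (h j) (denseSeq C(K, ℝ) p.1) < 1}
  let B (p : {J : Finset ℕ // J.card = k} × Q) : Set (ℕ → C(K, ℝ)) :=
    {h | ∀ x ∈ X p.2, ∃ j ∈ (p.1.1 : Set ℕ), h j x ≠ 0}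
  have hAo (p) : IsOpen (A p) := by
    simp only [A, ofPred_exists, ofPred_and]
    exact isOpen_iUnion fun j => isOpen_const.inter (isOpen_lt (by fun_prop) continuous_const)
  have hBo (p) : IsOpen (B p) := isOpen_avoiding _ (hX p.2) fun _ => 0
  have hA (p) : Dense (A p) := by
    intro h
    refine mem_closure_of_tendsto (b := atTop)
      (f := fun m => Function.update h (p.2 + m) (denseSeq C(K, ℝ) p.1)) ?_
      (Eventually.of_forall fun m => ⟨p.2 + m, Nat.le_add_right _ _, by simp⟩)
    refine tendsto_pi_nhds.2 fun j => tendsto_const_nhds.congr' ?_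
    filter_upwards [eventually_gt_atTop j] with m hm
    rw [Function.update_of_ne (by omega)]
  have hB (p) : Dense (B p) := by
    obtain ⟨⟨J, hJ⟩, q⟩ := p
    intro f
    have hav : Avoidable J (X q) := (h q).reindex (J.equivFinOfCardEq hJ)
    choose g hg hgX using fun m : ℕ => hav (fun j => f j) (1 / ((m : ℝ) + 1)) (by positivity)
    classical
    refine mem_closure_of_tendsto (b := atTop)
      (f := fun m j => if hj : j ∈ J then g m ⟨j, hj⟩ else f j) ?_
      (Eventually.of_forall fun m x hx => ?_)
    · refine tendsto_pi_nhds.2 fun j => ?_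
      by_cases hj : j ∈ J
      · simp only [hj, dif_pos]
        exact tendsto_iff_dist_tendsto_zero.2 (squeeze_zero (fun _ => dist_nonneg)
          (fun m => (hg m ⟨j, hj⟩).le) tendsto_one_div_add_atTop_nhds_zero_nat)
      · simp [hj]
    · obtain ⟨⟨j, hj⟩, hjx⟩ := hgX m x hx
      exact ⟨j, hj, by simpa [hj] using hjx⟩
  obtain ⟨f, hfA, hfB⟩ := ((dense_iInter_of_isOpen hAo hA).inter_of_Gδ
    (.iInter_of_isOpen hAo) (.iInter_of_isOpen hBo) (dense_iInter_of_isOpen hBo hB)).nonempty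
  refine ⟨f, fun x U hU hx N => ?_, fun J hJ q => mem_iInter.1 hfB ⟨⟨J, hJ⟩, q⟩⟩
  obtain ⟨u, hu0, hu1, -⟩ := exists_continuous_zero_one_of_isClosed hU.isClosed_compl
    (isClosed_singleton (x := x)) (by simpa using hx)
  let w : C(K, ℝ) := ⟨fun y => 4 * u y - 2, by fun_prop⟩
  obtain ⟨p, hp⟩ := (denseRange_denseSeq C(K, ℝ)).exists_dist_lt w one_pos
  obtain ⟨j, hNj, hj⟩ := mem_iInter.1 hfA (p, N)
  have key (y) : |f j y - (4 * u y - 2)| < 2 := by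
    have hd : dist (f j) w < 2 := by
      linarith [dist_triangle_right (f j) w (denseSeq C(K, ℝ) p)]
    exact (ContinuousMap.dist_apply_le_dist y).trans_lt hd
  refine ⟨j, hNj, ?_, fun y hy => ?_⟩
  · have h1 := (abs_lt.1 (key x)).1
    rw [hu1 (mem_singleton x), Pi.one_apply] at h1
    linarith
  · have h1 := (abs_lt.1 (key y)).2
    rw [hu0 hy, Pi.zero_apply] at h1
    linarith

theorem Avoidable.mono {ι : Type*} {X Y : Set K} (h : Avoidable ι Y) (hXY : X ⊆ Y) :
    Avoidable ι X := fun f ε hε =>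
  (h f ε hε).imp fun _ hg => ⟨hg.1, fun x hx => hg.2 x (hXY hx)⟩

theorem indBelow_iUnion {Q : Type*} [Countable Q] {k : ℕ} {X : Q → Set K}
    (hX : ∀ q, IsClosed (X q)) (h : ∀ q, Avoidable (Fin k) (X q)) :
    indBelow k (⋃ q, X q : Set K) := by
  obtain ⟨g, hg, hgX⟩ := exists_isSeparatingSeq hX h
  refine hg.indBelow ∅ k _ fun J _ hJ x hx => ?_
  obtain ⟨q, hq⟩ := mem_iUnion.1 hx
  exact hgX J hJ q x hq

theorem Avoidable.indBelow {k : ℕ} {X : Set K} (h : Avoidable (Fin k) X) (hX : IsClosed X) :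
    indBelow k X :=
  (indBelow_iUnion (Q := Unit) (fun _ => hX) fun _ => h).subset (subset_iUnion (fun _ => X) ())

theorem frontier_biUnion_finset_subset {α ι : Type*} [TopologicalSpace α] (t : Finset ι)
    (V : ι → Set α) : frontier (⋃ i ∈ t, V i) ⊆ ⋃ i ∈ t, frontier (V i) := by
  intro x hx
  rw [frontier, Finset.closure_biUnion] at hx
  obtain ⟨i, hi, hxi⟩ := mem_iUnion₂.1 hx.1
  exact mem_iUnion₂.2 ⟨i, hi, hxi, fun h => hx.2 (interior_mono (subset_biUnion_of_mem hi) h)⟩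

theorem Avoidable.cons {k : ℕ} {X : Set K} (hX : IsClosed X)
    (h : ∀ (f : C(K, ℝ)) (δ : ℝ), 0 < δ → ∃ W : Set X, IsOpen W ∧ (∀ x ∈ W, 0 < f x) ∧
      (∀ x ∉ W, f x < δ) ∧ Avoidable (Fin k) (Subtype.val '' frontier W)) :
    Avoidable (Fin (k + 1)) X := by
  intro f ε hε
  obtain ⟨W, hW, hWpos, hWlt, hWfr⟩ := h (f 0) (ε / 2) (half_pos hε)
  obtain ⟨g, hg, hgW⟩ := hWfr (fun i => f i.succ) ε hε
  let O : Set K := {y | ∃ i, g i y ≠ 0}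
  have hO : IsOpen O := by
    simp only [O, ofPred_exists]
    exact isOpen_iUnion fun i => isOpen_ne_fun (by fun_prop) continuous_const
  have hcl {A : Set X} (hA : IsClosed A) : IsClosed (Subtype.val '' A \ O) :=
    (hX.isClosedEmbedding_subtypeVal.isClosedMap A hA).sdiff hO
  have hdisj : Disjoint (Subtype.val '' Wᶜ \ O) (Subtype.val '' closure W \ O) := by
    refine disjoint_left.2 ?_
    rintro _ ⟨⟨x, hx, rfl⟩, hxO⟩ ⟨⟨y, hy, hxy⟩, -⟩
    obtain rfl := Subtype.val_injective hxy
    exact hxO (hgW y ⟨y, ⟨hy, by rwa [hW.interior_eq]⟩, rfl⟩)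
  obtain ⟨u, hu0, hu1, hu⟩ := exists_continuous_zero_one_of_isClosed
    (hcl hW.isClosed_compl) (hcl isClosed_closure) hdisj
  let f₀ : C(K, ℝ) := ⟨fun x => f 0 x - ε / 2 + ε * u x, by fun_prop⟩
  refine ⟨Fin.cons f₀ g, Fin.forall_fin_succ.2 ⟨?_, hg⟩, fun x hx => ?_⟩
  · refine (ContinuousMap.dist_lt_iff hε).2 fun x => ?_
    obtain ⟨h0, h1⟩ := hu x
    rw [Real.dist_eq, abs_lt]
    simp only [Fin.cons_zero, f₀, ContinuousMap.coe_mk]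
    constructor <;> nlinarith
  · by_cases hxO : x ∈ O
    · obtain ⟨i, hi⟩ := hxO
      exact ⟨i.succ, hi⟩
    refine ⟨0, ?_⟩
    simp only [Fin.cons_zero, f₀, ContinuousMap.coe_mk]
    by_cases hxW : (⟨x, hx⟩ : X) ∈ closure W
    · have h0 : 0 ≤ f 0 x :=
        closure_minimal (t := {y : X | 0 ≤ f 0 y}) (fun y hy => (hWpos y hy).le)
          (isClosed_le continuous_const (by fun_prop)) hxW
      rw [hu1 ⟨⟨_, hxW, rfl⟩, hxO⟩, Pi.one_apply]
      exact ne_of_gt (by linarith)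
    · have hxW' := notMem_subset subset_closure hxW
      have h0 := hWlt _ hxW'
      rw [hu0 ⟨⟨_, hxW', rfl⟩, hxO⟩, Pi.zero_apply]
      exact ne_of_lt (by linarith)

theorem avoidable_of_indBelow {k : ℕ} {X : Set K} (hX : IsClosed X) (h : indBelow k X) :
    Avoidable (Fin k) X := by
  induction k generalizing X with
  | zero => exact fun f ε _ => ⟨f, fun i => i.elim0, fun x hx => (h.false ⟨x, hx⟩).elim⟩
  | succ k ih =>
    refine Avoidable.cons hX fun f δ hδ => ?_
    have hV (x : X) (hx : δ ≤ f x) := h x {y | 0 < f y}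
      (isOpen_lt continuous_const (by fun_prop)) (hδ.trans_le hx)
    choose! V hVo hxV hVf hVk using hV
    have := isCompact_iff_compactSpace.1 hX.isCompact
    have hcomp : IsCompact {x : X | δ ≤ f x} :=
      (isClosed_le continuous_const (by fun_prop)).isCompact
    obtain ⟨t, ht, htV⟩ := hcomp.elim_nhds_subcover V fun x hx => (hVo x hx).mem_nhds (hxV x hx)
    refine ⟨⋃ x ∈ t, V x, isOpen_biUnion fun x hx => hVo x (ht x hx), fun x hx => ?_,
      fun x hx => lt_of_not_ge fun hle => hx (htV hle), ?_⟩
    · obtain ⟨y, hy, hxy⟩ := mem_iUnion₂.1 hx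
      exact hVf y (ht y hy) hxy
    · have hav : Avoidable (Fin k) (⋃ x : t, (Subtype.val '' frontier (V x) : Set K)) := by
        have hcl (x : t) : IsClosed (Subtype.val '' frontier (V x) : Set K) :=
          hX.isClosedEmbedding_subtypeVal.isClosedMap _ isClosed_frontier
        refine avoidable_iUnion hcl fun x => ih (hcl x) ?_
        refine (hVk x (ht x x.2)).of_isInducing
          (e := fun y => ⟨⟨y.1, (Subtype.coe_image_subset X _) y.2⟩, ?_⟩) ?_
        · obtain ⟨z, hz, hzy⟩ := y.2
          simpa only [← hzy] using hz
        · exact (IsInducing.of_comp (by fun_prop) continuous_subtype_val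
            (IsInducing.of_comp (by fun_prop) continuous_subtype_val IsInducing.subtypeVal))
      refine hav.mono ?_
      rw [← image_iUnion]
      refine image_mono ((frontier_biUnion_finset_subset t V).trans fun y hy => ?_)
      obtain ⟨x, hx, hxy⟩ := mem_iUnion₂.1 hy
      exact mem_iUnion.2 ⟨⟨x, hx⟩, hxy⟩

theorem avoidable_iUnion_of_indBelow {Q : Type*} [Countable Q] {k : ℕ} {X : Q → Set K}
    (hX : ∀ q, IsClosed (X q)) (h : indBelow k (⋃ q, X q : Set K)) :
    Avoidable (Fin k) (⋃ q, X q) :=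
  avoidable_iUnion hX fun q => avoidable_of_indBelow (hX q) (h.subset (subset_iUnion X q))

/-- Addition theorem: an `F_σ` set and its complement. -/
theorem indBelow_univ_of_compl {Q : Type*} [Countable Q] {n d : ℕ} {C : Q → Set K}
    (hC : ∀ q, IsClosed (C q)) (hn : indBelow n (⋃ q, C q : Set K))
    (hd : indBelow d ((⋃ q, C q)ᶜ : Set K)) : indBelow (n + d) (univ : Set K) := by
  refine Avoidable.indBelow (.reindex (ι := Fin n ⊕ Fin d) ?_ finSumFinEquiv.symm) isClosed_univ
  intro f ε hε
  obtain ⟨g, hg, hgC⟩ := avoidable_iUnion_of_indBelow hC hn (fun i => f (.inl i)) ε hε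
  have hZ : IsClosed {x | ∀ i, g i x = 0} := by
    simp only [ofPred_forall]
    exact isClosed_iInter fun i => isClosed_eq (by fun_prop) continuous_const
  have hZd : indBelow d {x | ∀ i, g i x = 0} := hd.subset fun x hx hxC =>
    (hgC x hxC).elim fun i hi => hi (hx i)
  obtain ⟨h, hh, hhZ⟩ := avoidable_of_indBelow hZ hZd (fun i => f (.inr i)) ε hε
  refine ⟨Sum.elim g h, fun i => i.casesOn hg hh, fun x _ => ?_⟩
  by_cases hx : ∀ i, g i x = 0
  · obtain ⟨i, hi⟩ := hhZ x hx
    exact ⟨.inr i, hi⟩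
  · obtain ⟨i, hi⟩ := not_forall.1 hx
    exact ⟨.inl i, hi⟩

/-- Decomposition theorem, with one of the two pieces an `F_σ` set. -/
theorem exists_indBelow_iUnion_compl {n d : ℕ} (h : indBelow (n + d) (univ : Set K)) :
    ∃ C : ℕ → Set K, (∀ i, IsClosed (C i)) ∧ indBelow n (⋃ i, C i : Set K) ∧
      indBelow d ((⋃ i, C i)ᶜ : Set K) := by
  obtain ⟨g, hg, hgJ⟩ := exists_isSeparatingSeq (Q := Unit) (fun _ => isClosed_univ)
    fun _ => avoidable_of_indBelow isClosed_univ h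
  let E (J : Finset ℕ) : Set K := {x | ∀ j ∈ J, g j x = 0}
  have hE (J) : IsClosed (E J) := by
    simp only [E, ofPred_forall]
    exact isClosed_biInter fun i _ => isClosed_eq (by fun_prop) continuous_const
  have : Nonempty {J : Finset ℕ // J.card = d} := ⟨Finset.range d, Finset.card_range d⟩
  obtain ⟨s, hs⟩ := exists_surjective_nat {J : Finset ℕ // J.card = d}
  refine ⟨fun i => E (s i).1, fun i => hE _, indBelow_iUnion (fun i => hE _) fun i =>
    avoidable_of_indBelow (hE _) (hg.indBelow (s i).1 n _ fun J hJ hJn x hx => ?_),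
    hg.indBelow ∅ d _ fun J _ hJ x hx => ?_⟩
  · obtain ⟨j, hj, hjx⟩ := hgJ (J ∪ (s i).1)
      (by rw [Finset.card_union_of_disjoint hJ, hJn, (s i).2]) () x (mem_univ x)
    rcases Finset.mem_union.1 hj with hj | hj
    · exact ⟨j, hj, hjx⟩
    · exact (hjx (hx j hj)).elim
  · by_contra! hcon
    obtain ⟨i, hi⟩ := hs ⟨J, hJ⟩
    exact hx (mem_iUnion.2 ⟨i, by rw [hi]; exact hcon⟩)

/-- Removing finitely many points does not lower a nonnegative dimension bound. -/
theorem indBelow_of_diff_finite {d : ℕ} {C F : Set K} (hC : IsClosed C) (hF : F.Finite)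
    (h : indBelow (d + 1) (C \ F : Set K)) : indBelow (d + 1) C := by
  obtain ⟨D, hD, hDF, hDU, -⟩ := hF.isClosed.isOpen_compl.exists_iUnion_isClosed
  have := hF.countable.to_subtype
  have hcl : ∀ q : ℕ ⊕ F, IsClosed (Sum.elim (fun i => C ∩ D i) (fun x => {x.1}) q) := by
    rintro (i | x)
    · exact hC.inter (hD i)
    · exact isClosed_singleton
  refine (indBelow_iUnion (k := d + 1) hcl ?_).subset fun x hx => mem_iUnion.2 ?_
  · rintro (i | x)
    · exact avoidable_of_indBelow (hcl (.inl i))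
        (h.subset fun x hx => ⟨hx.1, hDF i hx.2⟩)
    · exact avoidable_of_indBelow (hcl (.inr x))
        ((indBelow_one_of_subsingleton (X := ({x.1} : Set K))).mono (Nat.le_add_left 1 d))
  · by_cases hxF : x ∈ F
    · exact ⟨.inr ⟨x, hxF⟩, rfl⟩
    · obtain ⟨i, hi⟩ := mem_iUnion.1 (hDU.symm ▸ hxF : x ∈ ⋃ i, D i)
      exact ⟨.inl i, hx, hi⟩

theorem continuous_abs_fract_sub_half : Continuous fun s : ℝ => |Int.fract s - 1 / 2| :=
  ContinuousOn.comp_fract'' (f := fun u : ℝ => |u - 1 / 2|) (by fun_prop) (by norm_num)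

theorem exists_continuous_int_of_le_abs_fract (η : ℝ) (hη : 0 < η) :
    ∃ φ : ℝ → ℝ, Continuous φ ∧ (∀ s, |φ s - s| ≤ 1) ∧
      ∀ s, η ≤ |Int.fract s - 1 / 2| → ∃ k : ℤ, φ s = k := by
  wlog h : η ≤ 1 / 2 generalizing η
  · obtain ⟨φ, h1, h2, h3⟩ := this (1 / 2) (by norm_num) le_rfl
    exact ⟨φ, h1, h2, fun s hs => h3 s ((le_of_not_ge h).trans hs)⟩
  let ψ : ℝ → ℝ := fun u => max 0 (min 1 (1 / 2 + (u - 1 / 2) / (2 * η)))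
  have hψ_low {u : ℝ} (hu : u ≤ 1 / 2 - η) : ψ u = 0 := by
    refine max_eq_left (min_le_iff.2 (.inr ?_))
    have : (u - 1 / 2) / (2 * η) ≤ -(1 / 2) := by
      rw [div_le_iff₀ (by positivity)]; linarith
    linarith
  have hψ_high {u : ℝ} (hu : 1 / 2 + η ≤ u) : ψ u = 1 := by
    have : 1 / 2 ≤ (u - 1 / 2) / (2 * η) := by
      rw [le_div_iff₀ (by positivity)]; linarith
    simp only [ψ]
    rw [min_eq_left (by linarith), max_eq_right zero_le_one]
  have hψ0 (u) : 0 ≤ ψ u := le_max_left _ _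
  have hψ1 (u) : ψ u ≤ 1 := max_le zero_le_one (min_le_left _ _)
  refine ⟨fun s => s + (ψ (Int.fract s) - Int.fract s), ?_, fun s => ?_, fun s hs => ?_⟩
  · refine continuous_id.add (ContinuousOn.comp_fract'' (f := fun u => ψ u - u) ?_ ?_)
    · exact Continuous.continuousOn (by fun_prop)
    · rw [hψ_low (by linarith), hψ_high (by linarith)]
      norm_num
  · rw [add_sub_cancel_left, abs_le]
    have := hψ0 (Int.fract s)
    have := hψ1 (Int.fract s)
    have := Int.fract_nonneg s
    have := Int.fract_lt_one s
    constructor <;> linarith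
  · have hs' := Int.floor_add_fract s
    change ∃ k : ℤ, s + (ψ (Int.fract s) - Int.fract s) = k
    rcases le_abs'.1 hs with h' | h'
    · exact ⟨⌊s⌋, by rw [hψ_low (by linarith)]; linarith⟩
    · exact ⟨⌊s⌋ + 1, by rw [hψ_high (by linarith)]; push_cast; linarith⟩

/-- A map into `ℝⁿ` from a set of dimension less than `n` can be pushed into the
codimension-one skeleton of any cubical lattice. -/
theorem Avoidable.exists_near_mem_lattice {n : ℕ} {X : Set K} (hX : IsClosed X)
    (h : Avoidable (Fin n) X) (f : Fin n → C(K, ℝ)) {δ : ℝ} (hδ : 0 < δ) (τ : ℝ) :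
    ∃ g : Fin n → C(K, ℝ), (∀ i, dist (g i) (f i) < 3 * δ) ∧
      ∀ x ∈ X, ∃ i, ∃ k : ℤ, g i x = δ * (k + τ) := by
  obtain ⟨f', hf', hfX⟩ := exists_near_forall_ne (Q := Fin n → ℤ) (fun _ => hX) (fun _ => h)
    (fun q i => δ * (q i + 1 / 2 + τ)) f hδ
  let s (i : Fin n) (x : K) : ℝ := f' i x / δ - τ
  have hs (i x) : δ * (s i x + τ) = f' i x := by simp only [s]; field_simp; ring
  have hsc (i) : Continuous (s i) := by fun_prop
  let v (x : K) : Fin n → ℝ := fun i => |Int.fract (s i x) - 1 / 2|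
  have hv : Continuous v := continuous_pi fun i => continuous_abs_fract_sub_half.comp (hsc i)
  have hv0 (x) (hx : x ∈ X) : 0 < ‖v x‖ := by
    refine norm_pos_iff.2 fun h0 => ?_
    obtain ⟨i, hi⟩ := hfX (fun i => ⌊s i x⌋) x hx
    have h1 : Int.fract (s i x) = 1 / 2 := sub_eq_zero.1 (abs_eq_zero.1 (congr_fun h0 i))
    exact hi (by rw [← hs i x, ← h1, Int.floor_add_fract])
  obtain ⟨η, hη, hηX⟩ := hX.isCompact.exists_forall_le' (f := fun x => ‖v x‖)
    hv.norm.continuousOn hv0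
  obtain ⟨φ, hφ, hφ1, hφk⟩ := exists_continuous_int_of_le_abs_fract η hη
  refine ⟨fun i => ⟨fun x => δ * (φ (s i x) + τ), by fun_prop⟩, fun i => ?_, fun x hx => ?_⟩
  · refine (ContinuousMap.dist_lt_iff (by positivity)).2 fun x => ?_
    have h1 : dist (δ * (φ (s i x) + τ)) (f' i x) ≤ δ := by
      rw [← hs i x, Real.dist_eq, ← mul_sub, add_sub_add_right_eq_sub, abs_mul, abs_of_pos hδ]
      exact mul_le_of_le_one_right hδ.le (hφ1 _)
    have h2 := (ContinuousMap.dist_apply_le_dist x).trans_lt (hf' i)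
    have h3 := dist_triangle (δ * (φ (s i x) + τ)) (f' i x) (f i x)
    simp only [ContinuousMap.coe_mk]
    linarith
  · by_contra! hcon
    refine (hηX x hx).not_gt ((pi_norm_lt_iff hη).2 fun i => ?_)
    by_contra hi
    rw [not_lt, Real.norm_of_nonneg (abs_nonneg _)] at hi
    obtain ⟨k, hk⟩ := hφk _ hi
    exact hcon i k (by simp [hk])

theorem dense_setOf_iInter_image_eq_empty {n : ℕ} {X : Fin (n + 1) → Set K}
    (hX : ∀ a, IsClosed (X a)) (hd : Pairwise fun a b => Disjoint (X a) (X b))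
    (h : ∀ a, Avoidable (Fin n) (X a)) :
    Dense {f : C(K, Fin n → ℝ) | ∀ p ∈ univ.pi X, ∃ a b, f (p a) ≠ f (p b)} := by
  refine Metric.dense_iff.2 fun f ε hε => ?_
  let δ : ℝ := ε / (3 * (n + 2))
  have hδ : 0 < δ := by positivity
  choose g hg hgX using fun a => (h a).exists_near_mem_lattice (hX a)
    (fun i => ⟨fun x => f x i, by fun_prop⟩) hδ (a / (n + 1))
  have hu (a) := exists_continuous_zero_one_of_isClosed (s := ⋃ b : {b // b ≠ a}, X b) (t := X a)
    (isClosed_iUnion_of_finite fun b => hX b) (hX a)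
    (disjoint_iUnion_left.2 fun b => hd b.2)
  choose u hu0 hu1 hu using hu
  let G : C(K, Fin n → ℝ) :=
    ⟨fun x i => f x i + ∑ a, u a x * (g a i x - f x i), by fun_prop⟩
  have hG (a x) (hx : x ∈ X a) (i) : G x i = g a i x := by
    have h1 (b) (hb : b ≠ a) : u b x * (g b i x - f x i) = 0 := by
      rw [hu0 b (mem_iUnion.2 ⟨⟨a, hb.symm⟩, hx⟩), Pi.zero_apply, zero_mul]
    simp only [G, ContinuousMap.coe_mk]
    rw [Finset.sum_eq_single a (fun b _ hb => h1 b hb) (by simp), hu1 a hx]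
    simp
  refine ⟨G, ?_, fun p hp => ?_⟩
  · rw [mem_ball, ContinuousMap.dist_lt_iff hε]
    intro x
    rw [dist_pi_lt_iff hε]
    intro i
    have h1 (a) : |u a x * (g a i x - f x i)| ≤ 3 * δ := by
      have h2 : |g a i x - f x i| ≤ 3 * δ :=
        ((ContinuousMap.dist_apply_le_dist x).trans_lt (hg a i)).le
      rw [abs_mul, abs_of_nonneg (hu a x).1]
      exact (mul_le_of_le_one_left (abs_nonneg _) (hu a x).2).trans h2
    rw [Real.dist_eq]
    simp only [G, ContinuousMap.coe_mk, add_sub_cancel_left]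
    calc _ ≤ ∑ a, |u a x * (g a i x - f x i)| := Finset.abs_sum_le_sum_abs _ _
      _ ≤ ∑ a : Fin (n + 1), 3 * δ := Finset.sum_le_sum fun a _ => h1 a
      _ < ε := by
        simp only [Finset.sum_const, Finset.card_univ, Fintype.card_fin, nsmul_eq_mul, δ]
        push_cast
        field_simp
        linarith
  · by_contra! hcon
    choose i k hik using fun a => hgX a (p a) (hp a trivial)
    obtain ⟨a, b, hab, hiab⟩ := Fintype.exists_ne_map_eq_of_card_lt i (by simp)
    have h1 := hik a
    rw [← hG a _ (hp a trivial), hcon a b, hiab, hG b _ (hp b trivial), hik b] at h1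
    have h2 := mul_left_cancel₀ hδ.ne' h1
    field_simp at h2
    have h3 : k b * (n + 1) + (b : ℤ) = k a * (n + 1) + (a : ℤ) := by
      have : ((k b * (n + 1) + (b : ℤ) : ℤ) : ℝ) = ((k a * (n + 1) + (a : ℤ) : ℤ) : ℝ) := by
        push_cast
        linarith
      exact_mod_cast this
    have h4 := congrArg (· % ((n : ℤ) + 1)) h3
    simp only [mul_comm _ ((n : ℤ) + 1), Int.mul_add_emod_self_left] at h4
    rw [Int.emod_eq_of_lt (by omega) (by omega), Int.emod_eq_of_lt (by omega) (by omega)] at h4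
    exact hab (Fin.ext (by omega))

theorem isOpen_setOf_iInter_image_eq_empty {n : ℕ} {X : Fin (n + 1) → Set K}
    (hX : ∀ a, IsClosed (X a)) :
    IsOpen {f : C(K, Fin n → ℝ) | ∀ p ∈ univ.pi X, ∃ a b, f (p a) ≠ f (p b)} := by
  refine isOpen_setOf_forall_mem_compact
    (W := {q : C(K, Fin n → ℝ) × (Fin (n + 1) → K) | ∃ a b, q.1 (q.2 a) ≠ q.1 (q.2 b)})
    (isCompact_univ_pi fun a => (hX a).isCompact) ?_
  simp only [ofPred_exists]
  exact isOpen_iUnion fun a => isOpen_iUnion fun b => isOpen_ne_fun (by fun_prop) (by fun_prop)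

/-- A generic map into `ℝⁿ` is at most `n`-to-one on an `F_σ` set of dimension less than `n`. -/
theorem eventually_residual_finite_to_one {n : ℕ} {C : ℕ → Set K} (hC : ∀ i, IsClosed (C i))
    (h : indBelow n (⋃ i, C i : Set K)) :
    ∀ᶠ f : C(K, Fin n → ℝ) in residual C(K, Fin n → ℝ), ∀ y, (⇑f ⁻¹' {y} ∩ ⋃ i, C i).Finite := by
  have hbasis := isBasis_countableBasis K
  have : Countable (countableBasis K) := (countable_countableBasis K).to_subtype
  let X (q : (Fin (n + 1) → ℕ) × (Fin (n + 1) → countableBasis K)) (a : Fin (n + 1)) : Set K :=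
    C (q.1 a) ∩ closure (q.2 a)
  have hX (q a) : IsClosed (X q a) := (hC _).inter isClosed_closure
  have hgen : ∀ᶠ f : C(K, Fin n → ℝ) in residual C(K, Fin n → ℝ), ∀ q,
      (Pairwise fun a b => Disjoint (X q a) (X q b)) → ∀ p ∈ univ.pi (X q), ∃ a b, f (p a) ≠ f (p b) := by
    refine eventually_countable_forall.2 fun q => ?_
    by_cases hq : Pairwise fun a b => Disjoint (X q a) (X q b)
    · refine mem_of_superset (residual_of_dense_open (isOpen_setOf_iInter_image_eq_empty (hX q))
        (dense_setOf_iInter_image_eq_empty (hX q) hq fun a => ?_)) fun f hf _ => hf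
      exact avoidable_of_indBelow (hX q a)
        (h.subset (inter_subset_left.trans (subset_iUnion C _)))
    · exact .of_forall fun f h => (hq h).elim
  filter_upwards [hgen] with f hf y
  by_contra hinf
  let e := Set.Infinite.natEmbedding _ hinf
  let p (a : Fin (n + 1)) : K := e a
  have hp : Function.Injective p := fun a b hab =>
    Fin.ext (e.injective (Subtype.val_injective hab))
  obtain ⟨U, hU, hUd⟩ := (finite_range p).t2_separation
  choose B hB hpB hBU using fun a =>
    hbasis.exists_closure_subset ((hU (p a)).2.mem_nhds (hU (p a)).1)
  choose i hi using fun a => mem_iUnion.1 (e a).2.2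
  obtain ⟨a, b, hab⟩ := hf (fun a => i a, fun a => ⟨B a, hB a⟩) (fun a b hab =>
    (hUd (mem_range_self a) (mem_range_self b) (hp.ne hab)).mono
      (inter_subset_right.trans (hBU a)) (inter_subset_right.trans (hBU b))) p
    fun a _ => ⟨hi a, subset_closure (hpB a)⟩
  exact hab ((e a).2.1.trans (e b).2.1.symm)

theorem eventually_residual_indBelow_fiber {n e : ℕ}
    (h : indBelow (n + (e + 1)) (univ : Set K)) :
    ∀ᶠ f : C(K, Fin n → ℝ) in residual C(K, Fin n → ℝ), ∀ y, indBelow (e + 1) (⇑f ⁻¹' {y}) := by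
  obtain ⟨C, hC, hCn, hCe⟩ := exists_indBelow_iUnion_compl h
  filter_upwards [eventually_residual_finite_to_one hC hCn] with f hf y
  refine indBelow_of_diff_finite (isClosed_singleton.preimage f.continuous) (hf y) ?_
  exact hCe.subset fun x hx hxC => hx.2 ⟨hx.1, hxC⟩

/-- Truncation of a real number to the interval `[-r, r]`. -/
def clampAbs (r t : ℝ) : ℝ := max (-r) (min r t)

@[fun_prop]
theorem continuous_clampAbs (r : ℝ) : Continuous (clampAbs r) := by
  unfold clampAbs; fun_prop

theorem abs_clampAbs_le {r : ℝ} (hr : 0 ≤ r) (t : ℝ) : |clampAbs r t| ≤ r :=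
  abs_le.2 ⟨le_max_left _ _, max_le (by linarith) (min_le_left _ _)⟩

theorem clampAbs_eq_self {r t : ℝ} (h : |t| ≤ r) : clampAbs r t = t := by
  rw [clampAbs, min_eq_right (abs_le.1 h).2, max_eq_right (abs_le.1 h).1]

theorem exists_near_not_avoidable_preimage {n e : ℕ}
    (h : ¬ indBelow (n + e) (univ : Set K)) (f : C(K, Fin n → ℝ)) {ε : ℝ} (hε : 0 < ε) :
    ∃ c, ¬ Avoidable (Fin n ⊕ Fin e) (⇑f ⁻¹' closedBall c ε) := by
  by_contra! hcon
  have hcl (m : ℕ) : IsClosed (⇑f ⁻¹' closedBall (denseSeq (Fin n → ℝ) m) ε) :=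
    isClosed_closedBall.preimage f.continuous
  have hav := avoidable_iUnion hcl fun m => hcon _
  have huniv : (univ : Set K) ⊆ ⋃ m, ⇑f ⁻¹' closedBall (denseSeq (Fin n → ℝ) m) ε :=
    fun x _ => by
      obtain ⟨m, hm⟩ := (denseRange_denseSeq (Fin n → ℝ)).exists_dist_lt (f x) hε
      exact mem_iUnion.2 ⟨m, hm.le⟩
  exact h (((hav.mono huniv).reindex finSumFinEquiv.symm).indBelow isClosed_univ)

/-- Maps all of whose nearby maps have fibers of dimension at least `e` over a common ball
are dense. -/
theorem exists_near_stable_not_indBelow_fiber {n e : ℕ}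
    (h : ¬ indBelow (n + e) (univ : Set K)) (f : C(K, Fin n → ℝ)) {ε : ℝ} (hε : 0 < ε) :
    ∃ F : C(K, Fin n → ℝ), dist F f < ε ∧ ∃ r > 0, ∃ c, ∀ g, dist g F < r →
      ∀ y, dist y c < r → ¬ indBelow e (⇑g ⁻¹' {y}) := by
  obtain ⟨c, hc⟩ := exists_near_not_avoidable_preimage h f (show 0 < ε / 3 by positivity)
  simp only [Avoidable, not_forall, not_exists, not_and, exists_prop, not_not] at hc
  obtain ⟨p, δ, hδ, hp⟩ := hc
  set X : Set K := ⇑f ⁻¹' closedBall c (ε / 3)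
  obtain ⟨l, hl, hlp⟩ : ∃ l > 0, ∀ i x, |l * p (.inl i) x| ≤ ε / 3 := by
    let M := ‖fun i => p (.inl i)‖ + 1
    have hM : 0 < M := by positivity
    refine ⟨ε / 3 / M, by positivity, fun i x => ?_⟩
    have h1 : |p (.inl i) x| ≤ M := by
      have h2 := (p (.inl i)).norm_coe_le_norm x
      have h3 := norm_le_pi_norm (fun i => p (.inl i)) i
      rw [Real.norm_eq_abs] at h2
      simp only [M]
      linarith
    rw [abs_mul, abs_of_pos (by positivity), div_mul_eq_mul_div, div_le_iff₀ hM]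
    gcongr
  let F : C(K, Fin n → ℝ) :=
    ⟨fun x i => f x i + clampAbs (2 * (ε / 3)) (c i - f x i + l * p (.inl i) x), by fun_prop⟩
  have hF (x) (hx : x ∈ X) (i) : F x i = c i + l * p (.inl i) x := by
    have h1 : |c i - f x i| ≤ ε / 3 := by
      have := (dist_le_pi_dist (f x) c i).trans hx
      rwa [dist_comm, Real.dist_eq] at this
    have h2 : |c i - f x i + l * p (.inl i) x| ≤ 2 * (ε / 3) := by
      linarith [abs_add_le (c i - f x i) (l * p (.inl i) x), hlp i x]
    simp only [F, ContinuousMap.coe_mk, clampAbs_eq_self h2]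
    ring
  refine ⟨F, ?_, l * δ / 4, by positivity, c, fun g hg y hy hind => ?_⟩
  · rw [ContinuousMap.dist_lt_iff hε]
    intro x
    rw [dist_pi_lt_iff hε]
    intro i
    simp only [F, ContinuousMap.coe_mk, Real.dist_eq, add_sub_cancel_left]
    exact (abs_clampAbs_le (by positivity) _).trans_lt (by linarith)
  obtain ⟨q, hq, hqy⟩ := avoidable_of_indBelow (isClosed_singleton.preimage g.continuous) hind
    (fun i => p (.inr i)) δ hδ
  let G (i : Fin n) : C(K, ℝ) :=
    ⟨fun x => p (.inl i) x + clampAbs (δ / 2) (l⁻¹ * (g x i - y i) - p (.inl i) x), by fun_prop⟩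
  have hG (i) : dist (Sum.elim G q i) (p i) < δ := by
    rcases i with i | i
    · refine (ContinuousMap.dist_lt_iff hδ).2 fun x => ?_
      simp only [Sum.elim_inl, G, ContinuousMap.coe_mk, Real.dist_eq, add_sub_cancel_left]
      exact (abs_clampAbs_le (by positivity) _).trans_lt (by linarith)
    · exact hq i
  obtain ⟨x, hxX, hx0⟩ := hp (Sum.elim G q) hG
  refine (hqy x ?_).elim fun i hi => hi (hx0 (.inr i))
  refine funext fun i => ?_
  have h1 : |g x i - F x i| ≤ l * δ / 4 := by
    rw [← Real.dist_eq]
    exact ((dist_le_pi_dist (g x) (F x) i).trans (ContinuousMap.dist_apply_le_dist x)).trans hg.le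
  have h2 : |y i - c i| ≤ l * δ / 4 := by
    rw [← Real.dist_eq]
    exact (dist_le_pi_dist y c i).trans hy.le
  have h3 : l⁻¹ * (g x i - y i) - p (.inl i) x = l⁻¹ * ((g x i - F x i) - (y i - c i)) := by
    rw [hF x hxX i]
    field_simp
    ring
  have h4 : |l⁻¹ * (g x i - y i) - p (.inl i) x| ≤ δ / 2 := by
    rw [h3, abs_mul, abs_of_pos (inv_pos.2 hl), inv_mul_le_iff₀ hl]
    linarith [abs_sub (g x i - F x i) (y i - c i)]
  have h5 : G i x = 0 := hx0 (.inl i)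
  simp only [G, ContinuousMap.coe_mk, clampAbs_eq_self h4, add_sub_cancel] at h5
  exact sub_eq_zero.1 ((mul_eq_zero.1 h5).resolve_left (inv_ne_zero hl.ne'))

theorem eventually_residual_exists_not_indBelow_fiber {n e : ℕ}
    (h : ¬ indBelow (n + e) (univ : Set K)) :
    ∀ᶠ f : C(K, Fin n → ℝ) in residual C(K, Fin n → ℝ),
      ∃ U : Set (Fin n → ℝ), IsOpen U ∧ U.Nonempty ∧ ∀ y ∈ U, ¬ indBelow e (⇑f ⁻¹' {y}) := by
  let S : Set C(K, Fin n → ℝ) :=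
    {f | ∃ U : Set (Fin n → ℝ), IsOpen U ∧ U.Nonempty ∧ ∀ y ∈ U, ¬ indBelow e (⇑f ⁻¹' {y})}
  have hS : Dense (interior S) := by
    refine Metric.dense_iff.2 fun f ε hε => ?_
    obtain ⟨F, hFf, r, hr, c, hF⟩ := exists_near_stable_not_indBelow_fiber h f hε
    refine ⟨F, hFf, mem_interior_iff_mem_nhds.2 (mem_of_superset (ball_mem_nhds F hr) ?_)⟩
    exact fun g hg => ⟨ball c r, isOpen_ball, ⟨c, mem_ball_self hr⟩, hF g hg⟩
  exact mem_of_superset (residual_of_dense_open isOpen_interior hS) interior_subset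

theorem dStar_tdim_univ {n e : ℕ} (h : indBelow (n + (e + 1)) (univ : Set K))
    (h' : ¬ indBelow (n + e) (univ : Set K)) (hn : 0 < n) :
    dStar tdim n (univ : Set K) = e := by
  obtain ⟨n, rfl⟩ := Nat.exists_eq_succ_of_ne_zero hn.ne'
  refine le_antisymm ?_ (le_sInf ?_)
  · obtain ⟨C, hC, hCn, hCe⟩ := exists_indBelow_iUnion_compl h
    have hmem : tdim ((univ : Set K) \ ⋃ i, C i) ∈ {d : EReal | ∃ F : Set K,
        IsFSigmaIn F univ ∧ tdim F ≤ ((n + 1 : ℕ) : EReal) - 1 ∧ d = tdim (univ \ F)} :=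
      ⟨_, ⟨C, hC, by simp⟩, (indDim_le hCn).trans (natCast_succ_sub_one n).ge, rfl⟩
    exact (sInf_le hmem).trans (indDim_le (by rwa [← compl_eq_univ_sdiff]))
  · rintro _ ⟨_, ⟨C, hC, rfl⟩, hF, rfl⟩
    simp only [inter_univ] at hF ⊢
    refine le_indDim fun hd => h' (indBelow_univ_of_compl hC ?_ ?_)
    · by_contra hn
      have h1 := (le_indDim hn).trans hF
      rw [Nat.succ_eq_add_one, natCast_succ_sub_one] at h1
      exact absurd (Nat.cast_le.1 h1) (by omega)
    · rwa [compl_eq_univ_sdiff]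

end Avoidable

/-- If `n ≤ dim_T K < ∞` then for a generic `f ∈ C(K,ℝⁿ)` there is a non-empty open set of
values whose fibers have topological dimension exactly `d^n_T(K)`. -/
theorem stmt14 (n : ℕ) (hn : 0 < n) (K : Type*) [MetricSpace K] [CompactSpace K]
    (hK : (n : EReal) ≤ tdim (Set.univ : Set K)) (hK' : tdim (Set.univ : Set K) < ⊤) :
    ∀ᶠ (f : C(K, Fin n → ℝ)) in residual C(K, Fin n → ℝ),
      ∃ U : Set (Fin n → ℝ), IsOpen U ∧ U.Nonempty ∧
        ∀ y ∈ U, tdim (⇑f ⁻¹' {y}) = dStar tdim n (Set.univ : Set K) := by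
  obtain ⟨N, hN, hmin⟩ : ∃ N, indBelow N (univ : Set K) ∧
      ∀ m < N, ¬ indBelow m (univ : Set K) := by
    classical
    have hex : ∃ N, indBelow N (univ : Set K) := by
      obtain ⟨_, ⟨N, hN, -⟩, -⟩ := sInf_lt_iff.1 hK'
      exact ⟨N, hN⟩
    exact ⟨Nat.find hex, Nat.find_spec hex, fun m hm => Nat.find_min hex hm⟩
  have hnN : n < N := by
    by_contra! hle
    obtain ⟨m, rfl⟩ := Nat.exists_eq_succ_of_ne_zero hn.ne'
    have h1 := hK.trans (indDim_le (hN.mono hle))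
    exact absurd (Nat.cast_le.1 h1) (by omega)
  obtain ⟨e, rfl⟩ := Nat.exists_eq_add_of_lt hnN
  have hlow := hmin (n + e) (by omega)
  rw [dStar_tdim_univ (n := n) (e := e) hN hlow hn]
  filter_upwards [eventually_residual_indBelow_fiber (n := n) (e := e) hN,
    eventually_residual_exists_not_indBelow_fiber (n := n) (e := e) hlow] with f hf hfU
  obtain ⟨U, hU, hUne, hUf⟩ := hfU
  exact ⟨U, hU, hUne, fun y hy => le_antisymm (indDim_le (hf y)) (le_indDim (hUf y hy))⟩
end
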